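/- μ classifies the nondegenerate components: let A, A' : [0,1] → Sp(E) be continuous paths of symplectic automorphisms of a real symplectic vector space (E, ω) with A(0) = A'(0) = I, ker(A(1) − I) = {0} and ker(A'(1) − I) = {0}. Then there exists a continuous homotopy H : [0,1] × [0,1] → Sp(E) with H(0,·) = A, H(1,·) = A', H(s,0) = I and ker(H(s,1) − I) = {0} for all s ∈ [0,1], if and only if μ(A) = μ(A'). -/

import Mathlib

open LinearMap (BilinForm)

variable {E : Type*} [NormedAddCommGroup E] [NormedSpace ℝ E]

/-- A subspace is Lagrangian iff it equals its symplectic orthogonal. -/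
def IsLagrangian (ω : BilinForm ℝ E) (L : Submodule ℝ E) : Prop :=
  LinearMap.BilinForm.orthogonal ω L = L

/-- Maximal dimension of a subspace on which the function `Q` is positive away from `0`. -/
noncomputable def posIndex {V : Type*} [AddCommGroup V] [Module ℝ V] (Q : V → ℝ) : ℕ :=
  sSup {d : ℕ | ∃ W : Submodule ℝ V, Module.finrank ℝ W = d ∧ ∀ x ∈ W, x ≠ 0 → 0 < Q x}

/-- The quadratic form `Q(L1,L2,L3)` of a triplet of subspaces,
`Q(x1,x2,x3) = ω(x1,x2) + ω(x2,x3) + ω(x3,x1)`. -/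
def tripleQ (ω : BilinForm ℝ E) (L1 L2 L3 : Submodule ℝ E) (v : L1 × L2 × L3) : ℝ :=
  ω v.1 v.2.1 + ω v.2.1 v.2.2 + ω v.2.2 v.1

/-- The signature `s(L1,L2,L3)` of a triplet of subspaces: the signature (number of positive
squares minus number of negative squares in a diagonalization) of `Q(L1,L2,L3)`. -/
noncomputable def tripleSig (ω : BilinForm ℝ E) (L1 L2 L3 : Submodule ℝ E) : ℤ :=
  (posIndex (tripleQ ω L1 L2 L3) : ℤ) - (posIndex (fun v => - tripleQ ω L1 L2 L3 v) : ℤ)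

/-- A continuous path of Lagrangian subspaces of `(E, ω)` on the interval `[a,b]`:  a family
`(L t)` of Lagrangian subspaces such that every `t0 ∈ [a,b]` has a neighbourhood `U` in `[a,b]`
on which there is a continuous family of idempotent linear maps of `E` with range `L t`. -/
structure IsLagrangianPath (ω : BilinForm ℝ E) (a b : ℝ) (L : ℝ → Submodule ℝ E) : Prop where
  lag : ∀ t ∈ Set.Icc a b, IsLagrangian ω (L t)
  locTriv : ∀ t0 ∈ Set.Icc a b, ∃ U ∈ nhdsWithin t0 (Set.Icc a b), U ⊆ Set.Icc a b ∧
    ∃ P : ℝ → E →L[ℝ] E, ContinuousOn P U ∧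
      ∀ t ∈ U, (P t).comp (P t) = P t ∧ LinearMap.range (P t : E →ₗ[ℝ] E) = L t

/-- A jointly continuous two-parameter family `(L s t)`, `s ∈ [0,1]`, `t ∈ [a,b]`, of Lagrangian
subspaces (a homotopy of paths of Lagrangian subspaces). -/
structure IsLagrangianHomotopy (ω : BilinForm ℝ E) (a b : ℝ)
    (L : ℝ → ℝ → Submodule ℝ E) : Prop where
  lag : ∀ s ∈ Set.Icc (0:ℝ) 1, ∀ t ∈ Set.Icc a b, IsLagrangian ω (L s t)
  locTriv : ∀ p ∈ Set.Icc (0:ℝ) 1 ×ˢ Set.Icc a b,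
    ∃ U ∈ nhdsWithin p (Set.Icc (0:ℝ) 1 ×ˢ Set.Icc a b),
      U ⊆ Set.Icc (0:ℝ) 1 ×ˢ Set.Icc a b ∧
      ∃ P : ℝ × ℝ → E →L[ℝ] E, ContinuousOn P U ∧
        ∀ q ∈ U, (P q).comp (P q) = P q ∧ LinearMap.range (P q : E →ₗ[ℝ] E) = L q.1 q.2

/-- Admissible data for a pair of paths of Lagrangian subspaces on `[a,b]`:  a partition
`a = t_0 ≤ t_1 ≤ … ≤ t_k = b` together with Lagrangian subspaces `M_1, …, M_k` such that
`M_ν ∩ L_i(t) = 0` for all `t ∈ [t_{ν-1}, t_ν]`, `i = 1,2`.  (Here `M (ν+1)` plays the role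
of `M_{ν+1}` for `0 ≤ ν < k`.) -/
structure AdmissibleData (ω : BilinForm ℝ E) (a b : ℝ) (L1 L2 : ℝ → Submodule ℝ E) where
  k : ℕ
  kpos : 0 < k
  t : ℕ → ℝ
  M : ℕ → Submodule ℝ E
  ht0 : t 0 = a
  htk : t k = b
  hmono : ∀ ν < k, t ν ≤ t (ν + 1)
  hlag : ∀ ν < k, IsLagrangian ω (M (ν + 1))
  htrans1 : ∀ ν < k, ∀ s ∈ Set.Icc (t ν) (t (ν + 1)), M (ν + 1) ⊓ L1 s = ⊥
  htrans2 : ∀ ν < k, ∀ s ∈ Set.Icc (t ν) (t (ν + 1)), M (ν + 1) ⊓ L2 s = ⊥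

/-- The expression `(1/2) Σ_ν ( s(L1(t_{ν-1}), L2(t_{ν-1}), M_ν) − s(L1(t_ν), L2(t_ν), M_ν) )`
computed from admissible data; by well-definedness this is the intersection number `[L1 : L2]`. -/
noncomputable def dataSum {ω : BilinForm ℝ E} {a b : ℝ} {L1 L2 : ℝ → Submodule ℝ E}
    (D : AdmissibleData ω a b L1 L2) : ℝ :=
  (1 / 2 : ℝ) * ∑ ν ∈ Finset.range D.k,
    ((tripleSig ω (L1 (D.t ν)) (L2 (D.t ν)) (D.M (ν + 1)) : ℝ)
      - (tripleSig ω (L1 (D.t (ν + 1))) (L2 (D.t (ν + 1))) (D.M (ν + 1)) : ℝ))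

/-- A continuous path of symplectic automorphisms of `(E, ω)` on `[a,b]`. -/
structure IsSymplecticPath (ω : BilinForm ℝ E) (a b : ℝ) (A : ℝ → E →L[ℝ] E) : Prop where
  bij : ∀ t ∈ Set.Icc a b, Function.Bijective (A t)
  symp : ∀ t ∈ Set.Icc a b, ∀ x y, ω (A t x) (A t y) = ω x y
  cont : ContinuousOn A (Set.Icc a b)

/-- The symplectic form of `E × E⁻`: `((x1,x2),(y1,y2)) ↦ ω(x1,y1) − ω(x2,y2)`. -/
noncomputable def prodNegForm (ω : BilinForm ℝ E) : BilinForm ℝ (E × E) :=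
  LinearMap.mk₂ ℝ (fun x y => ω x.1 y.1 - ω x.2 y.2)
    (fun x x' y => by simp only [Prod.fst_add, Prod.snd_add, map_add, LinearMap.add_apply]; ring)
    (fun c x y => by
      simp only [Prod.smul_fst, Prod.smul_snd, map_smul, LinearMap.smul_apply, smul_eq_mul]; ring)
    (fun x y y' => by simp only [Prod.fst_add, Prod.snd_add, map_add]; ring)
    (fun c x y => by simp only [Prod.smul_fst, Prod.smul_snd, map_smul, smul_eq_mul]; ring)

/-- The graph `Γ_A = {(A x, x)}` of an endomorphism, as a subspace of `E × E`. -/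
def graphSub (A : E →L[ℝ] E) : Submodule ℝ (E × E) :=
  LinearMap.range ((A : E →ₗ[ℝ] E).prod LinearMap.id)

/-- The diagonal `Δ = {(x, x)}` in `E × E`. -/
def diagSub : Submodule ℝ (E × E) :=
  LinearMap.range ((LinearMap.id : E →ₗ[ℝ] E).prod LinearMap.id)

section QuadraticSignature

variable {V V₁ V₂ : Type*} [AddCommGroup V] [Module ℝ V] [AddCommGroup V₁] [Module ℝ V₁]
  [AddCommGroup V₂] [Module ℝ V₂]

/-- The signature of a real quadratic form. -/
noncomputable def sgn (Q : QuadraticForm ℝ V) : ℤ := (sigPos Q : ℤ) - (sigNeg Q : ℤ)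

theorem posIndex_eq_sigPos [FiniteDimensional ℝ V] (Q : QuadraticForm ℝ V) :
    posIndex (fun v => Q v) = sigPos Q := by
  rw [posIndex, ← (sigPos_isGreatest Q).csSup_eq]
  congr 1
  ext d
  constructor
  · rintro ⟨W, h, hW⟩
    exact ⟨W, h, fun x hx => hW x x.2 (by simpa using hx)⟩
  · rintro ⟨W, h, hW⟩
    exact ⟨W, h, fun x hx h0 => hW ⟨x, hx⟩ (by simpa using h0)⟩

theorem sgn_eq_posIndex [FiniteDimensional ℝ V] (Q : QuadraticForm ℝ V) :
    (posIndex (fun v => Q v) : ℤ) - (posIndex (fun v => - Q v) : ℤ) = sgn Q := by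
  rw [sgn, posIndex_eq_sigPos, ← sigPos_neg, ← posIndex_eq_sigPos (-Q)]
  rfl

theorem sgn_congr {Q : QuadraticForm ℝ V} {Q₁ : QuadraticForm ℝ V₁} (e : V ≃ₗ[ℝ] V₁)
    (h : ∀ v, Q₁ (e v) = Q v) : sgn Q = sgn Q₁ := by
  have : QuadraticMap.Equivalent Q Q₁ := ⟨⟨e, h⟩⟩
  rw [sgn, sgn, this.sigPos_eq, this.sigNeg_eq]

theorem sgn_neg (Q : QuadraticForm ℝ V) : sgn (-Q) = - sgn Q := by
  rw [sgn, sgn, sigPos_neg, sigNeg_neg]; ring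

theorem sgn_eq_zero_of_neg {Q : QuadraticForm ℝ V} (e : V ≃ₗ[ℝ] V)
    (h : ∀ v, Q (e v) = - Q v) : sgn Q = 0 := by
  have := sgn_congr (Q := -Q) (Q₁ := Q) e (by simpa using h)
  rw [sgn_neg] at this
  linarith

theorem finrank_le_sigPos [FiniteDimensional ℝ V] {Q : QuadraticForm ℝ V}
    (f : V₁ →ₗ[ℝ] V) (h : ∀ u, u ≠ 0 → 0 < Q (f u)) : Module.finrank ℝ V₁ ≤ sigPos Q := by
  have hf : Function.Injective f := by
    refine (injective_iff_map_eq_zero f).2 fun u hu => ?_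
    by_contra h0
    simpa [hu] using h u h0
  rw [← LinearMap.finrank_range_of_inj hf]
  refine le_sigPos_of_posDef Q fun x hx => ?_
  obtain ⟨x, u, rfl⟩ := x
  refine h u ?_
  rintro rfl
  simp at hx

theorem exists_submodule_sigPos [FiniteDimensional ℝ V] (Q : QuadraticForm ℝ V) :
    ∃ W : Submodule ℝ V, Module.finrank ℝ W = sigPos Q ∧ ∀ x : W, x ≠ 0 → 0 < Q x := by
  obtain ⟨W, h, hW⟩ := exists_finrank_eq_sigPos_and_posDef Q
  exact ⟨W, h, fun x hx => hW x hx⟩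

theorem sigPos_prod_ge [FiniteDimensional ℝ V₁] [FiniteDimensional ℝ V₂]
    (Q₁ : QuadraticForm ℝ V₁) (Q₂ : QuadraticForm ℝ V₂) :
    sigPos Q₁ + sigPos Q₂ ≤ sigPos (Q₁.prod Q₂) := by
  obtain ⟨W₁, h₁, hW₁⟩ := exists_submodule_sigPos Q₁
  obtain ⟨W₂, h₂, hW₂⟩ := exists_submodule_sigPos Q₂
  rw [← h₁, ← h₂, ← Module.finrank_prod]
  refine finrank_le_sigPos (W₁.subtype.prodMap W₂.subtype) ?_
  rintro ⟨x, y⟩ h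
  simp only [LinearMap.prodMap_apply, QuadraticMap.prod_apply, Submodule.subtype_apply]
  by_cases hx : x = 0
  · have hy : y ≠ 0 := fun hy => h (by simp [hx, hy])
    simpa [hx] using hW₂ y hy
  · by_cases hy : y = 0
    · simpa [hy] using hW₁ x hx
    · exact add_pos (hW₁ x hx) (hW₂ y hy)

theorem mem_radical_iff_polar {Q : QuadraticForm ℝ V} {v : V} :
    v ∈ Q.radical ↔ ∀ w, QuadraticMap.polar Q v w = 0 := by
  rw [QuadraticMap.radical_eq_ker_polarBilin, LinearMap.mem_ker]
  constructor
  · intro h w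
    exact LinearMap.congr_fun h w
  · intro h
    ext w
    exact h w

theorem sgn_prod [FiniteDimensional ℝ V₁] [FiniteDimensional ℝ V₂]
    (Q₁ : QuadraticForm ℝ V₁) (Q₂ : QuadraticForm ℝ V₂) :
    sgn (Q₁.prod Q₂) = sgn Q₁ + sgn Q₂ := by
  have hp := sigPos_prod_ge Q₁ Q₂
  have hn := sigPos_prod_ge (-Q₁) (-Q₂)
  have hneg : (-Q₁).prod (-Q₂) = -(Q₁.prod Q₂) := by
    ext x
    simp [QuadraticMap.prod_apply]; ring
  rw [hneg, sigPos_neg, sigPos_neg, sigPos_neg] at hn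
  have hr : Module.finrank ℝ Q₁.radical + Module.finrank ℝ Q₂.radical
      ≤ Module.finrank ℝ (Q₁.prod Q₂).radical := by
    rw [← Module.finrank_prod]
    refine LinearMap.finrank_le_finrank_of_injective
      (f := (Q₁.radical.subtype.prodMap Q₂.radical.subtype).codRestrict _ ?_) ?_
    · rintro ⟨⟨x, hx⟩, ⟨y, hy⟩⟩
      rw [mem_radical_iff_polar] at hx hy ⊢
      rintro ⟨a, b⟩
      have h1 := hx a
      have h2 := hy b
      simp only [QuadraticMap.polar, QuadraticMap.prod_apply, LinearMap.prodMap_apply,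
        Submodule.subtype_apply, Prod.fst_add, Prod.snd_add] at h1 h2 ⊢
      linarith
    · intro x y h
      have := congrArg Subtype.val h
      simp only [LinearMap.codRestrict_apply, LinearMap.prodMap_apply, Submodule.subtype_apply,
        Prod.mk.injEq, Subtype.val_inj] at this
      exact Prod.ext this.1 this.2
  have e := QuadraticForm.sigPos_add_sigNeg_add_radical (Q := Q₁.prod Q₂)
  have e₁ := QuadraticForm.sigPos_add_sigNeg_add_radical (Q := Q₁)
  have e₂ := QuadraticForm.sigPos_add_sigNeg_add_radical (Q := Q₂)
  rw [Module.finrank_prod] at e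
  simp only [sgn]
  omega

end QuadraticSignature

section LocallyConstantSignature

variable {V : Type*} [NormedAddCommGroup V] [NormedSpace ℝ V] [FiniteDimensional ℝ V]
  {X : Type*} [TopologicalSpace X]

theorem eventually_sigPos_ge (Q : X → QuadraticForm ℝ V)
    (hQ : Continuous fun p : X × V => Q p.1 p.2) (x₀ : X) :
    ∀ᶠ x in nhds x₀, sigPos (Q x₀) ≤ sigPos (Q x) := by
  obtain ⟨W, h, hW⟩ := exists_submodule_sigPos (Q x₀)
  have hc : IsCompact (Metric.sphere (0 : W) 1) := isCompact_sphere _ _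
  have hpos : ∀ᶠ x in nhds x₀, ∀ w ∈ Metric.sphere (0 : W) 1, 0 < Q x w := by
    refine hc.eventually_forall_of_forall_eventually fun w hw => ?_
    have hcont : Continuous fun p : X × W => Q p.1 p.2 := by
      exact hQ.comp (by fun_prop : Continuous fun p : X × W => (p.1, (p.2 : V)))
    refine hcont.continuousAt.eventually (lt_mem_nhds ?_)
    refine hW w ?_
    rintro rfl
    simp at hw
  filter_upwards [hpos] with x hx
  rw [← h]
  refine finrank_le_sigPos W.subtype fun u hu => ?_
  have hn : 0 < ‖u‖ := norm_pos_iff.2 hu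
  have := hx (‖u‖⁻¹ • u) (by
    rw [mem_sphere_zero_iff_norm, norm_smul, norm_inv, norm_norm, inv_mul_cancel₀ hn.ne'])
  rw [Submodule.coe_smul, QuadraticMap.map_smul] at this
  exact pos_of_mul_pos_right (by simpa using this) (by positivity)

theorem eventually_sgn_eq (Q : X → QuadraticForm ℝ V)
    (hQ : Continuous fun p : X × V => Q p.1 p.2) (x₀ : X)
    (hnd : ∀ v, (∀ w, QuadraticMap.polar (Q x₀) v w = 0) → v = 0) :
    ∀ᶠ x in nhds x₀, sgn (Q x) = sgn (Q x₀) := by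
  have h1 := eventually_sigPos_ge Q hQ x₀
  have h2 := eventually_sigPos_ge (fun x => - Q x)
    hQ.neg x₀
  have hr : (Q x₀).radical = ⊥ := by
    rw [eq_bot_iff]
    intro v hv
    exact hnd v (mem_radical_iff_polar.1 hv)
  have e := QuadraticForm.sigPos_add_sigNeg_add_radical (Q := Q x₀)
  rw [hr, finrank_bot] at e
  filter_upwards [h1, h2] with x h1 h2
  have e' := QuadraticForm.sigPos_add_sigNeg_add_radical (Q := Q x)
  rw [sigPos_neg, sigPos_neg] at h2
  simp only [sgn]
  omega

end LocallyConstantSignature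

section TripleSignature

variable {V : Type*} [NormedAddCommGroup V] [NormedSpace ℝ V]

theorem isAlt_skew {Ω : BilinForm ℝ V} (halt : Ω.IsAlt) (x y : V) : Ω x y = - Ω y x :=
  (LinearMap.BilinForm.IsAlt.neg_eq halt y x).symm

theorem IsLagrangian.isotropic {Ω : BilinForm ℝ V} {L : Submodule ℝ V} (hL : IsLagrangian Ω L)
    {x y : V} (hx : x ∈ L) (hy : y ∈ L) : Ω x y = 0 := by
  rw [← hL] at hy
  exact LinearMap.BilinForm.mem_orthogonal_iff.1 hy x hx

theorem IsLagrangian.mem {Ω : BilinForm ℝ V} {L : Submodule ℝ V} (hL : IsLagrangian Ω L)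
    {y : V} (h : ∀ x ∈ L, Ω x y = 0) : y ∈ L := by
  rw [← hL]
  exact LinearMap.BilinForm.mem_orthogonal_iff.2 h

theorem eq_zero_of_inf_eq_bot {L M : Submodule ℝ V} (h : L ⊓ M = ⊥) {x : V} (hL : x ∈ L)
    (hM : x ∈ M) : x = 0 := by
  rw [← Submodule.mem_bot ℝ, ← h]
  exact ⟨hL, hM⟩

/-- `π` is the projection onto `L` along `M`, when these are complementary. -/
def IsProjAlong (π : V →ₗ[ℝ] V) (L M : Submodule ℝ V) : Prop :=
  ∀ v, π v ∈ L ∧ v - π v ∈ M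

theorem IsLagrangian.exists_isProjAlong [FiniteDimensional ℝ V] {Ω : BilinForm ℝ V}
    (hnd : Ω.Nondegenerate) {L M : Submodule ℝ V} (hL : IsLagrangian Ω L)
    (hM : IsLagrangian Ω M) (h : M ⊓ L = ⊥) : ∃ π, IsProjAlong π L M := by
  have e1 := LinearMap.BilinForm.finrank_orthogonal hnd L
  have e2 := LinearMap.BilinForm.finrank_orthogonal hnd M
  rw [hL] at e1
  rw [hM] at e2
  have l1 := Submodule.finrank_le L
  have l2 := Submodule.finrank_le M
  have hd : Disjoint L M := (disjoint_iff.2 h).symm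
  have htop : L ⊔ M = ⊤ := Submodule.eq_top_of_disjoint L M (by omega) hd
  have hc : IsCompl L M := ⟨hd, codisjoint_iff.2 htop⟩
  exact ⟨L.projection M hc, fun v =>
    ⟨L.projection_apply_mem hc v, L.sub_projection_mem hc v⟩⟩

theorem IsProjAlong.map_eq_zero {π : V →ₗ[ℝ] V} {L M : Submodule ℝ V} (hπ : IsProjAlong π L M)
    (h : M ⊓ L = ⊥) {m : V} (hm : m ∈ M) : π m = 0 := by
  refine eq_zero_of_inf_eq_bot h ?_ (hπ m).1
  simpa using M.sub_mem hm (hπ m).2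

theorem IsProjAlong.map_eq_self {π : V →ₗ[ℝ] V} {L M : Submodule ℝ V} (hπ : IsProjAlong π L M)
    (h : M ⊓ L = ⊥) {x : V} (hx : x ∈ L) : π x = x := by
  refine (sub_eq_zero.1 (eq_zero_of_inf_eq_bot h (hπ x).2 ?_)).symm
  exact L.sub_mem hx (hπ x).1

/-- The quadratic form `v ↦ Ω(π v, v)`. -/
noncomputable def projForm (Ω : BilinForm ℝ V) (π : V →ₗ[ℝ] V) : QuadraticForm ℝ V :=
  LinearMap.BilinMap.toQuadraticMap (Ω ∘ₗ π)

theorem projForm_apply (Ω : BilinForm ℝ V) (π : V →ₗ[ℝ] V) (v : V) :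
    projForm Ω π v = Ω (π v) v := rfl

theorem polar_projForm (Ω : BilinForm ℝ V) (π : V →ₗ[ℝ] V) (v w : V) :
    QuadraticMap.polar (projForm Ω π) v w = Ω (π v) w + Ω (π w) v := by
  simp only [QuadraticMap.polar, projForm_apply, map_add, LinearMap.add_apply]; ring

/-- For complementary Lagrangians, `Ω(v, w) = Ω(π v, w) - Ω(π w, v)`. -/
theorem IsProjAlong.form_eq {Ω : BilinForm ℝ V} (halt : Ω.IsAlt) {L M : Submodule ℝ V}
    (hL : IsLagrangian Ω L) (hM : IsLagrangian Ω M) {π : V →ₗ[ℝ] V} (hπ : IsProjAlong π L M)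
    (v w : V) : Ω v w = Ω (π v) w - Ω (π w) v := by
  have h1 := hL.isotropic (hπ v).1 (hπ w).1
  have h2 := hM.isotropic (hπ v).2 (hπ w).2
  have h3 : Ω v (π w) = - Ω (π w) v := isAlt_skew halt _ _
  simp only [map_sub, LinearMap.sub_apply] at h2
  linarith

/-- The triple signature with a Lagrangian transverse to the first one, in terms of the
projection form. -/
theorem tripleSig_eq_sgn [FiniteDimensional ℝ V] [FiniteDimensional ℝ E] {Ω : BilinForm ℝ V}
    (halt : Ω.IsAlt)
    {L M : Submodule ℝ V} (hL : IsLagrangian Ω L) (hM : IsLagrangian Ω M)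
    {π : V →ₗ[ℝ] V} (hπ : IsProjAlong π L M) (γ : E →ₗ[ℝ] V) (hγ : Function.Injective γ) :
    tripleSig Ω L (LinearMap.range γ) M = sgn ((projForm Ω π).comp γ) := by
  let πL : V →ₗ[ℝ] L := π.codRestrict L fun v => (hπ v).1
  let πM : V →ₗ[ℝ] M := (LinearMap.id - π).codRestrict M fun v => (hπ v).2
  let g : E ≃ₗ[ℝ] LinearMap.range γ := LinearEquiv.ofInjective γ hγ
  let e : (E × (M × L)) ≃ₗ[ℝ] (L × LinearMap.range γ × M) :=
    { toFun := fun p => (p.2.2 + πL (γ p.1), g p.1, p.2.1 + πM (γ p.1))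
      map_add' := fun p q => by
        simp only [Prod.fst_add, Prod.snd_add, map_add, Prod.mk_add_mk, Prod.mk.injEq, true_and]
        constructor <;> abel
      map_smul' := fun c p => by
        simp [smul_add]
      invFun := fun q => (g.symm q.2.1, (q.2.2 - πM q.2.1, q.1 - πL q.2.1))
      left_inv := fun p => by
        have : (g p.1 : V) = γ p.1 := rfl
        simp [this]
      right_inv := fun q => by
        have : γ (g.symm q.2.1) = q.2.1 := congrArg Subtype.val (g.apply_symm_apply q.2.1)
        simp [this] }
  let H : QuadraticForm ℝ (M × L) := LinearMap.BilinMap.toQuadraticMap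
    (Ω.compl₁₂ (M.subtype ∘ₗ LinearMap.fst ℝ M L) (L.subtype ∘ₗ LinearMap.snd ℝ M L))
  have hH : ∀ p : M × L, H p = Ω p.1 p.2 := fun p => rfl
  let T : QuadraticForm ℝ (L × LinearMap.range γ × M) :=
    (((projForm Ω π).comp γ).prod H).comp (e.symm : _ →ₗ[ℝ] _)
  have hT : ∀ q, tripleQ Ω L (LinearMap.range γ) M q = T q := by
    intro q
    obtain ⟨⟨y, ⟨a, b⟩⟩, rfl⟩ := e.surjective q
    have h1 : T (e (y, (a, b))) = Ω (π (γ y)) (γ y) + Ω a b := by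
      change (((projForm Ω π).comp γ).prod H) (e.symm (e (y, (a, b)))) = _
      rw [e.symm_apply_apply]
      rfl
    have h2 : tripleQ Ω L (LinearMap.range γ) M (e (y, (a, b)))
        = Ω (b + π (γ y)) (γ y) + Ω (γ y) (a + (γ y - π (γ y)))
          + Ω (a + (γ y - π (γ y))) (b + π (γ y)) := rfl
    rw [h1, h2]
    have hu := (hπ (γ y)).1
    have hm := (hπ (γ y)).2
    generalize π (γ y) = u at hu hm ⊢
    obtain ⟨m, hm'⟩ : ∃ m, m = γ y - u := ⟨_, rfl⟩
    rw [← hm'] at hm ⊢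
    have hz : γ y = u + m := by rw [hm']; abel
    rw [hz]
    have i1 := hL.isotropic b.2 hu
    have i2 := hL.isotropic hu hu
    have i3 := hM.isotropic hm a.2
    have i4 := hM.isotropic hm hm
    have s1 := isAlt_skew halt m b
    have s2 := isAlt_skew halt a u
    have s3 := isAlt_skew halt m u
    simp only [map_add, LinearMap.add_apply]
    linarith
  have h0 : tripleQ Ω L (LinearMap.range γ) M = fun q => T q := funext hT
  rw [tripleSig, h0, sgn_eq_posIndex, sgn_congr (Q := T) (Q₁ := ((projForm Ω π).comp γ).prod H) e.symm (fun v => rfl), sgn_prod]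
  have : sgn H = 0 := by
    refine sgn_eq_zero_of_neg ((LinearEquiv.refl ℝ M).prodCongr (LinearEquiv.neg ℝ)) fun p => ?_
    simp [hH]
  rw [this, add_zero]

/-- The auxiliary form on `E × M` comparing the projection forms of two complements. -/
noncomputable def comparisonForm (Ω : BilinForm ℝ V) (π π' : V →ₗ[ℝ] V) (M : Submodule ℝ V)
    (γ : E →ₗ[ℝ] V) : QuadraticForm ℝ (E × M) :=
  LinearMap.BilinMap.toQuadraticMap
    (- (Ω ∘ₗ π).compl₁₂ (γ ∘ₗ LinearMap.fst ℝ E M) (γ ∘ₗ LinearMap.fst ℝ E M)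
      + (2:ℝ) • Ω.compl₁₂ (γ ∘ₗ LinearMap.fst ℝ E M) (M.subtype ∘ₗ LinearMap.snd ℝ E M)
      + (Ω ∘ₗ (π' - π)).compl₁₂ (M.subtype ∘ₗ LinearMap.snd ℝ E M)
          (M.subtype ∘ₗ LinearMap.snd ℝ E M))

theorem comparisonForm_apply (Ω : BilinForm ℝ V) (π π' : V →ₗ[ℝ] V) (M : Submodule ℝ V)
    (γ : E →ₗ[ℝ] V) (p : E × M) : comparisonForm Ω π π' M γ p
      = - Ω (π (γ p.1)) (γ p.1) + 2 * Ω (γ p.1) p.2 + Ω (π' p.2 - π p.2) p.2 := rfl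

theorem sgn_projForm_comp_eq_add [FiniteDimensional ℝ V] [FiniteDimensional ℝ E]
    {Ω : BilinForm ℝ V} (halt : Ω.IsAlt)
    {L M M' : Submodule ℝ V} (hL : IsLagrangian Ω L) (hM : IsLagrangian Ω M)
    (hM' : IsLagrangian Ω M') (h : M ⊓ L = ⊥) (h' : M' ⊓ L = ⊥)
    {π π' : V →ₗ[ℝ] V} (hπ : IsProjAlong π L M) (hπ' : IsProjAlong π' L M')
    (γ : E →ₗ[ℝ] V) (hγ : IsLagrangian Ω (LinearMap.range γ)) {ρ : V →ₗ[ℝ] E}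
    (hρ : ∀ v, v - γ (ρ v) ∈ M) :
    sgn ((projForm Ω π').comp γ)
      = sgn ((projForm Ω π).comp γ) + sgn (comparisonForm Ω π π' M γ) := by
  let πM : V →ₗ[ℝ] M := (LinearMap.id - π).codRestrict M fun v => (hπ v).2
  let H : QuadraticForm ℝ (E × M) := LinearMap.BilinMap.toQuadraticMap
    (Ω.compl₁₂ (γ ∘ₗ LinearMap.fst ℝ E M) ((2:ℝ) • M.subtype ∘ₗ LinearMap.snd ℝ E M))
  have hH0 : ∀ p : E × M, H p = 2 * Ω (γ p.1) p.2 := fun p => by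
    simp [H]
  have hH : sgn H = 0 := by
    refine sgn_eq_zero_of_neg ((LinearEquiv.refl ℝ E).prodCongr (LinearEquiv.neg ℝ)) fun p => ?_
    simp [hH0]
  rw [← sgn_prod, ← add_zero (sgn ((projForm Ω π').comp γ)), ← hH, ← sgn_prod]
  let τ : E × M →ₗ[ℝ] E := ρ ∘ₗ (π' - π) ∘ₗ ((1/2 : ℝ) • M.subtype ∘ₗ LinearMap.snd ℝ E M
    - (M.subtype ∘ₗ πM) ∘ₗ γ ∘ₗ LinearMap.fst ℝ E M)
  let e : (E × (E × M)) ≃ₗ[ℝ] (E × (E × M)) :=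
    { toFun := fun p => (p.1 + (p.2.1 - τ (p.1, p.2.2)),
        (p.2.1 - τ (p.1, p.2.2), p.2.2 - πM (γ p.1)))
      map_add' := fun p q => by
        have := τ.map_add (p.1, p.2.2) (q.1, q.2.2)
        rw [Prod.mk_add_mk] at this
        simp only [Prod.fst_add, Prod.snd_add, map_add, Prod.mk_add_mk, Prod.mk.injEq, this]
        refine ⟨?_, ?_, ?_⟩ <;> abel
      map_smul' := fun c p => by
        have := τ.map_smul c (p.1, p.2.2)
        rw [Prod.smul_mk] at this
        simp only [Prod.smul_fst, Prod.smul_snd, map_smul, this, Prod.smul_mk, smul_add, smul_sub,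
          RingHom.id_apply]
      invFun := fun q => (q.1 - q.2.1,
        (q.2.1 + τ (q.1 - q.2.1, q.2.2 + πM (γ (q.1 - q.2.1))),
          q.2.2 + πM (γ (q.1 - q.2.1))))
      left_inv := fun p => by
        simp only [add_sub_cancel_right, sub_add_cancel]
      right_inv := fun q => by
        simp only [sub_add_cancel, add_sub_cancel_right] }
  refine sgn_congr e ?_
  rintro ⟨x, z, m⟩
  change Ω (π (γ (x + (z - τ (x, m))))) (γ (x + (z - τ (x, m))))
    + (- Ω (π (γ (z - τ (x, m)))) (γ (z - τ (x, m))) + 2 * Ω (γ (z - τ (x, m))) (m - πM (γ x) : M)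
      + Ω (π' (m - πM (γ x) : M) - π (m - πM (γ x) : M)) (m - πM (γ x) : M))
    = Ω (π' (γ x)) (γ x) + H (z, m)
  rw [hH0]
  have hτ : τ (x, m) = ρ (π' ((1/2 : ℝ) • (m : V) - (γ x - π (γ x)))
    - π ((1/2 : ℝ) • (m : V) - (γ x - π (γ x)))) := rfl
  have hc : ((m - πM (γ x) : M) : V) = m - (γ x - π (γ x)) := rfl
  have hT : γ (z - τ (x, m)) = γ z - γ (τ (x, m)) := map_sub _ _ _
  rw [hc, map_add γ, hT]
  have hTM := hρ (π' ((1/2 : ℝ) • (m : V) - (γ x - π (γ x)))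
    - π ((1/2 : ℝ) • (m : V) - (γ x - π (γ x))))
  rw [← hτ] at hTM
  have hXT := hγ.isotropic ⟨x, rfl⟩ (⟨τ (x, m), rfl⟩ : γ (τ (x, m)) ∈ LinearMap.range γ)
  have hXZ := hγ.isotropic ⟨x, rfl⟩ (⟨z, rfl⟩ : γ z ∈ LinearMap.range γ)
  have hp := (hπ (γ x)).2
  have hu := (hπ (γ x)).1
  have hu' := (hπ' (γ x)).1
  have hm := m.2
  generalize γ (τ (x, m)) = T at *
  generalize γ z = Z at *
  generalize γ x = X at *
  generalize (m : V) = m at *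
  obtain ⟨p, hp'⟩ : ∃ p, p = X - π X := ⟨_, rfl⟩
  rw [← hp'] at hp hTM ⊢
  have e1 : π m = 0 := hπ.map_eq_zero h hm
  have e2 : π p = 0 := hπ.map_eq_zero h hp
  have e3 : π' p = π' X - π X := by rw [hp', map_sub, hπ'.map_eq_self h' hu]
  have f1 := hπ.form_eq halt hL hM X (Z - T)
  have f2 := hπ'.form_eq halt hL hM' m p
  have i1 := hM.isotropic hm hp
  have i2 := hM.isotropic hTM hm
  have i3 := hL.isotropic hu' hu
  have i4 := hL.isotropic hu hu
  have s1 := isAlt_skew halt (Z - T) p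
  have s2 := isAlt_skew halt p (Z - T)
  have g1 : Ω p (Z - T) = Ω X (Z - T) - Ω (π X) (Z - T) := by rw [hp']; simp
  have g2 : Ω (π' X) p = Ω (π' X) X - Ω (π' X) (π X) := by rw [hp']; simp
  have g3 : Ω (π X) p = Ω (π X) X - Ω (π X) (π X) := by rw [hp']; simp
  simp only [map_sub, map_add, map_smul, LinearMap.add_apply, LinearMap.sub_apply,
    LinearMap.smul_apply, smul_eq_mul, e1, e2, e3, smul_zero, sub_zero] at *
  linarith

theorem comparisonForm_nondegenerate {Ω : BilinForm ℝ V} (halt : Ω.IsAlt)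
    {L M M' : Submodule ℝ V} (hL : IsLagrangian Ω L) (hM : IsLagrangian Ω M)
    (hM' : IsLagrangian Ω M') (h : M ⊓ L = ⊥)
    {π π' : V →ₗ[ℝ] V} (hπ : IsProjAlong π L M) (hπ' : IsProjAlong π' L M')
    (γ : E →ₗ[ℝ] V) (hinj : Function.Injective γ) (hγ : IsLagrangian Ω (LinearMap.range γ))
    (hMγ : M ⊓ LinearMap.range γ = ⊥) (hMγ' : M' ⊓ LinearMap.range γ = ⊥) (v : E × M)
    (hv : ∀ w, QuadraticMap.polar (comparisonForm Ω π π' M γ) v w = 0) : v = 0 := by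
  obtain ⟨y, m⟩ := v
  have k1 : π (γ y) + m ∈ LinearMap.range γ := by
    refine hγ.mem ?_
    rintro _ ⟨w, rfl⟩
    have := hv (w, 0)
    have f1 := hπ.form_eq halt hL hM (γ y) (γ w)
    have i1 := hγ.isotropic ⟨y, rfl⟩ (⟨w, rfl⟩ : γ w ∈ LinearMap.range γ)
    have s1 := isAlt_skew halt (γ w) (π (γ y))
    simp only [QuadraticMap.polar, comparisonForm_apply, Prod.fst_add, Prod.snd_add, map_add,
      LinearMap.add_apply, add_zero, ZeroMemClass.coe_zero, map_zero, sub_zero] at this ⊢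
    linarith
  have k2 : γ y + (π' m - π m) ∈ M := by
    refine hM.mem fun n hn => ?_
    have := hv (0, ⟨n, hn⟩)
    have f1 := hπ.form_eq halt hL hM (m : V) n
    have f2 := hπ'.form_eq halt hL hM' (m : V) n
    have s1 := isAlt_skew halt n (γ y)
    have s2 := isAlt_skew halt n (π m)
    have s3 := isAlt_skew halt n (π' m)
    simp only [QuadraticMap.polar, comparisonForm_apply, Prod.fst_add, Prod.snd_add, map_add,
      LinearMap.add_apply, add_zero, map_zero, Submodule.coe_add, map_sub,
      LinearMap.sub_apply, LinearMap.zero_apply, mul_zero, zero_add, neg_zero] at this ⊢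
    linarith
  have k3 : π m = 0 := hπ.map_eq_zero h m.2
  have k4 := hπ.map_eq_zero h k2
  rw [map_add, map_sub, k3, map_zero, sub_zero, hπ.map_eq_self h (hπ' m).1] at k4
  have k5 : (m : V) - π' m = 0 := by
    refine eq_zero_of_inf_eq_bot hMγ' (hπ' m).2 ?_
    rwa [sub_eq_add_neg, ← eq_neg_of_add_eq_zero_left k4, add_comm]
  have k6 : (m : V) = 0 := by
    refine eq_zero_of_inf_eq_bot h m.2 ?_
    rw [sub_eq_zero.1 k5]
    exact (hπ' m).1
  have k7 : γ y = 0 := by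
    refine eq_zero_of_inf_eq_bot hMγ ?_ ⟨y, rfl⟩
    simpa [k6] using k2
  have k8 : y = 0 := hinj (by rw [k7, map_zero])
  rw [k8, Subtype.ext (a2 := (0 : M)) k6]
  rfl

end TripleSignature

section GraphSignature

/-- `B` preserves the form `ω`. -/
def IsSp (ω : BilinForm ℝ E) (B : E →L[ℝ] E) : Prop := ∀ x y, ω (B x) (B y) = ω x y

theorem prodNegForm_apply (ω : BilinForm ℝ E) (x y : E × E) :
    prodNegForm ω x y = ω x.1 y.1 - ω x.2 y.2 := rfl

theorem isAlt_prodNegForm {ω : BilinForm ℝ E} (halt : ω.IsAlt) : (prodNegForm ω).IsAlt := by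
  intro x
  rw [prodNegForm_apply, halt x.1, halt x.2, sub_zero]

theorem eq_zero_of_forall_form_eq_zero {ω : BilinForm ℝ E} (hnd : ω.Nondegenerate) {x : E}
    (h : ∀ y, ω x y = 0) : x = 0 := hnd.1 x h

theorem nondegenerate_prodNegForm {ω : BilinForm ℝ E} (halt : ω.IsAlt) (hnd : ω.Nondegenerate) :
    (prodNegForm ω).Nondegenerate := by
  have h : ∀ x : E × E, (∀ y, prodNegForm ω x y = 0) → x = 0 := by
    intro x hx
    refine Prod.ext (hnd.1 _ fun y => ?_) (hnd.1 _ fun y => ?_)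
    · simpa [prodNegForm_apply] using hx (y, 0)
    · simpa [prodNegForm_apply] using hx (0, y)
  refine ⟨h, fun y hy => h y fun x => ?_⟩
  rw [isAlt_skew (isAlt_prodNegForm halt), hy, neg_zero]

theorem isLagrangian_of_isotropic_of_finrank {V : Type*} [NormedAddCommGroup V] [NormedSpace ℝ V]
    [FiniteDimensional ℝ V] {Ω : BilinForm ℝ V} (hnd : Ω.Nondegenerate) {L : Submodule ℝ V}
    (h : ∀ x ∈ L, ∀ y ∈ L, Ω x y = 0)
    (hdim : 2 * Module.finrank ℝ L = Module.finrank ℝ V) : IsLagrangian Ω L := by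
  have e := LinearMap.BilinForm.finrank_orthogonal hnd L
  refine (Submodule.eq_of_le_of_finrank_eq (fun y hy => ?_) (by omega)).symm
  exact LinearMap.BilinForm.mem_orthogonal_iff.2 fun x hx => h x hx y hy

theorem isLagrangian_range [FiniteDimensional ℝ E] {ω : BilinForm ℝ E} (halt : ω.IsAlt)
    (hnd : ω.Nondegenerate) (f : E →ₗ[ℝ] E × E) (hf : Function.Injective f)
    (h : ∀ x y, prodNegForm ω (f x) (f y) = 0) :
    IsLagrangian (prodNegForm ω) (LinearMap.range f) := by
  refine isLagrangian_of_isotropic_of_finrank (nondegenerate_prodNegForm halt hnd) ?_ ?_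
  · rintro _ ⟨x, rfl⟩ _ ⟨y, rfl⟩
    exact h x y
  · rw [LinearMap.finrank_range_of_inj hf, Module.finrank_prod, two_mul]

/-- The parametrization `y ↦ (B y, y)` of the graph of `B`. -/
def graphMap (B : E →L[ℝ] E) : E →ₗ[ℝ] E × E := (B : E →ₗ[ℝ] E).prod LinearMap.id

theorem graphMap_apply (B : E →L[ℝ] E) (y : E) : graphMap B y = (B y, y) := rfl

theorem graphMap_injective (B : E →L[ℝ] E) : Function.Injective (graphMap B) :=
  fun _ _ h => (Prod.ext_iff.1 h).2

theorem isLagrangian_graphSub [FiniteDimensional ℝ E] {ω : BilinForm ℝ E} (halt : ω.IsAlt)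
    (hnd : ω.Nondegenerate) {B : E →L[ℝ] E} (hB : IsSp ω B) :
    IsLagrangian (prodNegForm ω) (graphSub B) :=
  isLagrangian_range halt hnd _ (graphMap_injective B) fun x y => by
    simp [prodNegForm_apply, hB x y]

theorem isSp_one (ω : BilinForm ℝ E) : IsSp ω 1 := fun _ _ => rfl

theorem isLagrangian_diagSub [FiniteDimensional ℝ E] {ω : BilinForm ℝ E} (halt : ω.IsAlt)
    (hnd : ω.Nondegenerate) : IsLagrangian (prodNegForm ω) (diagSub : Submodule ℝ (E × E)) :=
  isLagrangian_graphSub halt hnd (isSp_one ω)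

/-- A Lagrangian complement of the diagonal. -/
structure IsDiagCompl (ω : BilinForm ℝ E) (M : Submodule ℝ (E × E)) : Prop where
  lag : IsLagrangian (prodNegForm ω) M
  inf : M ⊓ diagSub = ⊥

/-- The triple signature of the diagonal, the graph of `B`, and `M`. -/
noncomputable def graphSig (ω : BilinForm ℝ E) (M : Submodule ℝ (E × E)) (B : E →L[ℝ] E) : ℤ :=
  tripleSig (prodNegForm ω) diagSub (graphSub B) M

theorem IsDiagCompl.exists_proj [FiniteDimensional ℝ E] {ω : BilinForm ℝ E} (halt : ω.IsAlt)
    (hnd : ω.Nondegenerate) {M : Submodule ℝ (E × E)} (hM : IsDiagCompl ω M) :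
    ∃ π, IsProjAlong π diagSub M ∧
      ∀ B, graphSig ω M B = sgn ((projForm (prodNegForm ω) π).comp (graphMap B)) := by
  have hL := isLagrangian_diagSub halt hnd
  obtain ⟨π, hπ⟩ :=
    hL.exists_isProjAlong (nondegenerate_prodNegForm halt hnd) hM.lag hM.inf
  exact ⟨π, hπ, fun B =>
    tripleSig_eq_sgn (isAlt_prodNegForm halt) hL hM.lag hπ _ (graphMap_injective B)⟩

theorem eventually_transverse [FiniteDimensional ℝ E] {M : Submodule ℝ (E × E)}
    {B₀ : E →L[ℝ] E} (h : M ⊓ graphSub B₀ = ⊥) :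
    ∀ᶠ B in nhds B₀, M ⊓ graphSub B = ⊥ := by
  have hc : IsCompact (Metric.sphere (0 : E) 1) := isCompact_sphere _ _
  have hev : ∀ᶠ B in nhds B₀, ∀ y ∈ Metric.sphere (0 : E) 1, (B y, y) ∉ M := by
    refine hc.eventually_forall_of_forall_eventually fun y hy => ?_
    have hcont : Continuous fun p : (E →L[ℝ] E) × E => (p.1 p.2, p.2) := by fun_prop
    refine hcont.continuousAt.eventually
      (M.closed_of_finiteDimensional.isOpen_compl.mem_nhds fun hmem => ?_)
    have := (Prod.ext_iff.1 (eq_zero_of_inf_eq_bot h hmem ⟨y, rfl⟩)).2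
    simp only [Prod.snd_zero] at this
    simp [this] at hy
  filter_upwards [hev] with B hB
  rw [eq_bot_iff]
  rintro _ ⟨hmem, y, rfl⟩
  by_contra hne
  have hy : y ≠ 0 := by
    rintro rfl
    exact hne (by simp)
  have hn : 0 < ‖y‖ := norm_pos_iff.2 hy
  refine hB (‖y‖⁻¹ • y) ?_ ?_
  · rw [mem_sphere_zero_iff_norm, norm_smul, norm_inv, norm_norm, inv_mul_cancel₀ hn.ne']
  · have := M.smul_mem ‖y‖⁻¹ hmem
    simpa using this

theorem continuous_form_apply [FiniteDimensional ℝ E] {X : Type*} [TopologicalSpace X]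
    (ω : BilinForm ℝ E) {f g : X → E} (hf : Continuous f) (hg : Continuous g) :
    Continuous fun x => ω (f x) (g x) := by
  have h : Continuous fun x => (LinearMap.toContinuousBilinearMap ω) (f x) (g x) := by fun_prop
  exact h

theorem continuous_graphMap_apply [FiniteDimensional ℝ E] {X : Type*} [TopologicalSpace X]
    {f : X → E →L[ℝ] E} {g : X → E} (hf : Continuous f) (hg : Continuous g) :
    Continuous fun x => graphMap (f x) (g x) := by
  simp only [graphMap_apply]
  fun_prop

theorem graphSig_sub_eventually_eq [FiniteDimensional ℝ E] {ω : BilinForm ℝ E} (halt : ω.IsAlt)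
    (hnd : ω.Nondegenerate) {M M' : Submodule ℝ (E × E)} (hM : IsDiagCompl ω M)
    (hM' : IsDiagCompl ω M') {B₀ : E →L[ℝ] E} (hB₀ : IsSp ω B₀) (h : M ⊓ graphSub B₀ = ⊥)
    (h' : M' ⊓ graphSub B₀ = ⊥) :
    ∀ᶠ B in nhds B₀, IsSp ω B →
      graphSig ω M' B - graphSig ω M B = graphSig ω M' B₀ - graphSig ω M B₀ := by
  have hA := isAlt_prodNegForm halt
  have hN := nondegenerate_prodNegForm halt hnd
  have hL := isLagrangian_diagSub halt hnd
  obtain ⟨π, hπ, hs⟩ := hM.exists_proj halt hnd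
  obtain ⟨π', hπ', hs'⟩ := hM'.exists_proj halt hnd
  have key : ∀ B, IsSp ω B → M ⊓ graphSub B = ⊥ → graphSig ω M' B - graphSig ω M B
      = sgn (comparisonForm (prodNegForm ω) π π' M (graphMap B)) := by
    intro B hB hMB
    have hΓ := isLagrangian_graphSub halt hnd hB
    obtain ⟨r, hr⟩ := hΓ.exists_isProjAlong hN hM.lag hMB
    rw [hs, hs', sgn_projForm_comp_eq_add hA hL hM.lag hM'.lag hM.inf hM'.inf hπ hπ'
      (graphMap B) hΓ (ρ := LinearMap.snd ℝ E E ∘ₗ r)]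
    · ring
    · intro v
      obtain ⟨y, hy⟩ := (hr v).1
      have : graphMap B ((LinearMap.snd ℝ E E ∘ₗ r) v) = r v := by
        rw [LinearMap.comp_apply, ← hy]
        rfl
      rw [this]
      exact (hr v).2
  have hcont : Continuous fun p : (E →L[ℝ] E) × (E × M) =>
      comparisonForm (prodNegForm ω) π π' M (graphMap p.1) p.2 := by
    simp only [comparisonForm_apply]
    have hg : Continuous fun p : (E →L[ℝ] E) × (E × M) => graphMap p.1 p.2.1 :=
      continuous_graphMap_apply (by fun_prop) (by fun_prop)
    have hm : Continuous fun p : (E →L[ℝ] E) × (E × M) => (p.2.2 : E × E) := by fun_prop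
    have c1 := LinearMap.continuous_of_finiteDimensional π
    have c2 := LinearMap.continuous_of_finiteDimensional π'
    refine ((continuous_form_apply _ (c1.comp hg) hg).neg.add
      (continuous_const.mul (continuous_form_apply _ hg hm))).add
      (continuous_form_apply _ ((c2.comp hm).sub (c1.comp hm)) hm)
  have hev := eventually_sgn_eq
    (fun B => comparisonForm (prodNegForm ω) π π' M (graphMap B)) hcont B₀
    (comparisonForm_nondegenerate hA hL hM.lag hM'.lag hM.inf hπ hπ' (graphMap B₀)
      (graphMap_injective B₀) (isLagrangian_graphSub halt hnd hB₀) h h')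
  filter_upwards [hev, eventually_transverse h] with B h1 h2 hB
  rw [key B hB h2, key B₀ hB₀ h, h1]

theorem continuous_projForm_graphMap [FiniteDimensional ℝ E] {ω : BilinForm ℝ E}
    (π : E × E →ₗ[ℝ] E × E) : Continuous fun p : (E →L[ℝ] E) × E =>
      (projForm (prodNegForm ω) π).comp (graphMap p.1) p.2 := by
  have hg : Continuous fun p : (E →L[ℝ] E) × E => graphMap p.1 p.2 :=
    continuous_graphMap_apply (by fun_prop) (by fun_prop)
  have c1 := LinearMap.continuous_of_finiteDimensional π
  exact continuous_form_apply (prodNegForm ω) (c1.comp hg) hg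

theorem graphSig_eventually_eq [FiniteDimensional ℝ E] {ω : BilinForm ℝ E} (halt : ω.IsAlt)
    (hnd : ω.Nondegenerate) {M : Submodule ℝ (E × E)} (hM : IsDiagCompl ω M)
    {B₀ : E →L[ℝ] E} (hB₀ : IsSp ω B₀) (h : M ⊓ graphSub B₀ = ⊥) (hker : ∀ x, B₀ x = x → x = 0) :
    ∀ᶠ B in nhds B₀, graphSig ω M B = graphSig ω M B₀ := by
  have hA := isAlt_prodNegForm halt
  have hL := isLagrangian_diagSub halt hnd
  have hΓ := isLagrangian_graphSub halt hnd hB₀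
  obtain ⟨π, hπ, hs⟩ := hM.exists_proj halt hnd
  have hev := eventually_sgn_eq (fun B => (projForm (prodNegForm ω) π).comp (graphMap B))
    (continuous_projForm_graphMap π) B₀ (fun y hy => by
      have k1 : π (graphMap B₀ y) ∈ graphSub B₀ := by
        refine hΓ.mem ?_
        rintro _ ⟨w, rfl⟩
        have f0 : QuadraticMap.polar (projForm (prodNegForm ω) π) (graphMap B₀ y) (graphMap B₀ w)
            = 0 := by
          have := hy w
          simpa only [QuadraticMap.polar, QuadraticMap.comp_apply, map_add] using this
        rw [polar_projForm] at f0
        have f1 := hπ.form_eq hA hL hM.lag (graphMap B₀ y) (graphMap B₀ w)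
        have i1 := hΓ.isotropic ⟨y, rfl⟩ (⟨w, rfl⟩ : graphMap B₀ w ∈ graphSub B₀)
        have s1 := isAlt_skew hA (graphMap B₀ w) (π (graphMap B₀ y))
        change prodNegForm ω (graphMap B₀ y) (graphMap B₀ w) = 0 at i1
        change prodNegForm ω (graphMap B₀ w) (π (graphMap B₀ y)) = 0
        linarith
      have k2 : graphMap B₀ y - π (graphMap B₀ y) = 0 :=
        eq_zero_of_inf_eq_bot h (hπ _).2 (Submodule.sub_mem _ ⟨y, rfl⟩ k1)
      obtain ⟨z, hz⟩ := (hπ (graphMap B₀ y)).1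
      rw [← sub_eq_zero.1 k2] at hz
      have e1 : z = B₀ y := (Prod.ext_iff.1 hz).1
      have e2 : z = y := (Prod.ext_iff.1 hz).2
      exact hker y (by rw [← e1, e2]))
  filter_upwards [hev] with B h1
  rw [hs, hs, h1]

/-- A symplectic space carries an inner product `g` and an endomorphism `G` with
`ω(x, G y) = g(x, y)`. -/
theorem exists_posDef_form [FiniteDimensional ℝ E] {ω : BilinForm ℝ E} (halt : ω.IsAlt)
    (hnd : ω.Nondegenerate) : ∃ G : E →L[ℝ] E, (∀ x y, ω x (G y) = ω y (G x)) ∧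
      ∀ x, x ≠ 0 → 0 < ω x (G x) := by
  let b := Module.finBasis ℝ E
  let g : BilinForm ℝ E := ∑ i, LinearMap.BilinForm.linMulLin (b.coord i) (b.coord i)
  have hg : ∀ x y, g x y = ∑ i, b.repr x i * b.repr y i := fun x y => by
    simp [g, LinearMap.sum_apply]
  let G : E →ₗ[ℝ] E := - ((LinearMap.BilinForm.toDual ω hnd).symm : _ →ₗ[ℝ] E) ∘ₗ g
  have hG : ∀ x y, ω x (G y) = g y x := fun x y => by
    rw [isAlt_skew halt]
    simp [G, LinearMap.BilinForm.apply_toDual_symm_apply]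
  refine ⟨LinearMap.toContinuousLinearMap G, fun x y => ?_, fun x hx => ?_⟩
  · change ω x (G y) = ω y (G x)
    rw [hG, hG, hg, hg]
    exact Finset.sum_congr rfl fun i _ => mul_comm _ _
  · change 0 < ω x (G x)
    rw [hG, hg]
    have hne : b.repr x ≠ 0 := by simpa using hx
    obtain ⟨i, hi⟩ := Finsupp.ne_iff.1 hne
    exact Finset.sum_pos' (fun j _ => mul_self_nonneg _)
      ⟨i, Finset.mem_univ i, mul_self_pos.2 (by simpa using hi)⟩

theorem exists_isDiagCompl_transverse [FiniteDimensional ℝ E] {ω : BilinForm ℝ E}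
    (halt : ω.IsAlt) (hnd : ω.Nondegenerate) {B : E →L[ℝ] E} (hB : IsSp ω B) :
    ∃ M, IsDiagCompl ω M ∧ M ⊓ graphSub B = ⊥ := by
  obtain ⟨G, hsym, hpos⟩ := exists_posDef_form halt hnd
  let F : ℝ → E →ₗ[ℝ] E × E := fun c =>
    ((c • (G : E →ₗ[ℝ] E) + LinearMap.id).prod (c • (G : E →ₗ[ℝ] E) - LinearMap.id))
  have hF : ∀ c z, F c z = (c • G z + z, c • G z - z) := fun c z => rfl
  have hform : ∀ c c' z z', prodNegForm ω (F c z) (F c' z')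
      = 2 * (c' - c) * ω z (G z') := by
    intro c c' z z'
    have := isAlt_skew halt (G z) z'
    have := hsym z z'
    simp only [prodNegForm_apply, hF, map_add, map_sub, map_smul, LinearMap.add_apply,
      LinearMap.sub_apply, LinearMap.smul_apply, smul_eq_mul]
    have h1 : ω (G z) z' = - ω z (G z') := by linarith
    rw [h1]
    ring
  have hinj : ∀ c z, (F c z).1 = (F c z).2 → z = 0 := by
    intro c z h
    simp only [hF] at h
    have : z = -z := by
      have := congrArg (fun v => v - c • G z) h
      simpa using this
    have h2 : (2:ℝ) • z = 0 := by rw [two_smul]; nth_rewrite 1 [this]; simp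
    simpa using h2
  have hM : ∀ c, IsDiagCompl ω (LinearMap.range (F c)) := by
    intro c
    refine ⟨isLagrangian_range halt hnd _ ?_ fun x y => by rw [hform]; ring, ?_⟩
    · refine (injective_iff_map_eq_zero _).2 fun z hz => hinj c z (by rw [hz]; rfl)
    · rw [eq_bot_iff]
      rintro _ ⟨⟨z, rfl⟩, ⟨w, hw⟩⟩
      have h1 : w = (F c z).1 := (Prod.ext_iff.1 hw).1
      have h2 : w = (F c z).2 := (Prod.ext_iff.1 hw).2
      have : z = 0 := hinj c z (by rw [← h1, ← h2])
      simp [this]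
  by_contra! hcon
  have hbad : ∀ c, ∃ z, z ≠ 0 ∧ F c z ∈ graphSub B := by
    intro c
    obtain ⟨x, ⟨⟨z, rfl⟩, hx⟩, hne⟩ := Submodule.exists_mem_ne_zero_of_ne_bot (hcon _ (hM c))
    refine ⟨z, ?_, hx⟩
    rintro rfl
    simp at hne
  choose z hz hzB using hbad
  have horth : ∀ c c', c ≠ c' → ω (z c) (G (z c')) = 0 := by
    intro c c' hcc
    have := (isLagrangian_graphSub halt hnd hB).isotropic (hzB c) (hzB c')
    rw [hform] at this
    have hne : 2 * (c' - c) ≠ 0 := by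
      intro h0
      exact hcc (by linarith)
    exact (mul_eq_zero.1 this).resolve_left hne
  have hli : LinearIndependent ℝ z := by
    refine LinearMap.BilinForm.linearIndependent_of_iIsOrtho
      (B := ω.compl₁₂ LinearMap.id (G : E →ₗ[ℝ] E)) ?_ ?_
    · intro c c' hcc
      exact horth c c' hcc
    · intro c h0
      exact (hpos (z c) (hz c)).ne' h0
  exact not_finite_iff_infinite.2 (inferInstance : Infinite ℝ) hli.finite_of_isNoetherian

end GraphSignature

section Potential

variable {X Y : Type*} [TopologicalSpace X] [TopologicalSpace Y]

/-- An integer function whose variation compensates, locally on `S`, the variation of the triple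
signatures of the family `A`. -/
def IsPotential (ω : BilinForm ℝ E) (S : Set X) (A : X → E →L[ℝ] E) (φ : X → ℤ) : Prop :=
  ∀ p ∈ S, ∀ M, IsDiagCompl ω M → M ⊓ graphSub (A p) = ⊥ →
    ∀ᶠ q in nhdsWithin p S, φ q + graphSig ω M (A q) = φ p + graphSig ω M (A p)

theorem IsPotential.comp {ω : BilinForm ℝ E} {S : Set X} {A : X → E →L[ℝ] E} {φ : X → ℤ}
    (h : IsPotential ω S A φ) {T : Set Y} {g : Y → X} (hg : ContinuousOn g T)
    (hT : Set.MapsTo g T S) : IsPotential ω T (fun y => A (g y)) (fun y => φ (g y)) := by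
  intro p hp M hM hMp
  exact (hg.continuousWithinAt hp).tendsto_nhdsWithin hT |>.eventually (h (g p) (hT hp) M hM hMp)

theorem IsPotential.congr {ω : BilinForm ℝ E} {S : Set X} {A A' : X → E →L[ℝ] E} {φ φ' : X → ℤ}
    (h : IsPotential ω S A φ) (hA : Set.EqOn A A' S) (hφ : Set.EqOn φ φ' S) :
    IsPotential ω S A' φ' := by
  intro p hp M hM hMp
  rw [← hA hp] at hMp
  filter_upwards [h p hp M hM hMp, self_mem_nhdsWithin] with q hq hqS
  rw [← hA hqS, ← hA hp, ← hφ hqS, ← hφ hp, hq]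

theorem IsPotential.union {ω : BilinForm ℝ E} {S C₁ C₂ : Set X} {A : X → E →L[ℝ] E} {φ : X → ℤ}
    (hC₁ : IsClosed C₁) (hC₂ : IsClosed C₂)
    (h₁ : IsPotential ω (S ∩ C₁) A φ) (h₂ : IsPotential ω (S ∩ C₂) A φ) :
    IsPotential ω (S ∩ (C₁ ∪ C₂)) A φ := by
  have aux : ∀ C, IsClosed C → IsPotential ω (S ∩ C) A φ → ∀ p ∈ S, ∀ M, IsDiagCompl ω M →
      M ⊓ graphSub (A p) = ⊥ → ∀ᶠ q in nhdsWithin p (S ∩ C),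
        φ q + graphSig ω M (A q) = φ p + graphSig ω M (A p) := by
    intro C hC h p hp M hM hMp
    by_cases hpC : p ∈ C
    · exact h p ⟨hp, hpC⟩ M hM hMp
    · filter_upwards [self_mem_nhdsWithin, mem_nhdsWithin_of_mem_nhds
        (hC.isOpen_compl.mem_nhds hpC)] with q hq hq'
      exact (hq' hq.2).elim
  intro p hp M hM hMp
  rw [Set.inter_union_distrib_left, nhdsWithin_union, Filter.eventually_sup]
  exact ⟨aux C₁ hC₁ h₁ p hp.1 M hM hMp, aux C₂ hC₂ h₂ p hp.1 M hM hMp⟩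

theorem IsPotential.add_graphSig_eq {ω : BilinForm ℝ E} {a b : ℝ} (hab : a ≤ b)
    {A : ℝ → E →L[ℝ] E} {φ : ℝ → ℤ} (h : IsPotential ω (Set.Icc a b) A φ)
    {M : Submodule ℝ (E × E)} (hM : IsDiagCompl ω M)
    (hMA : ∀ t ∈ Set.Icc a b, M ⊓ graphSub (A t) = ⊥) :
    φ b + graphSig ω M (A b) = φ a + graphSig ω M (A a) := by
  have hc : ContinuousOn (fun t => φ t + graphSig ω M (A t)) (Set.Icc a b) := by
    intro t ht
    rw [ContinuousWithinAt, nhds_discrete, Filter.tendsto_pure]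
    exact h t ht M hM (hMA t ht)
  exact isPreconnected_Icc.constant hc (Set.right_mem_Icc.2 hab) (Set.left_mem_Icc.2 hab)

theorem IsPotential.dataSum_eq {ω : BilinForm ℝ E}
    {A : ℝ → E →L[ℝ] E} {φ : ℝ → ℤ} (h : IsPotential ω (Set.Icc 0 1) A φ)
    (D : AdmissibleData (prodNegForm ω) 0 1 (fun _ => diagSub) (fun t => graphSub (A t))) :
    dataSum D = ((φ 1 - φ 0 : ℤ) : ℝ) / 2 := by
  have hle : ∀ i ≤ D.k, ∀ j ≤ i, D.t j ≤ D.t i := by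
    intro i
    induction i with
    | zero => intro _ j hj; simp [Nat.le_zero.1 hj]
    | succ i ih =>
      intro hi j hj
      rcases Nat.lt_or_ge j (i + 1) with h1 | h1
      · exact (ih (by omega) j (by omega)).trans (D.hmono i (by omega))
      · rw [le_antisymm hj h1]
  have hmem : ∀ i ≤ D.k, D.t i ∈ Set.Icc (0:ℝ) 1 := fun i hi =>
    ⟨by
      have := hle i hi 0 (Nat.zero_le _)
      rwa [D.ht0] at this, by
      have := hle D.k le_rfl i hi
      rwa [D.htk] at this⟩
  have hterm : ∀ ν ∈ Finset.range D.k,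
      ((tripleSig (prodNegForm ω) diagSub (graphSub (A (D.t ν))) (D.M (ν + 1)) : ℝ)
      - (tripleSig (prodNegForm ω) diagSub (graphSub (A (D.t (ν + 1)))) (D.M (ν + 1)) : ℝ))
      = (φ (D.t (ν + 1)) : ℝ) - φ (D.t ν) := by
    intro ν hν
    have hν := Finset.mem_range.1 hν
    have hsub : Set.Icc (D.t ν) (D.t (ν + 1)) ⊆ Set.Icc 0 1 :=
      Set.Icc_subset_Icc (hmem ν hν.le).1 (hmem (ν + 1) hν).2
    have hM : IsDiagCompl ω (D.M (ν + 1)) := ⟨D.hlag ν hν,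
      D.htrans1 ν hν (D.t ν) (Set.left_mem_Icc.2 (D.hmono ν hν))⟩
    have := (h.comp (g := id) continuousOn_id hsub).add_graphSig_eq (D.hmono ν hν) hM
      (D.htrans2 ν hν)
    simp only [id_eq, graphSig] at this
    have h2 := congrArg (Int.cast : ℤ → ℝ) this
    push_cast at h2
    linarith
  rw [dataSum, Finset.sum_congr rfl hterm, Finset.sum_range_sub (fun i => (φ (D.t i) : ℝ)),
    D.htk, D.ht0]
  push_cast
  ring

/-- A partition of `[0,1]` with complements transverse to the graphs on each piece. -/
theorem exists_transverse_partition [FiniteDimensional ℝ E] {ω : BilinForm ℝ E}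
    (halt : ω.IsAlt) (hnd : ω.Nondegenerate) {A : ℝ → E →L[ℝ] E} (hA : Continuous A)
    (hsp : ∀ t, IsSp ω (A t)) :
    ∃ (t : ℕ → ℝ) (M : ℕ → Submodule ℝ (E × E)) (k : ℕ), t 0 = 0 ∧ Monotone t ∧ t k = 1 ∧
      0 < k ∧ (∀ n, IsDiagCompl ω (M n)) ∧
      ∀ n, ∀ τ ∈ Set.Icc (t n) (t (n + 1)), M n ⊓ graphSub (A τ) = ⊥ := by
  let c : {M // IsDiagCompl ω M} → Set (Set.Icc (0:ℝ) 1) :=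
    fun M => {τ | M.1 ⊓ graphSub (A τ) = ⊥}
  have hc : ∀ M, IsOpen (c M) := by
    intro M
    rw [isOpen_iff_mem_nhds]
    intro τ hτ
    exact (hA.comp continuous_subtype_val).continuousAt.eventually (eventually_transverse hτ)
  have hcov : Set.univ ⊆ ⋃ M, c M := by
    intro τ _
    obtain ⟨M, hM, h⟩ := exists_isDiagCompl_transverse halt hnd (hsp τ)
    exact Set.mem_iUnion.2 ⟨⟨M, hM⟩, h⟩
  obtain ⟨t, h0, hmono, ⟨m, hm⟩, hsub⟩ :=
    exists_monotone_Icc_subset_open_cover_Icc zero_le_one hc hcov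
  choose M hM using hsub
  refine ⟨fun n => t n, fun n => M n, m + 1, h0, fun i j hij => hmono hij, hm _ (by omega),
    by omega, fun n => (M n).2, fun n τ hτ => ?_⟩
  have h0 : (0:ℝ) ≤ τ := (t n).2.1.trans hτ.1
  have h1 : τ ≤ 1 := hτ.2.trans (t (n + 1)).2.2
  exact hM n (a := ⟨τ, h0, h1⟩) ⟨hτ.1, hτ.2⟩

theorem exists_admissibleData [FiniteDimensional ℝ E] {ω : BilinForm ℝ E}
    (halt : ω.IsAlt) (hnd : ω.Nondegenerate) {A A' : ℝ → E →L[ℝ] E} (hA : Continuous A)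
    (hsp : ∀ t, IsSp ω (A t)) (hA' : ∀ t ∈ Set.Icc (0:ℝ) 1, A' t = A t) :
    Nonempty (AdmissibleData (prodNegForm ω) 0 1 (fun _ => diagSub)
      (fun t => graphSub (A' t))) := by
  obtain ⟨t, M, k, h0, hmono, hk, hpos, hM, htr⟩ := exists_transverse_partition halt hnd hA hsp
  refine ⟨⟨k, hpos, t, fun n => M (n - 1), h0, hk, fun ν _ => hmono (Nat.le_succ ν),
    fun ν _ => (hM ν).lag, fun ν _ _ _ => (hM ν).inf, fun ν hν s hs => ?_⟩⟩
  have hs' : s ∈ Set.Icc (0:ℝ) 1 := ⟨h0 ▸ (hmono (Nat.zero_le ν)).trans hs.1,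
    hs.2.trans (hk ▸ hmono hν)⟩
  simp only [hA' s hs']
  exact htr ν s hs

theorem exists_local_potential [FiniteDimensional ℝ E] {ω : BilinForm ℝ E}
    (halt : ω.IsAlt) (hnd : ω.Nondegenerate) {H : ℝ × ℝ → E →L[ℝ] E} (hH : Continuous H)
    (hsp : ∀ p, IsSp ω (H p)) (h0 : ∀ s, H (s, 0) = 1) (s₀ : ℝ) :
    ∃ J ∈ nhds s₀, ∃ Φ : ℝ × ℝ → ℤ, (∀ s, Φ (s, 0) = 0) ∧
      IsPotential ω (J ×ˢ Set.Icc 0 1) H Φ := by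
  obtain ⟨t, M, k, ht0, hmono, hk, hpos, hM, htr⟩ := exists_transverse_partition halt hnd
    (A := fun t => H (s₀, t)) (by fun_prop) (fun t => hsp _)
  have hJ : ∀ n, ∀ᶠ s in nhds s₀, ∀ τ ∈ Set.Icc (t n) (t (n + 1)),
      M n ⊓ graphSub (H (s, τ)) = ⊥ := by
    intro n
    refine isCompact_Icc.eventually_forall_of_forall_eventually fun τ hτ => ?_
    exact hH.continuousAt.eventually (eventually_transverse (htr n τ hτ))
  have hJk : ∀ᶠ s in nhds s₀, ∀ n ∈ Finset.range k, ∀ τ ∈ Set.Icc (t n) (t (n + 1)),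
      M n ⊓ graphSub (H (s, τ)) = ⊥ := by
    rw [Filter.eventually_all_finset]
    exact fun n _ => hJ n
  refine ⟨_, hJk, ?_⟩
  generalize hJdef : {s | ∀ n ∈ Finset.range k, ∀ τ ∈ Set.Icc (t n) (t (n + 1)),
      M n ⊓ graphSub (H (s, τ)) = ⊥} = J
  have hJmem : ∀ s ∈ J, ∀ n < k, ∀ τ ∈ Set.Icc (t n) (t (n + 1)),
      M n ⊓ graphSub (H (s, τ)) = ⊥ := by
    intro s hs n hn
    rw [← hJdef] at hs
    exact hs n (Finset.mem_range.2 hn)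
  have main : ∀ n ≤ k, ∃ Φ : ℝ × ℝ → ℤ, (∀ s, Φ (s, 0) = 0) ∧
      IsPotential ω (J ×ˢ Set.Icc 0 (t n)) H Φ := by
    intro n
    induction n with
    | zero =>
      intro _
      refine ⟨fun _ => 0, fun _ => rfl, ?_⟩
      rintro ⟨s, x⟩ hp N hN _
      filter_upwards [self_mem_nhdsWithin] with q hq
      rw [ht0] at hp hq
      have e1 : x = 0 := le_antisymm hp.2.2 hp.2.1
      have e2 : q.2 = 0 := le_antisymm hq.2.2 hq.2.1
      have e3 : q = (q.1, 0) := Prod.ext rfl e2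
      rw [e1, e3, h0, h0]
    | succ n ih =>
      intro hn
      obtain ⟨Φ, hΦ0, hΦ⟩ := ih (by omega)
      have ha0 : 0 ≤ t n := ht0 ▸ hmono (Nat.zero_le n)
      have hab : t n ≤ t (n + 1) := hmono (Nat.le_succ n)
      let Φ' : ℝ × ℝ → ℤ := fun p => if p.2 ≤ t n then Φ p else
        Φ (p.1, t n) + graphSig ω (M n) (H (p.1, t n)) - graphSig ω (M n) (H p)
      refine ⟨Φ', fun s => ?_, ?_⟩
      · simp only [Φ', if_pos ha0, hΦ0]
      have hset : J ×ˢ Set.Icc 0 (t (n + 1))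
          = (J ×ˢ Set.univ) ∩ ((Set.univ ×ˢ Set.Icc 0 (t n))
            ∪ (Set.univ ×ˢ Set.Icc (t n) (t (n + 1)))) := by
        rw [← Set.prod_union, Set.Icc_union_Icc_eq_Icc ha0 hab, Set.prod_inter_prod,
          Set.inter_univ, Set.univ_inter]
      rw [hset]
      refine IsPotential.union (isClosed_univ.prod isClosed_Icc) (isClosed_univ.prod isClosed_Icc)
        ?_ ?_
      · rw [Set.prod_inter_prod, Set.inter_univ, Set.univ_inter]
        refine hΦ.congr (fun _ _ => rfl) fun p hp => ?_
        simp only [Φ', if_pos hp.2.2]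
      · rw [Set.prod_inter_prod, Set.inter_univ, Set.univ_inter]
        have hΦ' : ∀ p ∈ J ×ˢ Set.Icc (t n) (t (n + 1)), Φ' p
            = Φ (p.1, t n) + graphSig ω (M n) (H (p.1, t n)) - graphSig ω (M n) (H p) := by
          intro p hp
          by_cases hle : p.2 ≤ t n
          · have : p = (p.1, t n) := Prod.ext rfl (le_antisymm hle hp.2.1)
            simp only [Φ', if_pos hle]
            rw [← this]
            ring
          · simp only [Φ', if_neg hle]
        intro p hp N hN hNp
        have c1 := (hΦ.comp (T := J ×ˢ Set.Icc (t n) (t (n + 1))) (g := fun q => (q.1, t n))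
          (by fun_prop) (fun q hq => ⟨hq.1, ha0, le_rfl⟩)) p hp (M n) (hM n)
          (hJmem p.1 hp.1 n (by omega) _ ⟨le_rfl, hab⟩)
        have c2 : ∀ᶠ q in nhdsWithin p (J ×ˢ Set.Icc (t n) (t (n + 1))), IsSp ω (H q) →
            graphSig ω N (H q) - graphSig ω (M n) (H q)
              = graphSig ω N (H p) - graphSig ω (M n) (H p) :=
          ((hH.tendsto p).mono_left nhdsWithin_le_nhds).eventually
          (graphSig_sub_eventually_eq halt hnd (hM n) hN (hsp p)
            (hJmem p.1 hp.1 n (by omega) _ hp.2) hNp)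
        filter_upwards [c1, c2, self_mem_nhdsWithin] with q h1 h2 hq
        rw [hΦ' q hq, hΦ' p hp]
        have := h2 (hsp q)
        linarith
  have := main k le_rfl
  rwa [hk] at this

/-- The intersection numbers of the paths of a homotopy starting at the identity are half the
values of a potential along the endpoints. -/
theorem exists_endpoint_potential [FiniteDimensional ℝ E] {ω : BilinForm ℝ E}
    (halt : ω.IsAlt) (hnd : ω.Nondegenerate) {H : ℝ × ℝ → E →L[ℝ] E} (hH : Continuous H)
    (hsp : ∀ p, IsSp ω (H p)) (h0 : ∀ s, H (s, 0) = 1) :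
    ∃ e : ℝ → ℤ, IsPotential ω Set.univ (fun s => H (s, 1)) e ∧
      ∀ s, ∀ A : ℝ → E →L[ℝ] E, (∀ t ∈ Set.Icc (0:ℝ) 1, A t = H (s, t)) →
        ∀ D : AdmissibleData (prodNegForm ω) 0 1 (fun _ => diagSub) (fun t => graphSub (A t)),
          dataSum D = (e s : ℝ) / 2 := by
  choose J hJ Φ hΦ0 hΦ using exists_local_potential halt hnd hH hsp h0
  have hD : ∀ s₀, ∀ s ∈ J s₀, ∀ A : ℝ → E →L[ℝ] E, (∀ t ∈ Set.Icc (0:ℝ) 1, A t = H (s, t)) →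
      ∀ D : AdmissibleData (prodNegForm ω) 0 1 (fun _ => diagSub) (fun t => graphSub (A t)),
        dataSum D = (Φ s₀ (s, 1) : ℝ) / 2 := by
    intro s₀ s hs A hA D
    have := (((hΦ s₀).comp (T := Set.Icc 0 1) (g := fun t => (s, t)) (by fun_prop)
      (fun t ht => ⟨hs, ht⟩)).congr (fun t ht => (hA t ht).symm) (fun _ _ => rfl)).dataSum_eq D
    rw [this, hΦ0, sub_zero]
  have heq : ∀ s₀, ∀ s ∈ J s₀, Φ s (s, 1) = Φ s₀ (s, 1) := by
    intro s₀ s hs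
    obtain ⟨D⟩ := exists_admissibleData halt hnd (A := fun t => H (s, t)) (by fun_prop)
      (fun t => hsp _) (fun _ _ => rfl)
    have h1 := hD s₀ s hs _ (fun _ _ => rfl) D
    have h2 := hD s s (mem_of_mem_nhds (hJ s)) _ (fun _ _ => rfl) D
    rw [h1] at h2
    have h3 : (Φ s₀ (s, 1) : ℝ) = Φ s (s, 1) := by linarith
    exact_mod_cast h3.symm
  refine ⟨fun s => Φ s (s, 1), ?_, fun s A hA D => hD s s (mem_of_mem_nhds (hJ s)) A hA D⟩
  intro s _ M hM hMs
  have := ((hΦ s).comp (T := J s) (g := fun r => (r, (1:ℝ))) (by fun_prop)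
    (fun r hr => ⟨hr, by norm_num, le_rfl⟩)) s (mem_of_mem_nhds (hJ s)) M hM hMs
  rw [nhdsWithin_eq_nhds.2 (hJ s)] at this
  rw [nhdsWithin_univ]
  filter_upwards [this, hJ s] with r hr hrJ
  rw [heq s r hrJ, hr]

end Potential

section Crossing

/-- The transvection `x ↦ x + k ω(w, x) w`. -/
noncomputable def transv [FiniteDimensional ℝ E] (ω : BilinForm ℝ E) (w : E) (k : ℝ) : E →L[ℝ] E :=
  1 + k • (LinearMap.toContinuousLinearMap (ω w)).smulRight w

theorem transv_apply [FiniteDimensional ℝ E] (ω : BilinForm ℝ E) (w : E) (k : ℝ) (x : E) :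
    transv ω w k x = x + (k * ω w x) • w := by
  simp [transv, mul_smul]

@[simp] theorem transv_zero [FiniteDimensional ℝ E] (ω : BilinForm ℝ E) (w : E) :
    transv ω w 0 = 1 := by
  simp [transv]

theorem continuous_transv [FiniteDimensional ℝ E] {X : Type*} [TopologicalSpace X]
    (ω : BilinForm ℝ E) {f : X → E} {g : X → ℝ} (hf : Continuous f) (hg : Continuous g) :
    Continuous fun x => transv ω (f x) (g x) := by
  refine continuous_clm_apply.2 fun y => ?_
  simp only [transv_apply]
  exact continuous_const.add ((hg.mul (continuous_form_apply ω hf continuous_const)).smul hf)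

theorem isSp_transv [FiniteDimensional ℝ E] {ω : BilinForm ℝ E} (halt : ω.IsAlt) (w : E) (k : ℝ) :
    IsSp ω (transv ω w k) := by
  intro x y
  simp only [transv_apply, map_add, map_smul, LinearMap.add_apply, LinearMap.smul_apply,
    smul_eq_mul, halt w, isAlt_skew halt x w]
  ring

theorem transv_mul_transv_neg [FiniteDimensional ℝ E] {ω : BilinForm ℝ E} (halt : ω.IsAlt) (w : E)
    (k : ℝ) : transv ω w k * transv ω w (-k) = 1 := by
  ext x
  simp only [mul_apply_eq_comp, transv_apply, map_add, map_smul, halt w, one_apply_eq_self]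
  module

theorem IsSp.mul {ω : BilinForm ℝ E} {B C : E →L[ℝ] E} (hB : IsSp ω B) (hC : IsSp ω C) :
    IsSp ω (B * C) := fun x y => by
  rw [mul_apply_eq_comp, mul_apply_eq_comp, hB, hC]

/-- The inverse of `B - 1`. -/
noncomputable def res (B : E →L[ℝ] E) : E →L[ℝ] E := Ring.inverse (B - 1)

theorem apply_res {B : E →L[ℝ] E} (hu : IsUnit (B - 1)) (x : E) : B (res B x) = res B x + x := by
  have := congrArg (fun f : E →L[ℝ] E => f x) (Ring.mul_inverse_cancel _ hu)
  simp only [mul_apply_eq_comp, sub_apply,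
    one_apply_eq_self] at this
  exact sub_eq_iff_eq_add'.1 this

theorem res_apply {B : E →L[ℝ] E} (hu : IsUnit (B - 1)) (x : E) : res B (B x) = res B x + x := by
  have := congrArg (fun f : E →L[ℝ] E => f x) (Ring.inverse_mul_cancel _ hu)
  simp only [mul_apply_eq_comp, sub_apply,
    one_apply_eq_self, map_sub] at this
  exact sub_eq_iff_eq_add'.1 this

theorem form_res {ω : BilinForm ℝ E} {B : E →L[ℝ] E} (hB : IsSp ω B) (hu : IsUnit (B - 1))
    (a b : E) : ω (res B a) b + ω a (res B b) + ω a b = 0 := by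
  have h := hB (res B a) (res B b)
  rw [apply_res hu, apply_res hu] at h
  simp only [map_add, LinearMap.add_apply] at h
  linarith

theorem isUnit_sub_one_iff [FiniteDimensional ℝ E] {B : E →L[ℝ] E} :
    IsUnit (B - 1) ↔ ∀ x, B x = x → x = 0 := by
  constructor
  · intro hu x hx
    have := apply_res hu x
    have h2 := res_apply hu x
    rw [hx] at h2
    simpa using h2
  · intro h
    have hinj : Function.Injective ((B - 1 : E →L[ℝ] E) : E →ₗ[ℝ] E) := by
      refine (injective_iff_map_eq_zero _).2 fun x hx => h x (sub_eq_zero.1 ?_)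
      simpa using hx
    let e := (LinearEquiv.ofInjectiveEndo _ hinj).toContinuousLinearEquiv
    have he : ((ContinuousLinearEquiv.toUnit e : (E →L[ℝ] E)ˣ) : E →L[ℝ] E) = B - 1 := by
      ext x
      rfl
    rw [← he]
    exact Units.isUnit _

/-- An infinitesimal symplectic isomorphism with a prescribed value. -/
theorem exists_skew_apply_eq [FiniteDimensional ℝ E] {ω : BilinForm ℝ E} (halt : ω.IsAlt)
    (hnd : ω.Nondegenerate) {a l : E} (hal : ω a l ≠ 0) :
    ∃ H : E →ₗ[ℝ] E, (∀ x y, ω (H x) y + ω x (H y) = 0) ∧ H a = l ∧ Function.Injective H := by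
  obtain ⟨G, hsym, hpos⟩ := exists_posDef_form halt hnd
  let lam : E →ₗ[ℝ] ℝ := (ω a l)⁻¹ • ω.flip l
  have hlam : ∀ y, lam y * ω a l = ω y l := fun y => by
    simp only [lam, LinearMap.smul_apply, smul_eq_mul]
    field_simp
    rfl
  have hlam1 : lam a = 1 := mul_right_cancel₀ hal (by rw [hlam, one_mul])
  let P : E →ₗ[ℝ] E := LinearMap.id - lam.smulRight a
  have hP : ∀ x, P x = x - lam x • a := fun x => rfl
  let S : E →ₗ[ℝ] E := LinearMap.id - ((ω a l)⁻¹ • ω a).smulRight l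
  have hS : ∀ x, S x = x - ((ω a l)⁻¹ * ω a x) • l := fun x => rfl
  have hadj : ∀ x y, ω x (S y) = ω (P x) y := by
    intro x y
    rw [hS, hP, map_sub, map_smul, map_sub, map_smul, LinearMap.sub_apply, LinearMap.smul_apply,
      smul_eq_mul, smul_eq_mul, ← hlam x]
    field_simp
  let H : E →ₗ[ℝ] E := lam.smulRight l + S ∘ₗ (G : E →ₗ[ℝ] E) ∘ₗ P
  have hH : ∀ x y, ω x (H y) = lam x * lam y * ω a l + ω (P x) (G (P y)) := by
    intro x y
    have : H y = lam y • l + S (G (P y)) := rfl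
    rw [this, map_add, map_smul, hadj, smul_eq_mul, ← hlam x]
    ring
  have hPa : P a = 0 := by rw [hP, hlam1, one_smul, sub_self]
  refine ⟨H, fun x y => ?_, ?_, ?_⟩
  · rw [isAlt_skew halt, hH, hH, hsym (P x)]
    ring
  · have : H a = lam a • l + S (G (P a)) := rfl
    rw [this, hPa, hlam1, one_smul, map_zero, map_zero, add_zero]
  · refine (injective_iff_map_eq_zero _).2 fun x hx => ?_
    have h1 := hH a x
    have h2 := hH x x
    rw [hx, map_zero, hPa, map_zero, LinearMap.zero_apply, hlam1, one_mul, add_zero] at h1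
    have h3 : lam x = 0 := (mul_eq_zero.1 h1.symm).resolve_right hal
    rw [hx, map_zero, h3] at h2
    have h4 : P x = x := by rw [hP, h3, zero_smul, sub_zero]
    rw [h4] at h2
    by_contra h5
    have := hpos x h5
    simp only [mul_zero, zero_mul, zero_add] at h2
    linarith

/-- Along `c ↦ B T_{u,c}` a single complement of the diagonal is transverse to all graphs, and the
associated quadratic forms decrease by a rank one term. -/
theorem exists_isDiagCompl_mul_transv [FiniteDimensional ℝ E] {ω : BilinForm ℝ E} (halt : ω.IsAlt)
    (hnd : ω.Nondegenerate) {B : E →L[ℝ] E} (hB : IsSp ω B) (hu : IsUnit (B - 1)) {u : E}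
    (hQ : ω u (res B u) ≠ 0) :
    ∃ M, IsDiagCompl ω M ∧ (∀ c, M ⊓ graphSub (B * transv ω u c) = ⊥) ∧
      ∀ π, IsProjAlong π diagSub M → ∀ c y,
        (projForm (prodNegForm ω) π).comp (graphMap (B * transv ω u c)) y
          = (projForm (prodNegForm ω) π).comp (graphMap B) y - c * ω u y ^ 2 := by
  have hN := form_res hB hu
  have hBN := apply_res hu
  have hNB := res_apply hu
  generalize res B = N at *
  have hab : ω (N u + u) (-B u) ≠ 0 := by
    have h1 := hB u (N u)
    rw [hBN] at h1
    rw [map_neg, isAlt_skew halt, neg_neg, h1]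
    exact hQ
  obtain ⟨H, hH, hHa, hinj⟩ := exists_skew_apply_eq halt hnd hab
  have hsurj : Function.Surjective H := LinearMap.surjective_of_injective hinj
  let f : E →ₗ[ℝ] E × E := (LinearMap.id + (N : E →ₗ[ℝ] E) ∘ₗ H + H).prod
    (LinearMap.id + (N : E →ₗ[ℝ] E) ∘ₗ H)
  have hf : ∀ x, f x = (x + N (H x) + H x, x + N (H x)) := fun x => rfl
  have hf0 : ∀ x, H x = 0 → x = 0 := fun x hx => hinj (by rw [hx, map_zero])
  have hfinj : Function.Injective f := by
    refine (injective_iff_map_eq_zero _).2 fun x hx => hf0 x ?_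
    rw [hf, Prod.mk_eq_zero] at hx
    rw [hx.2, zero_add] at hx
    exact hx.1
  have hM : IsDiagCompl ω (LinearMap.range f) := by
    refine ⟨isLagrangian_range halt hnd f hfinj fun x y => ?_, ?_⟩
    · have h1 := hN (H x) (H y)
      have h2 := hH x y
      simp only [prodNegForm_apply, hf, map_add, LinearMap.add_apply]
      linarith
    · rw [eq_bot_iff]
      rintro _ ⟨⟨x, rfl⟩, y, hy⟩
      have e : (y, y) = f x := hy
      rw [hf, Prod.mk.injEq] at e
      have h0 : H x = 0 := by
        have := e.1
        rw [← e.2] at this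
        simpa using this
      rw [hf0 x h0, map_zero]
      exact Submodule.zero_mem _
  have hT : ∀ c y, (B * transv ω u c) y = B y + (c * ω u y) • B u := fun c y => by
    rw [mul_apply_eq_comp, transv_apply, map_add, map_smul]
  refine ⟨LinearMap.range f, hM, fun c => ?_, fun π hπ c y => ?_⟩
  · rw [eq_bot_iff]
    rintro _ ⟨⟨x, rfl⟩, y, hy⟩
    have e : ((B * transv ω u c) y, y) = f x := hy
    rw [hf, Prod.mk.injEq, hT] at e
    obtain ⟨e1, e2⟩ := e
    have h1 : B y + (c * ω u y) • B u = B x + N (H x) + (c * ω u y) • B u + H x := by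
      rw [e2, map_add, hBN]; abel
    rw [e1] at h1
    have h2 : x = B x + (c * ω u y) • B u := by
      have : x + (N (H x) + H x) = B x + (c * ω u y) • B u + (N (H x) + H x) := by
        rw [← add_assoc, h1]; abel
      exact add_right_cancel this
    have h3 : x = - ((c * ω u y) • (N u + u)) := by
      have := congrArg N h2
      rw [map_add, map_smul, hNB, hNB, add_assoc] at this
      have h4 : x + (c * ω u y) • (N u + u) = 0 := add_eq_left.1 this.symm
      exact eq_neg_of_add_eq_zero_left h4
    have h4 : H x = (c * ω u y) • B u := by
      rw [h3, map_neg, map_smul, hHa, smul_neg, neg_neg]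
    have h5 : y = 0 := by
      have h6 : x + (c * ω u y) • (N u + u) = 0 := by
        nth_rewrite 1 [h3]
        exact neg_add_cancel _
      rw [e2, h4, map_smul, hNB, h6]
    rw [h5, map_zero, mul_zero, zero_smul] at h4
    rw [hf0 x h4, map_zero]
    exact Submodule.zero_mem _
  · obtain ⟨x, hx⟩ := hsurj (B y - y)
    have hdiag : ∀ z : E, (z, z) ∈ (diagSub : Submodule ℝ (E × E)) := fun z => ⟨z, rfl⟩
    have hπx : ∀ c, π (graphMap (B * transv ω u c) y) = (-x, -x) := by
      intro c
      have e : graphMap (B * transv ω u c) y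
          = (-x, -x) + f (x - (c * ω u y) • (N u + u)) := by
        have h1 : H (x - (c * ω u y) • (N u + u)) = B y - y + (c * ω u y) • B u := by
          rw [map_sub, map_smul, hx, hHa, smul_neg, sub_neg_eq_add]
        rw [graphMap_apply, hT, hf, h1, map_add, map_sub, map_smul, hNB, hNB, Prod.mk_add_mk,
          Prod.mk.injEq]
        constructor <;> abel
      rw [e, map_add, hπ.map_eq_self hM.inf (hdiag _), hπ.map_eq_zero hM.inf ⟨_, rfl⟩, add_zero]
    have hπ0 : π (graphMap B y) = (-x, -x) := by
      have := hπx 0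
      rwa [transv_zero, mul_one] at this
    have key : ω x (B u) = ω u y := by
      have h1 := hH x (N u + u)
      rw [hx, hHa] at h1
      have h2 := hB y u
      have h3 := hN (B y) u
      have h4 := hN y u
      rw [hNB] at h3
      simp only [map_add, map_sub, map_neg, LinearMap.add_apply, LinearMap.sub_apply] at h1 h3 ⊢
      have h5 := isAlt_skew halt u y
      linarith
    rw [QuadraticMap.comp_apply, QuadraticMap.comp_apply, projForm_apply, projForm_apply, hπx, hπ0,
      graphMap_apply, graphMap_apply, hT, prodNegForm_apply, prodNegForm_apply]
    simp only [map_add, map_neg, map_smul, LinearMap.neg_apply, smul_eq_mul, key]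
    ring

theorem sgn_graphForm_lt [FiniteDimensional ℝ E] {q₀ q₁ q₂ : QuadraticForm ℝ E} {l : E →ₗ[ℝ] ℝ}
    {a : E} {c d : ℝ} (hc : 0 < c) (hd : 0 < d) (h₀ : ∀ y, q₀ y = q₁ y + c * l y ^ 2)
    (h₂ : ∀ y, q₂ y = q₁ y - d * l y ^ 2) (ha : l a ≠ 0)
    (hker : ∀ y (r : ℝ), q₁ (y + r • a) = q₁ y) : sgn q₂ < sgn q₀ := by
  have hpos : sigPos q₂ + 1 ≤ sigPos q₀ := by
    obtain ⟨W, hW, hWpos⟩ := exists_submodule_sigPos q₂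
    rw [← hW, ← Module.finrank_self ℝ, ← Module.finrank_prod]
    refine finrank_le_sigPos (W.subtype.coprod (LinearMap.id.smulRight a)) ?_
    rintro ⟨w, r⟩ hne
    have e : (W.subtype.coprod ((LinearMap.id : ℝ →ₗ[ℝ] ℝ).smulRight a)) (w, r) = (w : E) + r • a := by
      simp
    rw [e, h₀, hker]
    by_cases hw : w = 0
    · subst hw
      have hr : r ≠ 0 := by
        rintro rfl
        exact hne rfl
      have : q₁ ((0 : W) : E) = 0 := by simp
      rw [this, zero_add]
      have : l (((0 : W) : E) + r • a) = r * l a := by simp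
      rw [this]
      have := mul_ne_zero hr ha
      positivity
    · have h1 := hWpos w hw
      rw [h₂] at h1
      have h2 : 0 ≤ c * l (w + r • a) ^ 2 := by positivity
      have h3 : 0 ≤ d * l w ^ 2 := by positivity
      linarith
  have hneg : sigNeg q₀ ≤ sigNeg q₂ := by
    obtain ⟨W, hW, hWpos⟩ := exists_submodule_sigPos (-q₀)
    rw [← sigPos_neg, ← sigPos_neg, ← hW]
    refine finrank_le_sigPos W.subtype fun w hw => ?_
    have h1 := hWpos w hw
    rw [neg_apply, h₀] at h1
    rw [neg_apply, Submodule.subtype_apply, h₂]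
    have h2 : 0 ≤ c * l w ^ 2 := by positivity
    have h3 : 0 ≤ d * l w ^ 2 := by positivity
    linarith
  rw [sgn, sgn]
  omega

end Crossing

section PathSpace

open scoped unitInterval

/-- The paths of symplectic automorphisms issued from the identity with nondegenerate endpoint. -/
def ndPath (ω : BilinForm ℝ E) : Set C(I, E →L[ℝ] E) :=
  {A | (∀ t, IsSp ω (A t)) ∧ A 0 = 1 ∧ IsUnit (A 1 - 1)}

/-- The path `t ↦ T_{w(t), κ(t)}` of transvections. -/
noncomputable def transvPath [FiniteDimensional ℝ E] (ω : BilinForm ℝ E) (w : C(I, E))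
    (κ : C(I, ℝ)) : C(I, E →L[ℝ] E) :=
  ⟨fun t => transv ω (w t) (κ t), continuous_transv ω w.continuous κ.continuous⟩

/-- The path `t ↦ T_{w, t k}` of transvections. -/
noncomputable def linTransvPath [FiniteDimensional ℝ E] (ω : BilinForm ℝ E) (w : E) (k : ℝ) :
    C(I, E →L[ℝ] E) :=
  ⟨fun t => transv ω w (t * k), continuous_transv ω continuous_const (by fun_prop)⟩

theorem transvPath_apply [FiniteDimensional ℝ E] (ω : BilinForm ℝ E) (w : C(I, E)) (κ : C(I, ℝ))
    (t : I) : transvPath ω w κ t = transv ω (w t) (κ t) := rfl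

theorem linTransvPath_apply [FiniteDimensional ℝ E] (ω : BilinForm ℝ E) (w : E) (k : ℝ) (t : I) :
    linTransvPath ω w k t = transv ω w (t * k) := rfl

theorem joinedIn_ndPath [FiniteDimensional ℝ E] {ω : BilinForm ℝ E} {A B : C(I, E →L[ℝ] E)}
    (F : I × I → E →L[ℝ] E) (hF : Continuous F) (h0 : ∀ t, F (0, t) = A t)
    (h1 : ∀ t, F (1, t) = B t) (hsp : ∀ p, IsSp ω (F p)) (hs : ∀ s, F (s, 0) = 1)
    (hu : ∀ s, IsUnit (F (s, 1) - 1)) : JoinedIn (ndPath ω) A B := by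
  let G : C(I, C(I, E →L[ℝ] E)) := ContinuousMap.curry ⟨F, hF⟩
  refine ⟨⟨G, ?_, ?_⟩, fun s => ⟨fun t => hsp (s, t), hs s, hu s⟩⟩
  · ext1 t
    exact h0 t
  · ext1 t
    exact h1 t

open Classical in
/-- The index `μ` of a path, computed from some admissible data. -/
noncomputable def muIndex (ω : BilinForm ℝ E) (A : C(I, E →L[ℝ] E)) : ℝ :=
  if h : Nonempty (AdmissibleData (prodNegForm ω) 0 1 (fun _ => diagSub)
    (fun t => graphSub (A (Set.projIcc 0 1 zero_le_one t)))) then dataSum h.some else 0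

theorem exists_potential_muIndex [FiniteDimensional ℝ E] {ω : BilinForm ℝ E} (halt : ω.IsAlt)
    (hnd : ω.Nondegenerate) {F : ℝ → C(I, E →L[ℝ] E)} (hF : Continuous F)
    (hsp : ∀ s t, IsSp ω (F s t)) (h0 : ∀ s, F s 0 = 1) :
    ∃ e : ℝ → ℤ, IsPotential ω Set.univ (fun s => F s 1) e ∧ (∀ s, muIndex ω (F s) = e s / 2) ∧
      ∀ s, ∀ A : ℝ → E →L[ℝ] E, (∀ t : I, A t = F s t) →
        ∀ D : AdmissibleData (prodNegForm ω) 0 1 (fun _ => diagSub) (fun t => graphSub (A t)),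
          dataSum D = (e s : ℝ) / 2 := by
  let H : ℝ × ℝ → E →L[ℝ] E := fun p => F p.1 (Set.projIcc 0 1 zero_le_one p.2)
  have hH : Continuous H := by
    have h1 : Continuous fun p : ℝ × ℝ => (F p.1, Set.projIcc (0:ℝ) 1 zero_le_one p.2) :=
      (hF.comp continuous_fst).prodMk (continuous_projIcc.comp continuous_snd)
    exact ContinuousEval.continuous_eval.comp h1
  have hH1 : ∀ s (t : I), H (s, t) = F s t := fun s t => by
    simp only [H, Set.projIcc_val]
  obtain ⟨e, he, heD⟩ := exists_endpoint_potential halt hnd hH (fun p => hsp _ _)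
    (fun s => by simpa using (hH1 s 0).trans (h0 s))
  refine ⟨e, ?_, fun s => ?_, fun s A hA D => ?_⟩
  · refine he.congr (fun s _ => ?_) fun _ _ => rfl
    simpa using hH1 s 1
  · have hne := exists_admissibleData halt hnd (A := fun t => H (s, t))
      (A' := fun t => F s (Set.projIcc 0 1 zero_le_one t)) (by fun_prop)
      (fun t => hsp _ _) (fun _ _ => rfl)
    rw [muIndex, dif_pos hne]
    exact heD s _ (fun _ _ => rfl) _
  · refine heD s A (fun t ht => ?_) D
    rw [hA ⟨t, ht⟩, ← hH1]

theorem dataSum_eq_muIndex [FiniteDimensional ℝ E] {ω : BilinForm ℝ E} (halt : ω.IsAlt)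
    (hnd : ω.Nondegenerate) {F : C(I, E →L[ℝ] E)} (hF : F ∈ ndPath ω) {A : ℝ → E →L[ℝ] E}
    (hA : ∀ t : I, A t = F t)
    (D : AdmissibleData (prodNegForm ω) 0 1 (fun _ => diagSub) (fun t => graphSub (A t))) :
    dataSum D = muIndex ω F := by
  obtain ⟨e, -, h1, h2⟩ := exists_potential_muIndex halt hnd (F := fun _ => F) continuous_const
    (fun _ => hF.1) (fun _ => hF.2.1)
  rw [h1 0, h2 0 A hA D]

theorem JoinedIn.muIndex_eq [FiniteDimensional ℝ E] {ω : BilinForm ℝ E} (halt : ω.IsAlt)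
    (hnd : ω.Nondegenerate) {A B : C(I, E →L[ℝ] E)} (h : JoinedIn (ndPath ω) A B) :
    muIndex ω A = muIndex ω B := by
  obtain ⟨γ, hγ⟩ := h
  have hmem : ∀ s, γ.extend s ∈ ndPath ω := fun s => hγ _
  obtain ⟨e, he, hmu, -⟩ := exists_potential_muIndex halt hnd γ.continuous_extend
    (fun s => (hmem s).1) (fun s => (hmem s).2.1)
  have hc : IsLocallyConstant e := by
    rw [IsLocallyConstant.iff_eventually_eq]
    intro s
    obtain ⟨M, hM, hMs⟩ := exists_isDiagCompl_transverse halt hnd ((hmem s).1 1)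
    have h1 := he s (Set.mem_univ s) M hM hMs
    rw [nhdsWithin_univ] at h1
    have hcont : Continuous fun s => γ.extend s 1 :=
      (continuous_eval_const (1 : I)).comp γ.continuous_extend
    have h2 := hcont.continuousAt.eventually (graphSig_eventually_eq halt hnd hM ((hmem s).1 1) hMs
      (isUnit_sub_one_iff.1 (hmem s).2.2))
    filter_upwards [h1, h2] with r hr1 hr2
    rw [hr2] at hr1
    exact add_right_cancel hr1
  have h0 := hmu 0
  have h1 := hmu 1
  rw [γ.extend_zero] at h0
  rw [γ.extend_one] at h1
  rw [h0, h1, hc.apply_eq_of_preconnectedSpace 0 1]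

theorem isUnit_mul_transv_sub_one [FiniteDimensional ℝ E] {ω : BilinForm ℝ E} (halt : ω.IsAlt)
    {B : E →L[ℝ] E} (hu : IsUnit (B - 1)) {u : E} {k : ℝ} :
    IsUnit (B * transv ω u k - 1) ↔ 1 + k * ω u (res B u) ≠ 0 := by
  have hT : ∀ y, (B * transv ω u k) y = B y + (k * ω u y) • B u := fun y => by
    rw [mul_apply_eq_comp, transv_apply, map_add, map_smul]
  rw [isUnit_sub_one_iff]
  constructor
  · intro h h0
    have hx : (B * transv ω u k) (res B u + u) = res B u + u := by
      rw [hT, map_add, map_add, halt u, add_zero, apply_res hu,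
        show k * ω u (res B u) = -1 by linarith]
      module
    have := h _ hx
    rw [eq_neg_of_add_eq_zero_left this, map_neg, halt u] at h0
    simp at h0
  · intro h x hx
    rw [hT] at hx
    have h1 := congrArg (res B) hx
    rw [map_add, map_smul, res_apply hu, res_apply hu] at h1
    have h2 : x = - ((k * ω u x) • (res B u + u)) := by
      refine eq_neg_of_add_eq_zero_left ?_
      rw [add_assoc] at h1
      exact add_eq_left.1 h1
    have h3 := congrArg (ω u) h2
    rw [map_neg, map_smul, map_add, halt u, add_zero, smul_eq_mul] at h3
    have h4 : ω u x = 0 := by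
      refine (mul_eq_zero.1 (?_ : ω u x * (1 + k * ω u (res B u)) = 0)).resolve_right h
      linarith
    rw [h2, h4, mul_zero, zero_smul, neg_zero]

theorem form_res_mul_transv [FiniteDimensional ℝ E] {ω : BilinForm ℝ E} (halt : ω.IsAlt)
    {B : E →L[ℝ] E} (hu : IsUnit (B - 1)) {u : E} {k : ℝ} (hk : 1 + k * ω u (res B u) ≠ 0) :
    ω u (res (B * transv ω u k) u) = ω u (res B u) / (1 + k * ω u (res B u)) := by
  have hu' := (isUnit_mul_transv_sub_one halt hu).2 hk
  have haux : ∀ q : ℝ, 1 + k * q ≠ 0 → q - k * q / (1 + k * q) * (q + 0) = q / (1 + k * q) := by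
    intro q hq
    rw [eq_div_iff hq, sub_mul, mul_right_comm, div_mul_cancel₀ _ hq]
    ring
  have h : res (B * transv ω u k) u
      = res B u - (k * ω u (res B u) / (1 + k * ω u (res B u))) • (res B u + u) := by
    set x := res B u - (k * ω u (res B u) / (1 + k * ω u (res B u))) • (res B u + u) with hx
    have h1 : (B * transv ω u k) x = x + u := by
      have h2 : ω u x = ω u (res B u) / (1 + k * ω u (res B u)) := by
        rw [hx, map_sub, map_smul, map_add, halt u, smul_eq_mul, haux _ hk]
      rw [mul_apply_eq_comp, transv_apply, map_add, map_smul, h2, hx, map_sub, map_smul, map_add,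
        apply_res hu, ← mul_div_assoc]
      module
    have h2 := res_apply hu' x
    rw [h1, map_add] at h2
    exact add_left_cancel h2
  rw [h, map_sub, map_smul, map_add, halt u, smul_eq_mul, haux _ hk]

theorem IsSp.neg_form {ω : BilinForm ℝ E} {B : E →L[ℝ] E} (hB : IsSp ω B) : IsSp (-ω) B :=
  fun x y => by rw [LinearMap.neg_apply, LinearMap.neg_apply, LinearMap.neg_apply,
    LinearMap.neg_apply, hB]

theorem ndPath_neg (ω : BilinForm ℝ E) : ndPath (-ω) = ndPath ω := by
  ext A
  refine ⟨fun h => ⟨fun t => ?_, h.2⟩, fun h => ⟨fun t => (h.1 t).neg_form, h.2⟩⟩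
  intro x y
  have := h.1 t x y
  rwa [LinearMap.neg_apply, LinearMap.neg_apply, LinearMap.neg_apply, LinearMap.neg_apply,
    neg_inj] at this

theorem linTransvPath_neg_form [FiniteDimensional ℝ E] (ω : BilinForm ℝ E) (w : E) (k : ℝ) :
    linTransvPath (-ω) w k = linTransvPath ω w (-k) := by
  ext t x
  simp [linTransvPath_apply, transv_apply]

theorem linTransvPath_smul [FiniteDimensional ℝ E] (ω : BilinForm ℝ E) (w : E) (c k : ℝ) :
    linTransvPath ω (c • w) k = linTransvPath ω w (c ^ 2 * k) := by
  ext t x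
  simp only [linTransvPath_apply, transv_apply, map_smul, LinearMap.smul_apply, smul_eq_mul]
  module

theorem linTransvPath_mul_neg [FiniteDimensional ℝ E] {ω : BilinForm ℝ E} (halt : ω.IsAlt) (w : E)
    (k : ℝ) : linTransvPath ω w k * linTransvPath ω w (-k) = 1 := by
  ext1 t
  rw [ContinuousMap.mul_apply, linTransvPath_apply, linTransvPath_apply, mul_neg,
    transv_mul_transv_neg halt]
  rfl

theorem mul_linTransvPath_mem [FiniteDimensional ℝ E] {ω : BilinForm ℝ E} (halt : ω.IsAlt)
    {A : C(I, E →L[ℝ] E)} (hA : A ∈ ndPath ω) {u : E} {k : ℝ} :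
    A * linTransvPath ω u k ∈ ndPath ω ↔ 1 + k * ω u (res (A 1) u) ≠ 0 := by
  rw [← isUnit_mul_transv_sub_one halt hA.2.2]
  have h : (A * linTransvPath ω u k) 1 = A 1 * transv ω u k := by
    simp [linTransvPath_apply]
  rw [← h]
  refine ⟨fun h => h.2.2, fun h => ⟨fun t => (hA.1 t).mul (isSp_transv halt _ _), ?_, h⟩⟩
  simp [linTransvPath_apply, hA.2.1]

theorem muIndex_lt [FiniteDimensional ℝ E] {ω : BilinForm ℝ E} (halt : ω.IsAlt)
    (hnd : ω.Nondegenerate) {A : C(I, E →L[ℝ] E)} (hA : A ∈ ndPath ω) {u : E}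
    (hQ : ω u (res (A 1) u) < -1) : muIndex ω A < muIndex ω (A * linTransvPath ω u 1) := by
  have hF : Continuous fun s : ℝ => A * linTransvPath ω u s := by
    have h : Continuous fun s : ℝ => linTransvPath ω u s := by
      refine ContinuousMap.continuous_of_continuous_uncurry _ ?_
      exact continuous_transv ω continuous_const (by fun_prop)
    exact continuous_const.mul h
  have hsp : ∀ (s : ℝ) (t : I), IsSp ω ((A * linTransvPath ω u s) t) :=
    fun s t => (hA.1 t).mul (isSp_transv halt _ _)
  obtain ⟨e, he, hmu, -⟩ := exists_potential_muIndex halt hnd hF hsp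
    (fun s => by simp [linTransvPath_apply, hA.2.1])
  have hend : ∀ s : ℝ, (A * linTransvPath ω u s) 1 = A 1 * transv ω u s := fun s => by
    simp [linTransvPath_apply]
  obtain ⟨M, hM, hMtr, hMq⟩ := exists_isDiagCompl_mul_transv halt hnd (hA.1 1) hA.2.2
    (u := u) (by linarith)
  obtain ⟨π, hπ, hsig⟩ := hM.exists_proj halt hnd
  have hq := hMq π hπ
  have h1 := (he.comp (T := Set.Icc 0 1) (g := id) continuousOn_id
    (fun _ _ => Set.mem_univ _)).add_graphSig_eq zero_le_one hM
    (fun s _ => by simp only [id_eq, hend]; exact hMtr s)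
  simp only [id_eq, hend, hsig] at h1
  set Q := ω u (res (A 1) u)
  have hQ0 : Q ≠ 0 := by linarith
  have hcpos : 0 < -Q⁻¹ := by
    rw [neg_pos, inv_lt_zero]
    linarith
  have hc1 : 0 < 1 - -Q⁻¹ := by
    have h2 : Q⁻¹ * Q = 1 := inv_mul_cancel₀ hQ0
    nlinarith
  have hfix : (A 1 * transv ω u (-Q⁻¹)) (res (A 1) u + u) = res (A 1) u + u := by
    rw [mul_apply_eq_comp, transv_apply, map_add, map_smul, map_add, map_add, halt u, add_zero,
      apply_res hA.2.2, show -Q⁻¹ * ω u (res (A 1) u) = -1 by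
        rw [neg_mul, inv_mul_cancel₀ hQ0]]
    module
  have hlt := sgn_graphForm_lt
    (q₀ := (projForm (prodNegForm ω) π).comp (graphMap (A 1 * transv ω u 0)))
    (q₁ := (projForm (prodNegForm ω) π).comp (graphMap (A 1 * transv ω u (-Q⁻¹))))
    (q₂ := (projForm (prodNegForm ω) π).comp (graphMap (A 1 * transv ω u 1)))
    (l := ω u) (a := res (A 1) u + u) hcpos hc1
    (fun y => by rw [hq, hq]; ring) (fun y => by rw [hq, hq]; ring)
    (by rw [map_add, halt u, add_zero]; exact hQ0) (fun y r => by
      set a := res (A 1) u + u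
      have hΓ := isLagrangian_graphSub halt hnd
        ((hA.1 1).mul (isSp_transv halt u (-Q⁻¹)))
      set B := A 1 * transv ω u (-Q⁻¹)
      have hdiag : graphMap B a ∈ (diagSub : Submodule ℝ (E × E)) := by
        rw [graphMap_apply, hfix]
        exact ⟨a, rfl⟩
      have e1 := hπ.map_eq_self hM.inf hdiag
      have e2 : prodNegForm ω (graphMap B a) (graphMap B y) = 0 :=
        hΓ.isotropic ⟨a, rfl⟩ ⟨y, rfl⟩
      have e3 : prodNegForm ω (π (graphMap B y)) (graphMap B a) = 0 :=
        (isLagrangian_diagSub halt hnd).isotropic (hπ _).1 hdiag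
      have e4 : prodNegForm ω (graphMap B a) (graphMap B a) = 0 := isAlt_prodNegForm halt _
      rw [QuadraticMap.comp_apply, QuadraticMap.comp_apply, projForm_apply, projForm_apply]
      simp only [map_add, map_smul, LinearMap.add_apply, LinearMap.smul_apply, e1, e2, e3, e4,
        smul_zero, add_zero])
  have hz : A * linTransvPath ω u 0 = A := by
    ext1 t
    simp [linTransvPath_apply]
  have h2 := hmu 0
  rw [hz] at h2
  rw [h2, hmu 1]
  have h3 : e 0 < e 1 := by linarith
  have h4 : (e 0 : ℝ) < e 1 := by exact_mod_cast h3
  linarith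

end PathSpace

section UpStep

open scoped unitInterval

theorem continuous_ringInverse {R X : Type*} [NormedRing R] [CompleteSpace R] [TopologicalSpace X]
    {f : X → R} (hf : Continuous f) (hu : ∀ x, IsUnit (f x)) :
    Continuous fun x => Ring.inverse (f x) := by
  refine continuous_iff_continuousAt.2 fun x => ?_
  obtain ⟨v, hv⟩ := hu x
  have h := NormedRing.inverse_continuousAt v
  rw [hv] at h
  exact ContinuousAt.comp (f := f) h hf.continuousAt

theorem isUnit_of_forall_apply_eq_zero [FiniteDimensional ℝ E] {N : E →L[ℝ] E}
    (h : ∀ x, N x = 0 → x = 0) : IsUnit N := by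
  have := (isUnit_sub_one_iff (B := N + 1)).2 fun x hx => h x (by simpa using hx)
  rwa [add_sub_cancel_right] at this

theorem IsSp.isUnit [FiniteDimensional ℝ E] {ω : BilinForm ℝ E} (hnd : ω.Nondegenerate)
    {B : E →L[ℝ] E} (hB : IsSp ω B) : IsUnit B :=
  isUnit_of_forall_apply_eq_zero fun x hx => eq_zero_of_forall_form_eq_zero hnd fun y => by
    rw [← hB, hx, map_zero, LinearMap.zero_apply]

theorem IsSp.ringInverse {ω : BilinForm ℝ E} {B : E →L[ℝ] E} (hB : IsSp ω B) (hu : IsUnit B) :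
    IsSp ω (Ring.inverse B) := fun x y => by
  have h : ∀ z, B (Ring.inverse B z) = z := fun z =>
    congrArg (fun f : E →L[ℝ] E => f z) (Ring.mul_inverse_cancel _ hu)
  rw [← hB, h, h]

theorem isUnit_res {B : E →L[ℝ] E} (hu : IsUnit (B - 1)) : IsUnit (res B) := hu.ringInverse

/-- The endomorphisms `N` for which `1 + N⁻¹`, when defined, is symplectic. -/
def IsCayley (ω : BilinForm ℝ E) (N : E →L[ℝ] E) : Prop :=
  ∀ a b, ω (N a) b + ω a (N b) + ω a b = 0

theorem IsCayley.isSp {ω : BilinForm ℝ E} {N : E →L[ℝ] E} (hN : IsCayley ω N) (hu : IsUnit N) :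
    IsSp ω (1 + Ring.inverse N) := by
  have h : ∀ z, N (Ring.inverse N z) = z := fun z =>
    congrArg (fun f : E →L[ℝ] E => f z) (Ring.mul_inverse_cancel _ hu)
  intro x y
  have h1 := hN (Ring.inverse N x) (Ring.inverse N y)
  rw [h, h] at h1
  simp only [add_apply, one_apply_eq_self, map_add, LinearMap.add_apply]
  linarith

theorem IsCayley.isUnit_of_nonneg [FiniteDimensional ℝ E] {ω : BilinForm ℝ E}
    (hnd : ω.Nondegenerate) {N : E →L[ℝ] E} (hN : IsCayley ω N) (h : ∀ x, 0 ≤ ω x (N x)) :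
    IsUnit N := by
  refine isUnit_of_forall_apply_eq_zero fun x hx => eq_zero_of_forall_form_eq_zero hnd fun y => ?_
  have h1 := hN x y
  rw [hx, map_zero, LinearMap.zero_apply, zero_add] at h1
  have h2 : ∀ t : ℝ, 0 ≤ t * ω x (N y) + t ^ 2 * ω y (N y) := fun t => by
    have := h (x + t • y)
    simp only [map_add, map_smul, hx, zero_add, LinearMap.add_apply, LinearMap.smul_apply,
      smul_eq_mul] at this
    linarith
  suffices ω x (N y) = 0 by linarith
  have hp := h y
  generalize ω x (N y) = a at *
  generalize ω y (N y) = b at *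
  by_contra ha
  have h3 := h2 (-a / (b + 1))
  have hb : 0 < b + 1 := by linarith
  have h4 : -a / (b + 1) * a + (-a / (b + 1)) ^ 2 * b = -(a ^ 2 / (b + 1) ^ 2) := by
    field_simp
    ring
  rw [h4] at h3
  have : 0 < a ^ 2 / (b + 1) ^ 2 := by positivity
  linarith

/-- Positive definite elements of the Lie algebra. -/
def IsPosSkew (ω : BilinForm ℝ E) (G : E →L[ℝ] E) : Prop :=
  (∀ x y, ω x (G y) = ω y (G x)) ∧ ∀ x ≠ 0, 0 < ω x (G x)

theorem IsPosSkew.nonneg {ω : BilinForm ℝ E} {G : E →L[ℝ] E} (hG : IsPosSkew ω G) (x : E) :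
    0 ≤ ω x (G x) := by
  rcases eq_or_ne x 0 with rfl | hx
  · simp
  · exact (hG.2 x hx).le

theorem IsCayley.sub_smul {ω : BilinForm ℝ E} (halt : ω.IsAlt) {N G : E →L[ℝ] E}
    (hN : IsCayley ω N) (hG : IsPosSkew ω G) (c : ℝ) : IsCayley ω (N - c • G) := by
  intro a b
  have h1 := hN a b
  have h2 := hG.1 a b
  have h3 := isAlt_skew halt b (G a)
  simp only [sub_apply, smul_apply, map_sub, map_smul, LinearMap.sub_apply,
    LinearMap.smul_apply, smul_eq_mul]
  rw [h2, h3]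
  linarith

/-- The symplectic automorphism whose resolvent is that of `B` decreased by `c G`. -/
noncomputable def pushEnd (G B : E →L[ℝ] E) (c : ℝ) : E →L[ℝ] E :=
  1 + Ring.inverse (res B - c • G)

theorem res_pushEnd {G B : E →L[ℝ] E} {c : ℝ} (hu : IsUnit (res B - c • G)) :
    res (pushEnd G B c) = res B - c • G := by
  rw [pushEnd, res, add_sub_cancel_left, Ring.inverse_inverse hu]

theorem isUnit_pushEnd_sub_one {G B : E →L[ℝ] E} {c : ℝ} (hu : IsUnit (res B - c • G)) :
    IsUnit (pushEnd G B c - 1) := by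
  rw [pushEnd, add_sub_cancel_left]
  exact hu.ringInverse

theorem pushEnd_zero (G : E →L[ℝ] E) {B : E →L[ℝ] E} (hu : IsUnit (B - 1)) :
    pushEnd G B 0 = B := by
  rw [pushEnd, zero_smul, sub_zero, res, Ring.inverse_inverse hu, add_sub_cancel]

theorem IsSp.pushEnd {ω : BilinForm ℝ E} (halt : ω.IsAlt) {G B : E →L[ℝ] E} {c : ℝ}
    (hG : IsPosSkew ω G) (hB : IsSp ω B) (hu : IsUnit (B - 1)) (hc : IsUnit (res B - c • G)) :
    IsSp ω (pushEnd G B c) :=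
  (IsCayley.sub_smul halt (form_res hB hu) hG c).isSp hc

/-- The path obtained from `A` by decreasing the resolvent of its endpoint by `c G` and composing
with a path of transvections. -/
noncomputable def upFun [FiniteDimensional ℝ E] (ω : BilinForm ℝ E) (G : E →L[ℝ] E)
    (A : C(I, E →L[ℝ] E)) (c : ℝ) (w : E) (t : I) : E →L[ℝ] E :=
  A t * Ring.inverse (A 1) * pushEnd G (A 1) (t * c) * transv ω w t

open Classical in
/-- A function as a continuous path, if it is continuous. -/
noncomputable def bundlePath (f : I → E →L[ℝ] E) : C(I, E →L[ℝ] E) :=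
  if h : Continuous f then ⟨f, h⟩ else 1

/-- `upFun` as a continuous path. -/
noncomputable def upPath [FiniteDimensional ℝ E] (ω : BilinForm ℝ E) (G : E →L[ℝ] E)
    (A : C(I, E →L[ℝ] E)) (c : ℝ) (w : E) : C(I, E →L[ℝ] E) :=
  bundlePath (upFun ω G A c w)

/-- The parameters for which `upPath` is a path in `ndPath` of larger index. -/
def IsUpParam (ω : BilinForm ℝ E) (G : E →L[ℝ] E) (A : C(I, E →L[ℝ] E)) (c : ℝ) (w : E) : Prop :=
  0 ≤ c ∧ (∀ t : I, IsUnit (res (A 1) - (t * c) • G)) ∧ ω w (res (A 1) w - c • G w) < -1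

theorem continuous_upFun [FiniteDimensional ℝ E] {X : Type*} [TopologicalSpace X]
    {ω : BilinForm ℝ E} (hnd : ω.Nondegenerate) {G : E →L[ℝ] E} {A : X → C(I, E →L[ℝ] E)}
    {c : X → ℝ} {w : X → E} {τ : X → I} (hA : Continuous A) (hc : Continuous c) (hw : Continuous w)
    (hτ : Continuous τ) (hnp : ∀ x, A x ∈ ndPath ω)
    (hup : ∀ x, IsUnit (res (A x 1) - (τ x * c x) • G)) :
    Continuous fun x => upFun ω G (A x) (c x) (w x) (τ x) := by
  have h1 : Continuous fun x => A x 1 := (continuous_eval_const (1 : I)).comp hA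
  have h2 : Continuous fun x => A x (τ x) := ContinuousEval.continuous_eval.comp (hA.prodMk hτ)
  have hτ' : Continuous fun x => (τ x : ℝ) := continuous_subtype_val.comp hτ
  have h3 : Continuous fun x => res (A x 1) :=
    continuous_ringInverse (h1.sub continuous_const) fun x => (hnp x).2.2
  exact ((h2.mul (continuous_ringInverse h1 fun x => ((hnp x).1 1).isUnit hnd)).mul
    (continuous_const.add (continuous_ringInverse
      (h3.sub ((hτ'.mul hc).smul continuous_const)) hup))).mul (continuous_transv ω hw hτ')

theorem upPath_apply [FiniteDimensional ℝ E] {ω : BilinForm ℝ E} (hnd : ω.Nondegenerate)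
    {G : E →L[ℝ] E} {A : C(I, E →L[ℝ] E)} {c : ℝ} {w : E} (hA : A ∈ ndPath ω)
    (hup : IsUpParam ω G A c w) (t : I) : upPath ω G A c w t = upFun ω G A c w t := by
  rw [upPath, bundlePath, dif_pos]
  · rfl
  · exact continuous_upFun hnd continuous_const continuous_const continuous_const continuous_id
      (fun _ => hA) hup.2.1

theorem joinedIn_upPath [FiniteDimensional ℝ E] {ω : BilinForm ℝ E} (halt : ω.IsAlt)
    (hnd : ω.Nondegenerate) {G : E →L[ℝ] E} (hG : IsPosSkew ω G) {A : I → C(I, E →L[ℝ] E)}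
    {c : I → ℝ} {w : I → E} (hA : Continuous A) (hc : Continuous c) (hw : Continuous w)
    (hnp : ∀ s, A s ∈ ndPath ω) (hup : ∀ s, IsUpParam ω G (A s) (c s) (w s)) :
    JoinedIn (ndPath ω) (upPath ω G (A 0) (c 0) (w 0)) (upPath ω G (A 1) (c 1) (w 1)) := by
  refine joinedIn_ndPath (fun p : I × I => upFun ω G (A p.1) (c p.1) (w p.1) p.2) ?_
    (fun t => (upPath_apply hnd (hnp 0) (hup 0) t).symm)
    (fun t => (upPath_apply hnd (hnp 1) (hup 1) t).symm) (fun p => ?_) (fun s => ?_) fun s => ?_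
  · exact continuous_upFun hnd (hA.comp continuous_fst) (hc.comp continuous_fst)
      (hw.comp continuous_fst) continuous_snd (fun _ => hnp _) (fun p => (hup p.1).2.1 p.2)
  · have h := hnp p.1
    exact (((h.1 _).mul ((h.1 1).ringInverse ((h.1 1).isUnit hnd))).mul
      ((h.1 1).pushEnd halt hG h.2.2 ((hup p.1).2.1 p.2))).mul (isSp_transv halt _ _)
  · have h := hnp s
    simp only [upFun, h.2.1, Set.Icc.coe_zero, zero_mul, transv_zero, pushEnd_zero G h.2.2]
    simp only [one_mul, mul_one]
    exact Ring.inverse_mul_cancel _ ((h.1 1).isUnit hnd)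
  · have h := hnp s
    have hu : IsUnit (res (A s 1) - c s • G) := by simpa using (hup s).2.1 1
    have h1 : upFun ω G (A s) (c s) (w s) 1 = pushEnd G (A s 1) (c s) * transv ω (w s) 1 := by
      simp only [upFun, Set.Icc.coe_one, one_mul, Ring.mul_inverse_cancel _ ((h.1 1).isUnit hnd)]
    rw [h1, isUnit_mul_transv_sub_one halt (isUnit_pushEnd_sub_one hu), res_pushEnd hu, one_mul]
    have h2 := (hup s).2.2
    simp only [sub_apply, smul_apply]
    linarith

theorem transv_neg_vec [FiniteDimensional ℝ E] (ω : BilinForm ℝ E) (w : E) (k : ℝ) :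
    transv ω (-w) k = transv ω w k := by
  ext x
  simp [transv_apply]

theorem upPath_neg [FiniteDimensional ℝ E] (ω : BilinForm ℝ E) (G : E →L[ℝ] E)
    (A : C(I, E →L[ℝ] E)) (c : ℝ) (w : E) : upPath ω G A c (-w) = upPath ω G A c w := by
  have h : upFun ω G A c (-w) = upFun ω G A c w := by
    funext t
    rw [upFun, transv_neg_vec, upFun]
  rw [upPath, h, upPath]

theorem upPath_zero [FiniteDimensional ℝ E] {ω : BilinForm ℝ E} (hnd : ω.Nondegenerate)
    {G : E →L[ℝ] E} {A : C(I, E →L[ℝ] E)} {w : E} (hA : A ∈ ndPath ω)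
    (hup : IsUpParam ω G A 0 w) : upPath ω G A 0 w = A * linTransvPath ω w 1 := by
  ext1 t
  rw [upPath_apply hnd hA hup, upFun, mul_zero, pushEnd_zero G hA.2.2, mul_assoc (A t),
    Ring.inverse_mul_cancel _ ((hA.1 1).isUnit hnd), mul_one, ContinuousMap.mul_apply,
    linTransvPath_apply, mul_one]

theorem joinedIn_upPath_vec_of_le [FiniteDimensional ℝ E] {ω : BilinForm ℝ E} (halt : ω.IsAlt)
    (hnd : ω.Nondegenerate) {G : E →L[ℝ] E} (hG : IsPosSkew ω G) {A : C(I, E →L[ℝ] E)} {c : ℝ}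
    {w v : E} (hA : A ∈ ndPath ω) (hw : IsUpParam ω G A c w) (hv : IsUpParam ω G A c v)
    (hwv : ω w (res (A 1) v - c • G v) + ω v (res (A 1) w - c • G w) ≤ 0) :
    JoinedIn (ndPath ω) (upPath ω G A c w) (upPath ω G A c v) := by
  have h := joinedIn_upPath halt hnd hG (A := fun _ => A) (c := fun _ => c)
    (w := fun s : I => (1 + 2 * s * (1 - s) : ℝ) • ((1 - s : ℝ) • w + (s : ℝ) • v))
    continuous_const continuous_const (by fun_prop) (fun _ => hA) (fun s => ⟨hw.1, hw.2.1, ?_⟩)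
  · simpa using h
  · have e1 := hw.2.2
    have e2 := hv.2.2
    have hs0 := s.2.1
    have hs1 := s.2.2
    generalize (s : ℝ) = r at *
    simp only [map_sub, map_smul, smul_eq_mul, map_add, LinearMap.add_apply, LinearMap.smul_apply]
      at e1 e2 hwv ⊢
    set a := ω w (res (A 1) w)
    set b := ω v (res (A 1) v)
    set a' := ω w (G w)
    set b' := ω v (G v)
    set p := ω w (res (A 1) v)
    set p' := ω w (G v)
    set q := ω v (res (A 1) w)
    set q' := ω v (G w)
    have hx : 0 ≤ r * (1 - r) := mul_nonneg hs0 (by linarith)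
    have hx4 : r * (1 - r) ≤ 1 / 4 := by nlinarith [sq_nonneg (r - 1 / 2)]
    have key : (1 - r) ^ 2 * (a - c * a') + r ^ 2 * (b - c * b')
        + r * (1 - r) * (p - c * p' + (q - c * q')) < -(1 - 2 * (r * (1 - r))) := by
      have h3 : r * (1 - r) * (p - c * p' + (q - c * q')) ≤ 0 :=
        mul_nonpos_of_nonneg_of_nonpos hx hwv
      rcases eq_or_lt_of_le hs0 with h0 | h0
      · rw [← h0]
        linarith
      · have h4 : r ^ 2 * (b - c * b') < r ^ 2 * -1 := mul_lt_mul_of_pos_left e2 (by positivity)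
        have h5 : (1 - r) ^ 2 * (a - c * a') ≤ (1 - r) ^ 2 * -1 :=
          mul_le_mul_of_nonneg_left e1.le (by positivity)
        nlinarith
    generalize hX : r * (1 - r) = X at *
    have hC : 1 ≤ (1 + 2 * X) ^ 2 * (1 - 2 * X) := by
      have : 0 ≤ X * (2 - 4 * X - 8 * X ^ 2) := mul_nonneg hx (by nlinarith)
      nlinarith
    have hpos : 0 < (1 + 2 * X) ^ 2 := by positivity
    have := mul_lt_mul_of_pos_left key hpos
    have h2X : 2 * r * (1 - r) = 2 * X := by rw [mul_assoc, hX]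
    rw [h2X]
    have hX' : X = r * (1 - r) := hX.symm
    calc _ = (1 + 2 * X) ^ 2 * ((1 - r) ^ 2 * (a - c * a') + r ^ 2 * (b - c * b')
        + r * (1 - r) * (p - c * p' + (q - c * q'))) := by ring
      _ < (1 + 2 * X) ^ 2 * -(1 - 2 * X) := by rwa [hX]
      _ ≤ -1 := by linarith

theorem joinedIn_upPath_vec [FiniteDimensional ℝ E] {ω : BilinForm ℝ E} (halt : ω.IsAlt)
    (hnd : ω.Nondegenerate) {G : E →L[ℝ] E} (hG : IsPosSkew ω G) {A : C(I, E →L[ℝ] E)} {c : ℝ}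
    {w v : E} (hA : A ∈ ndPath ω) (hw : IsUpParam ω G A c w) (hv : IsUpParam ω G A c v) :
    JoinedIn (ndPath ω) (upPath ω G A c w) (upPath ω G A c v) := by
  rcases le_total (ω w (res (A 1) v - c • G v) + ω v (res (A 1) w - c • G w)) 0 with h | h
  · exact joinedIn_upPath_vec_of_le halt hnd hG hA hw hv h
  · rw [← upPath_neg ω G A c v]
    refine joinedIn_upPath_vec_of_le halt hnd hG hA hw ⟨hv.1, hv.2.1, ?_⟩ ?_
    · simpa only [map_neg, ← sub_eq_add_neg, smul_neg, ← neg_sub', LinearMap.neg_apply, neg_neg]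
        using hv.2.2
    · simp only [map_neg, map_sub, map_smul, LinearMap.neg_apply, smul_eq_mul, mul_neg] at h ⊢
      linarith

theorem joinedIn_upPath_param_of_le [FiniteDimensional ℝ E] {ω : BilinForm ℝ E} (halt : ω.IsAlt)
    (hnd : ω.Nondegenerate) {G : E →L[ℝ] E} (hG : IsPosSkew ω G) {A : C(I, E →L[ℝ] E)} {c d : ℝ}
    {w v : E} (hA : A ∈ ndPath ω) (hw : IsUpParam ω G A c w) (hv : IsUpParam ω G A d v)
    (hcd : c ≤ d) : JoinedIn (ndPath ω) (upPath ω G A c w) (upPath ω G A d v) := by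
  have hx : ∀ x, c ≤ x → x ≤ d → IsUpParam ω G A x w := by
    refine fun x hcx hxd => ⟨hw.1.trans hcx, fun t => ?_, ?_⟩
    · rcases eq_or_lt_of_le (hw.1.trans hcx) with h0 | h0
      · have := hw.2.1 0
        rw [← h0]
        simpa using this
      · have hd : 0 < d := h0.trans_le hxd
        have ht : t * x / d ∈ I := ⟨by have := t.2.1; positivity,
          (div_le_one hd).2 (by nlinarith [t.2.2, t.2.1])⟩
        have := hv.2.1 ⟨_, ht⟩
        rwa [div_mul_cancel₀ _ hd.ne'] at this
    · have h1 := hw.2.2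
      have h2 := mul_le_mul_of_nonneg_right hcx (hG.nonneg w)
      rw [map_sub, map_smul, smul_eq_mul] at h1 ⊢
      linarith
  have h := joinedIn_upPath halt hnd hG (A := fun _ => A) (c := fun s : I => c + s * (d - c))
    (w := fun _ => w) continuous_const (by fun_prop) continuous_const (fun _ => hA) fun s =>
      hx _ (by nlinarith [s.2.1]) (by nlinarith [s.2.2])
  have h2 : JoinedIn (ndPath ω) (upPath ω G A c w) (upPath ω G A d w) := by simpa using h
  exact h2.trans (joinedIn_upPath_vec halt hnd hG hA (hx d hcd le_rfl) hv)

theorem joinedIn_upPath_param [FiniteDimensional ℝ E] {ω : BilinForm ℝ E} (halt : ω.IsAlt)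
    (hnd : ω.Nondegenerate) {G : E →L[ℝ] E} (hG : IsPosSkew ω G) {A : C(I, E →L[ℝ] E)} {c d : ℝ}
    {w v : E} (hA : A ∈ ndPath ω) (hw : IsUpParam ω G A c w) (hv : IsUpParam ω G A d v) :
    JoinedIn (ndPath ω) (upPath ω G A c w) (upPath ω G A d v) := by
  rcases le_total c d with h | h
  · exact joinedIn_upPath_param_of_le halt hnd hG hA hw hv h
  · exact (joinedIn_upPath_param_of_le halt hnd hG hA hv hw h).symm

theorem exists_smul_lt_neg_one {ω : BilinForm ℝ E} {N : E →L[ℝ] E} {v : E}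
    (hv : ω v (N v) < 0) : ∃ w, ω w (N w) < -1 := by
  refine ⟨(1 + (-ω v (N v))⁻¹) • v, ?_⟩
  simp only [map_smul, LinearMap.smul_apply, smul_eq_mul]
  generalize ω v (N v) = q at *
  have h1 : 0 < (-q)⁻¹ := by
    rw [inv_pos]
    linarith
  have h2 : (-q)⁻¹ * q = -1 := by rw [inv_neg, neg_mul, inv_mul_cancel₀ hv.ne]
  nlinarith

theorem exists_isUpParam [FiniteDimensional ℝ E] {ω : BilinForm ℝ E} (halt : ω.IsAlt)
    (hnd : ω.Nondegenerate) {G : E →L[ℝ] E} (hG : IsPosSkew ω G) {A : C(I, E →L[ℝ] E)}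
    (hA : A ∈ ndPath ω) {u : E} (hu : u ≠ 0) : ∃ c w, IsUpParam ω G A c w := by
  have hN : IsCayley ω (res (A 1)) := form_res (hA.1 1) hA.2.2
  have hNu : IsUnit (res (A 1)) := hA.2.2.ringInverse
  unfold IsUpParam
  generalize res (A 1) = N at *
  by_cases hneg : ∃ v, ω v (N v) < 0
  · obtain ⟨v, hv⟩ := hneg
    obtain ⟨w, hw⟩ := exists_smul_lt_neg_one hv
    exact ⟨0, w, le_rfl, fun t => by simpa using hNu, by simpa using hw⟩
  push Not at hneg
  let S : Set ℝ := {c | 0 ≤ c ∧ ∀ x, c * ω x (G x) ≤ ω x (N x)}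
  have h0 : (0 : ℝ) ∈ S := ⟨le_rfl, fun x => by simpa using hneg x⟩
  have hbdd : BddAbove S := ⟨ω u (N u) / ω u (G u), fun c hc =>
    (le_div_iff₀ (hG.2 u hu)).2 (hc.2 u)⟩
  have hclosed : IsClosed S := by
    have : S = Set.Ici 0 ∩ ⋂ x, {c | c * ω x (G x) ≤ ω x (N x)} := by
      ext c
      simp [S]
    rw [this]
    exact isClosed_Ici.inter (isClosed_iInter fun x =>
      isClosed_le (by fun_prop) continuous_const)
  have hs : sSup S ∈ S := hclosed.csSup_mem ⟨0, h0⟩ hbdd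
  have hunit : ∀ c ≤ sSup S, IsUnit (N - c • G) := by
    refine fun c hc => (hN.sub_smul halt hG c).isUnit_of_nonneg hnd fun x => ?_
    have h1 := hs.2 x
    have h2 := mul_le_mul_of_nonneg_right hc (hG.nonneg x)
    simp only [sub_apply, smul_apply, map_sub, map_smul, smul_eq_mul]
    linarith
  have hopen : IsOpen {c : ℝ | IsUnit (N - c • G)} :=
    Units.isOpen.preimage (f := fun c : ℝ => N - c • G) (by fun_prop)
  obtain ⟨ε, hε, hball⟩ := Metric.isOpen_iff.1 hopen _ (hunit _ le_rfl)
  have hc : sSup S + ε / 2 ∉ S := fun h => by linarith [le_csSup hbdd h]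
  have hpos : 0 ≤ sSup S + ε / 2 := by linarith [hs.1]
  have hv : ∃ v, ω v ((N - (sSup S + ε / 2) • G) v) < 0 := by
    by_contra! h
    refine hc ⟨hpos, fun x => ?_⟩
    have := h x
    simp only [sub_apply, smul_apply, map_sub, map_smul, smul_eq_mul] at this
    linarith
  obtain ⟨v, hv⟩ := hv
  obtain ⟨w, hw⟩ := exists_smul_lt_neg_one hv
  refine ⟨_, w, hpos, fun t => ?_, hw⟩
  have ht : t * (sSup S + ε / 2) ≤ sSup S + ε / 2 := mul_le_of_le_one_left hpos t.2.2
  rcases le_total (t * (sSup S + ε / 2)) (sSup S) with h | h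
  · exact hunit _ h
  · refine hball ?_
    rw [Metric.mem_ball, Real.dist_eq, abs_of_nonneg (by linarith)]
    linarith

theorem IsUpParam.eventually [FiniteDimensional ℝ E] {ω : BilinForm ℝ E} {G : E →L[ℝ] E}
    {γ : ℝ → C(I, E →L[ℝ] E)} (hγ : Continuous γ) (hnp : ∀ s, γ s ∈ ndPath ω) {s : ℝ} {c : ℝ}
    {w : E} (hup : IsUpParam ω G (γ s) c w) : ∀ᶠ r in nhds s, IsUpParam ω G (γ r) c w := by
  have h1 : Continuous fun r => res (γ r 1) := continuous_ringInverse
    (((continuous_eval_const (1 : I)).comp hγ).sub continuous_const) fun r => (hnp r).2.2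
  have h2 : ∀ᶠ r in nhds s, ∀ t ∈ (Set.univ : Set I), IsUnit (res (γ r 1) - (t * c) • G) := by
    refine isCompact_univ.eventually_forall_of_forall_eventually fun t _ => ?_
    have hcont : Continuous fun p : ℝ × I => res (γ p.1 1) - (p.2 * c : ℝ) • G :=
      (h1.comp continuous_fst).sub (by fun_prop)
    exact hcont.continuousAt.eventually (Units.isOpen.mem_nhds (hup.2.1 t))
  have h3 : Continuous fun r => ω w (res (γ r 1) w - c • G w) :=
    continuous_form_apply ω continuous_const
      ((h1.clm_apply continuous_const).sub continuous_const)
  filter_upwards [h2, h3.continuousAt.eventually (gt_mem_nhds hup.2.2)] with r hr1 hr2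
  exact ⟨hup.1, fun t => hr1 t (Set.mem_univ t), hr2⟩

/-- Up to homotopy, composing with a path of transvections crossing the degenerate locus in the
positive direction only depends on the component of the path. -/
theorem JoinedIn.mul_linTransvPath [FiniteDimensional ℝ E] {ω : BilinForm ℝ E} (halt : ω.IsAlt)
    (hnd : ω.Nondegenerate) {A B : C(I, E →L[ℝ] E)} (hAB : JoinedIn (ndPath ω) A B) {u v : E}
    (hu : ω u (res (A 1) u) < -1) (hv : ω v (res (B 1) v) < -1) :
    JoinedIn (ndPath ω) (A * linTransvPath ω u 1) (B * linTransvPath ω v 1) := by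
  obtain ⟨G, hG⟩ : ∃ G, IsPosSkew ω G := exists_posDef_form halt hnd
  have hA : A ∈ ndPath ω := hAB.source_mem
  have hB : B ∈ ndPath ω := hAB.target_mem
  have hu0 : u ≠ 0 := by
    rintro rfl
    norm_num at hu
  obtain ⟨γ, hγ⟩ := hAB
  have hnp : ∀ s, γ.extend s ∈ ndPath ω := fun s => hγ _
  have hc := γ.continuous_extend
  choose c w hcw using fun s => exists_isUpParam halt hnd hG (hnp s) hu0
  have hloc : IsLocallyConstant fun s =>
      pathComponentIn (ndPath ω) (upPath ω G (γ.extend s) (c s) (w s)) := by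
    rw [IsLocallyConstant.iff_eventually_eq]
    intro s
    obtain ⟨ε, hε, hball⟩ := Metric.eventually_nhds_iff_ball.1 ((hcw s).eventually hc hnp)
    filter_upwards [Metric.ball_mem_nhds s hε] with r hr
    refine (pathComponentIn_congr ?_).symm
    have hseg : ∀ x : I, s + x * (r - s) ∈ Metric.ball s ε := fun x => by
      rw [Metric.mem_ball, Real.dist_eq] at hr ⊢
      rw [add_sub_cancel_left, abs_mul, abs_of_nonneg x.2.1]
      exact (mul_le_of_le_one_left (abs_nonneg _) x.2.2).trans_lt hr
    have h1 := joinedIn_upPath halt hnd hG (A := fun x : I => γ.extend (s + x * (r - s)))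
      (c := fun _ => c s) (w := fun _ => w s) (hc.comp (by fun_prop)) continuous_const
      continuous_const (fun _ => hnp _) fun x => hball _ (hseg x)
    simp only [Set.Icc.coe_zero, zero_mul, add_zero, Set.Icc.coe_one, one_mul,
      add_sub_cancel] at h1
    exact (h1.trans (joinedIn_upPath_param halt hnd hG (hnp r) (hball r hr) (hcw r))).symm
  have h01 := hloc.apply_eq_of_preconnectedSpace 0 1
  have e0 := hcw 0
  have e1 := hcw 1
  simp only [γ.extend_zero, γ.extend_one] at h01 e0 e1
  have hu' : IsUpParam ω G A 0 u :=
    ⟨le_rfl, fun t => by simpa using isUnit_res hA.2.2, by simpa using hu⟩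
  have hv' : IsUpParam ω G B 0 v :=
    ⟨le_rfl, fun t => by simpa using isUnit_res hB.2.2, by simpa using hv⟩
  have j0 := joinedIn_upPath_param halt hnd hG hA hu' e0
  have j1 := joinedIn_upPath_param halt hnd hG hB hv' e1
  rw [upPath_zero hnd hA hu'] at j0
  rw [upPath_zero hnd hB hv'] at j1
  have hmem : upPath ω G B (c 1) (w 1) ∈ pathComponentIn (ndPath ω) (upPath ω G A (c 0) (w 0)) := by
    rw [h01]
    exact mem_pathComponentIn_self j1.target_mem
  exact (j0.trans hmem).trans j1.symm

end UpStep

section UpRelation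

open scoped unitInterval

theorem nondegenerate_neg_form {ω : BilinForm ℝ E} (hnd : ω.Nondegenerate) :
    (-ω).Nondegenerate := by
  refine ⟨fun x hx => hnd.1 x fun y => ?_, fun y hy => hnd.2 y fun x => ?_⟩
  · simpa using hx y
  · simpa using hy x

theorem JoinedIn.of_mul_linTransvPath [FiniteDimensional ℝ E] {ω : BilinForm ℝ E} (halt : ω.IsAlt)
    (hnd : ω.Nondegenerate) {A B : C(I, E →L[ℝ] E)} (hA : A ∈ ndPath ω) (hB : B ∈ ndPath ω)
    {u v : E} (hu : ω u (res (A 1) u) < -1) (hv : ω v (res (B 1) v) < -1)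
    (hAB : JoinedIn (ndPath ω) (A * linTransvPath ω u 1) (B * linTransvPath ω v 1)) :
    JoinedIn (ndPath ω) A B := by
  have hQ : ∀ {A : C(I, E →L[ℝ] E)} {u : E}, A ∈ ndPath ω → ω u (res (A 1) u) < -1 →
      (-ω) u (res ((A * linTransvPath ω u 1) 1) u) < -1 := by
    intro A u hA hu
    have h : (A * linTransvPath ω u 1) 1 = A 1 * transv ω u 1 := by
      simp [linTransvPath_apply]
    rw [h, LinearMap.neg_apply, LinearMap.neg_apply,
      form_res_mul_transv halt hA.2.2 (by linarith), one_mul, neg_lt_neg_iff,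
      lt_div_iff_of_neg (by linarith)]
    linarith
  have hmul : ∀ (A : C(I, E →L[ℝ] E)) (u : E),
      A * linTransvPath ω u 1 * linTransvPath (-ω) u 1 = A := by
    intro A u
    ext1 t
    have := congrArg (fun f : C(I, E →L[ℝ] E) => f t) (linTransvPath_mul_neg halt u 1)
    simp only [ContinuousMap.mul_apply, ContinuousMap.one_apply] at this
    rw [linTransvPath_neg_form, ContinuousMap.mul_apply, ContinuousMap.mul_apply, mul_assoc, this,
      mul_one]
  rw [← ndPath_neg] at hAB ⊢
  have h := hAB.mul_linTransvPath (fun x => by simp [halt x]) (nondegenerate_neg_form hnd)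
    (hQ hA hu) (hQ hB hv)
  rwa [hmul, hmul] at h

/-- One component of `ndPath` is obtained from another by crossing the degenerate locus once in the
positive direction. -/
def UpRel [FiniteDimensional ℝ E] (ω : BilinForm ℝ E) (x y : Set C(I, E →L[ℝ] E)) : Prop :=
  ∃ A ∈ ndPath ω, ∃ u, ω u (res (A 1) u) < -1 ∧ x = pathComponentIn (ndPath ω) A ∧
    y = pathComponentIn (ndPath ω) (A * linTransvPath ω u 1)

theorem pathComponentIn_eq_iff {X : Type*} [TopologicalSpace X] {F : Set X} {x y : X} (hy : y ∈ F) :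
    pathComponentIn F x = pathComponentIn F y ↔ JoinedIn F x y := by
  refine ⟨fun h => ?_, fun h => (pathComponentIn_congr h).symm⟩
  have := mem_pathComponentIn_self hy
  rwa [← h] at this

theorem UpRel.rightUnique [FiniteDimensional ℝ E] {ω : BilinForm ℝ E} (halt : ω.IsAlt)
    (hnd : ω.Nondegenerate) : Relator.RightUnique (UpRel ω) := by
  rintro x y z ⟨A, hA, u, hu, rfl, rfl⟩ ⟨B, hB, v, hv, hx, rfl⟩
  rw [pathComponentIn_eq_iff hB] at hx
  have h := hx.mul_linTransvPath halt hnd hu hv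
  exact (pathComponentIn_eq_iff h.target_mem).2 h

theorem UpRel.leftUnique [FiniteDimensional ℝ E] {ω : BilinForm ℝ E} (halt : ω.IsAlt)
    (hnd : ω.Nondegenerate) : Relator.LeftUnique (UpRel ω) := by
  rintro x y z ⟨A, hA, u, hu, rfl, rfl⟩ ⟨B, hB, v, hv, rfl, hz⟩
  rw [pathComponentIn_eq_iff ((mul_linTransvPath_mem halt hB).2 (by linarith))] at hz
  exact (pathComponentIn_eq_iff hB).2 (hz.of_mul_linTransvPath halt hnd hA hB hu hv)

theorem Relation.EqvGen.reflTransGen_or {α : Type*} {r : α → α → Prop} (hr : Relator.RightUnique r)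
    (hl : Relator.LeftUnique r) {x y : α} (h : Relation.EqvGen r x y) :
    Relation.ReflTransGen r x y ∨ Relation.ReflTransGen r y x := by
  induction h with
  | rel x y h => exact Or.inl (Relation.ReflTransGen.single h)
  | refl x => exact Or.inl Relation.ReflTransGen.refl
  | symm x y _ ih => exact ih.symm
  | trans x y z _ _ ih₁ ih₂ =>
    rcases ih₁ with h₁ | h₁ <;> rcases ih₂ with h₂ | h₂
    · exact Or.inl (h₁.trans h₂)
    · have hsw : Relator.RightUnique (Function.swap r) := fun _ _ _ hab hac => hl hab hac
      have := Relation.ReflTransGen.total_of_right_unique hsw (Relation.reflTransGen_swap.2 h₁)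
        (Relation.reflTransGen_swap.2 h₂)
      simpa only [Relation.reflTransGen_swap, or_comm] using this
    · exact Relation.ReflTransGen.total_of_right_unique hr h₁ h₂
    · exact Or.inr (h₂.trans h₁)

theorem muIndex_lt_or_eq_of_reflTransGen [FiniteDimensional ℝ E] {ω : BilinForm ℝ E}
    (halt : ω.IsAlt) (hnd : ω.Nondegenerate) {x y : Set C(I, E →L[ℝ] E)}
    (h : Relation.ReflTransGen (UpRel ω) x y) {A B : C(I, E →L[ℝ] E)} (hB : B ∈ ndPath ω)
    (hx : x = pathComponentIn (ndPath ω) A)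
    (hy : y = pathComponentIn (ndPath ω) B) : muIndex ω A < muIndex ω B ∨ x = y := by
  induction h generalizing B with
  | refl => exact Or.inr rfl
  | tail _ hyz ih =>
    obtain ⟨C, hC, u, hu, rfl, rfl⟩ := hyz
    rw [pathComponentIn_eq_iff hB] at hy
    have h1 := hy.muIndex_eq halt hnd
    have h2 := muIndex_lt halt hnd hC hu
    left
    rcases ih hC rfl with h3 | h3
    · linarith
    · rw [hx, pathComponentIn_eq_iff hC] at h3
      have := h3.muIndex_eq halt hnd
      linarith

theorem JoinedIn.of_eqvGen_upRel [FiniteDimensional ℝ E] {ω : BilinForm ℝ E}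
    (halt : ω.IsAlt) (hnd : ω.Nondegenerate) {A B : C(I, E →L[ℝ] E)} (hA : A ∈ ndPath ω)
    (hB : B ∈ ndPath ω)
    (h : Relation.EqvGen (UpRel ω) (pathComponentIn (ndPath ω) A) (pathComponentIn (ndPath ω) B))
    (hmu : muIndex ω A = muIndex ω B) : JoinedIn (ndPath ω) A B := by
  rcases h.reflTransGen_or (UpRel.rightUnique halt hnd) (UpRel.leftUnique halt hnd) with h | h
  · rcases muIndex_lt_or_eq_of_reflTransGen halt hnd h hB rfl rfl with h | h
    · exact absurd hmu h.ne
    · exact (pathComponentIn_eq_iff hB).1 h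
  · rcases muIndex_lt_or_eq_of_reflTransGen halt hnd h hA rfl rfl with h | h
    · exact absurd hmu.symm h.ne
    · exact ((pathComponentIn_eq_iff hA).1 h).symm

theorem joinedIn_mul_transvPath [FiniteDimensional ℝ E] {ω : BilinForm ℝ E} (halt : ω.IsAlt)
    {A P : C(I, E →L[ℝ] E)} (hA : A ∈ ndPath ω) (hP : ∀ t, IsSp ω (P t)) (hP0 : P 0 = 1)
    {w w' : C(I, E)} {κ κ' : C(I, ℝ)} (hκ : κ 0 = 0) (hκ' : κ' 0 = 0)
    (hu : ∀ s : I, IsUnit (A 1 * transv ω ((1 - s : ℝ) • w 1 + (s : ℝ) • w' 1)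
      ((1 - s) * κ 1 + s * κ' 1) * P 1 - 1)) :
    JoinedIn (ndPath ω) (A * transvPath ω w κ * P) (A * transvPath ω w' κ' * P) := by
  refine joinedIn_ndPath (fun p : I × I => A p.2 * transv ω ((1 - p.1 : ℝ) • w p.2
    + (p.1 : ℝ) • w' p.2) ((1 - p.1) * κ p.2 + p.1 * κ' p.2) * P p.2) ?_ (fun t => ?_) (fun t => ?_)
    (fun p => ((hA.1 _).mul (isSp_transv halt _ _)).mul (hP _)) (fun s => ?_) hu
  · refine ((A.continuous.comp continuous_snd).mul (continuous_transv ω ?_ ?_)).mul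
      (P.continuous.comp continuous_snd) <;> fun_prop
  · simp [transvPath_apply]
  · simp [transvPath_apply]
  · simp [hκ, hκ', hP0, hA.2.1]

theorem linTransvPath_eq [FiniteDimensional ℝ E] (ω : BilinForm ℝ E) (u : E) (k : ℝ) :
    linTransvPath ω u k
      = transvPath ω (ContinuousMap.const I u) ⟨fun t => t * k, by fun_prop⟩ := rfl

theorem eqvGen_upRel_mul_linTransvPath [FiniteDimensional ℝ E] {ω : BilinForm ℝ E} (halt : ω.IsAlt)
    {A : C(I, E →L[ℝ] E)} (hA : A ∈ ndPath ω) {u : E} {k : ℝ}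
    (hAk : A * linTransvPath ω u k ∈ ndPath ω) :
    Relation.EqvGen (UpRel ω) (pathComponentIn (ndPath ω) A)
      (pathComponentIn (ndPath ω) (A * linTransvPath ω u k)) := by
  have hne := (mul_linTransvPath_mem halt hA).1 hAk
  rcases lt_or_gt_of_ne hne with h | h
  · have hk : k ≠ 0 := by
      rintro rfl
      norm_num at h
    rcases lt_or_gt_of_ne hk with hk | hk
    · refine Relation.EqvGen.symm _ _ (Relation.EqvGen.rel _ _
        ⟨_, hAk, √(-k) • u, ?_, rfl, ?_⟩)
      · have h1 : (A * linTransvPath ω u k) 1 = A 1 * transv ω u k := by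
          simp [linTransvPath_apply]
        simp only [h1, map_smul, LinearMap.smul_apply, smul_eq_mul]
        rw [← mul_assoc, Real.mul_self_sqrt (by linarith), form_res_mul_transv halt hA.2.2 hne,
          ← mul_div_assoc, div_lt_iff_of_neg h]
        linarith
      · congr 1
        ext1 t
        have := congrArg (fun f : C(I, E →L[ℝ] E) => f t) (linTransvPath_mul_neg halt u k)
        simp only [ContinuousMap.mul_apply, ContinuousMap.one_apply] at this
        rw [linTransvPath_smul, Real.sq_sqrt (by linarith), mul_one, ContinuousMap.mul_apply,
          ContinuousMap.mul_apply, mul_assoc, this, mul_one]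
    · refine Relation.EqvGen.rel _ _ ⟨A, hA, √k • u, ?_, rfl, ?_⟩
      · simp only [map_smul, LinearMap.smul_apply, smul_eq_mul]
        rw [← mul_assoc, Real.mul_self_sqrt hk.le]
        linarith
      · rw [linTransvPath_smul, Real.sq_sqrt hk.le, mul_one]
  · have hj := joinedIn_mul_transvPath halt (P := 1) hA (fun _ => isSp_one ω) rfl
      (w := ContinuousMap.const I u) (w' := ContinuousMap.const I u)
      (κ := ⟨fun t => t * 0, by fun_prop⟩) (κ' := ⟨fun t => t * k, by fun_prop⟩)
      (by simp) (by simp) fun s => by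
        have hs : (1 - s : ℝ) • u + (s : ℝ) • u = u := by module
        simp only [ContinuousMap.const_apply, hs, ContinuousMap.coe_mk, mul_zero, zero_add,
          Set.Icc.coe_one, one_mul, ContinuousMap.one_apply, mul_one]
        rw [isUnit_mul_transv_sub_one halt hA.2.2]
        have e : 1 + s * k * ω u (res (A 1) u)
            = (1 - s) + s * (1 + k * ω u (res (A 1) u)) := by ring
        rw [e]
        rcases eq_or_lt_of_le s.2.2 with h1 | h1
        · rw [h1]
          linarith
        · have := mul_nonneg s.2.1 h.le
          linarith
    rw [← linTransvPath_eq, ← linTransvPath_eq] at hj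
    have e0 : A * linTransvPath ω u 0 * 1 = A := by
      ext1 t
      simp [linTransvPath_apply]
    have e1 : A * linTransvPath ω u k * 1 = A * linTransvPath ω u k := by
      ext1 t
      simp
    rw [e0, e1] at hj
    rw [(pathComponentIn_eq_iff hj.target_mem).2 hj]
    exact Relation.EqvGen.refl _

/-- The products of paths of transvections issued from the identity. -/
inductive IsTransvWord [FiniteDimensional ℝ E] (ω : BilinForm ℝ E) : C(I, E →L[ℝ] E) → Prop
  | one : IsTransvWord ω 1
  | mul_left (w : C(I, E)) (κ : C(I, ℝ)) (hκ : κ 0 = 0) (P : C(I, E →L[ℝ] E)) :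
      IsTransvWord ω P → IsTransvWord ω (transvPath ω w κ * P)

theorem IsTransvWord.mul [FiniteDimensional ℝ E] {ω : BilinForm ℝ E} {P Q : C(I, E →L[ℝ] E)}
    (hP : IsTransvWord ω P) (hQ : IsTransvWord ω Q) : IsTransvWord ω (P * Q) := by
  induction hP with
  | one =>
    have : 1 * Q = Q := by
      ext1 t
      simp
    rwa [this]
  | mul_left w κ hκ P _ ih =>
    have : transvPath ω w κ * P * Q = transvPath ω w κ * (P * Q) := by
      ext1 t
      simp only [ContinuousMap.mul_apply, mul_assoc]
    rw [this]
    exact IsTransvWord.mul_left w κ hκ _ ih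

theorem IsTransvWord.isSp [FiniteDimensional ℝ E] {ω : BilinForm ℝ E} (halt : ω.IsAlt)
    {P : C(I, E →L[ℝ] E)} (hP : IsTransvWord ω P) : (∀ t, IsSp ω (P t)) ∧ P 0 = 1 := by
  induction hP with
  | one => exact ⟨fun t => isSp_one ω, rfl⟩
  | mul_left w κ hκ P _ ih =>
    exact ⟨fun t => (isSp_transv halt _ _).mul (ih.1 t),
      by rw [ContinuousMap.mul_apply, transvPath_apply, hκ, transv_zero, ih.2, one_mul]⟩

theorem eqvGen_upRel_mul [FiniteDimensional ℝ E] {ω : BilinForm ℝ E} (halt : ω.IsAlt)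
    {P : C(I, E →L[ℝ] E)} (hP : IsTransvWord ω P) {A : C(I, E →L[ℝ] E)} (hA : A ∈ ndPath ω)
    (hAP : A * P ∈ ndPath ω) :
    Relation.EqvGen (UpRel ω) (pathComponentIn (ndPath ω) A)
      (pathComponentIn (ndPath ω) (A * P)) := by
  induction hP generalizing A with
  | one =>
    have : A * 1 = A := by
      ext1 t
      simp
    rw [this]
    exact Relation.EqvGen.refl _
  | mul_left w κ hκ Y hY ih =>
    obtain ⟨hYsp, hY0⟩ := hY.isSp halt
    have hassoc : A * (transvPath ω w κ * Y) = A * transvPath ω w κ * Y := by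
      ext1 t
      simp only [ContinuousMap.mul_apply, mul_assoc]
    rw [hassoc] at hAP ⊢
    have hcont : Continuous fun δ : ℝ => A 1 * transv ω (w 1) (κ 1 + δ) * Y 1 - 1 :=
      ((continuous_const.mul (continuous_transv ω continuous_const (by fun_prop))).mul
        continuous_const).sub continuous_const
    have hopen : IsOpen {δ : ℝ | IsUnit (A 1 * transv ω (w 1) (κ 1 + δ) * Y 1 - 1)} :=
      Units.isOpen.preimage hcont
    have h0 : IsUnit (A 1 * transv ω (w 1) (κ 1 + 0) * Y 1 - 1) := by
      rw [add_zero]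
      exact hAP.2.2
    obtain ⟨ε, hε, hball⟩ := Metric.isOpen_iff.1 hopen 0 h0
    obtain ⟨δ, hδ0, hδ, hδne⟩ : ∃ δ : ℝ, 0 ≤ δ ∧ δ < ε ∧
        1 + (κ 1 + δ) * ω (w 1) (res (A 1) (w 1)) ≠ 0 := by
      generalize ω (w 1) (res (A 1) (w 1)) = q
      by_cases hq : 1 + (κ 1 + ε / 2) * q = 0
      · refine ⟨ε / 3, by linarith, by linarith, fun h => ?_⟩
        have hq0 : ε * q = 0 := by linarith
        rcases mul_eq_zero.1 hq0 with h1 | h1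
        · exact hε.ne' h1
        · rw [h1] at hq
          norm_num at hq
      · exact ⟨ε / 2, by linarith, by linarith, hq⟩
    let κδ : C(I, ℝ) := ⟨fun t => κ t + t * δ, by fun_prop⟩
    have hκδ0 : κδ 0 = 0 := by simp [κδ, hκ]
    have hκδ1 : κδ 1 = κ 1 + δ := by simp [κδ]
    have hj1 : JoinedIn (ndPath ω) (A * transvPath ω w κ * Y) (A * transvPath ω w κδ * Y) := by
      refine joinedIn_mul_transvPath halt hA hYsp hY0 hκ hκδ0 fun s => ?_
      have e1 : (1 - s : ℝ) • w 1 + (s : ℝ) • w 1 = w 1 := by module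
      have e2 : (1 - s) * κ 1 + s * κδ 1 = κ 1 + s * δ := by
        rw [hκδ1]
        ring
      rw [e1, e2]
      refine hball ?_
      rw [Metric.mem_ball, Real.dist_eq, sub_zero, abs_of_nonneg (mul_nonneg s.2.1 hδ0)]
      exact (mul_le_of_le_one_left hδ0 s.2.2).trans_lt hδ
    have hend := (isUnit_mul_transv_sub_one halt hA.2.2).2 hδne
    have hj2 := joinedIn_mul_transvPath halt (P := 1) hA (fun _ => isSp_one ω) rfl
      (w := w) (w' := ContinuousMap.const I (w 1))
      (κ := κδ) (κ' := ⟨fun t => t * (κ 1 + δ), by fun_prop⟩) hκδ0 (by simp) fun s => by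
        have e1 : (1 - s : ℝ) • w 1 + (s : ℝ) • w 1 = w 1 := by module
        have e2 : (1 - s) * (κ 1 + δ) + s * (κ 1 + δ) = κ 1 + δ := by ring
        simp only [ContinuousMap.const_apply, ContinuousMap.coe_mk, e1, hκδ1, Set.Icc.coe_one,
          one_mul, e2, ContinuousMap.one_apply, mul_one]
        exact hend
    rw [← linTransvPath_eq] at hj2
    have eone : ∀ B : C(I, E →L[ℝ] E), B * 1 = B := fun B => by
      ext1 t
      simp
    rw [eone, eone] at hj2
    rw [(pathComponentIn_eq_iff hj1.target_mem).2 hj1]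
    refine Relation.EqvGen.trans _ _ _ ?_ (ih hj2.source_mem hj1.target_mem)
    rw [(pathComponentIn_eq_iff hj2.target_mem).2 hj2]
    exact eqvGen_upRel_mul_linTransvPath halt hA hj2.target_mem

end UpRelation

section Factorization

open scoped unitInterval

/-- The rank one infinitesimal symplectic endomorphism `x ↦ ω(v, x) v`. -/
noncomputable def rankOneSkew [FiniteDimensional ℝ E] (ω : BilinForm ℝ E) (v : E) : E →L[ℝ] E :=
  (LinearMap.toContinuousLinearMap (ω v)).smulRight v

theorem rankOneSkew_apply [FiniteDimensional ℝ E] (ω : BilinForm ℝ E) (v x : E) :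
    rankOneSkew ω v x = ω v x • v := rfl

theorem IsCayley.add_smul_rankOneSkew [FiniteDimensional ℝ E] {ω : BilinForm ℝ E} (halt : ω.IsAlt)
    {N : E →L[ℝ] E} (hN : IsCayley ω N) (c : ℝ) (v : E) : IsCayley ω (N + c • rankOneSkew ω v) := by
  intro a b
  have h1 := hN a b
  simp only [add_apply, smul_apply, rankOneSkew_apply, map_add, map_smul, LinearMap.add_apply,
    LinearMap.smul_apply, smul_eq_mul, isAlt_skew halt a v]
  linarith

theorem ringInverse_apply_apply {N : E →L[ℝ] E} (h : IsUnit N) (x : E) :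
    Ring.inverse N (N x) = x :=
  congrArg (fun f : E →L[ℝ] E => f x) (Ring.inverse_mul_cancel _ h)

theorem apply_ringInverse_apply {N : E →L[ℝ] E} (h : IsUnit N) (x : E) :
    N (Ring.inverse N x) = x :=
  congrArg (fun f : E →L[ℝ] E => f x) (Ring.mul_inverse_cancel _ h)

theorem one_add_mul_form_ringInverse_ne_zero [FiniteDimensional ℝ E] {ω : BilinForm ℝ E}
    {N : E →L[ℝ] E} {c : ℝ} {v : E} (hu : IsUnit N)
    (hu' : IsUnit (N + c • rankOneSkew ω v)) : 1 + c * ω v (Ring.inverse N v) ≠ 0 := by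
  intro h
  have hx : (N + c • rankOneSkew ω v) (Ring.inverse N v) = 0 := by
    rw [add_apply, smul_apply, rankOneSkew_apply, apply_ringInverse_apply hu, smul_smul]
    nth_rewrite 1 [← one_smul ℝ v]
    rw [← add_smul, h, zero_smul]
  have h1 := ringInverse_apply_apply hu' (Ring.inverse N v)
  rw [hx, map_zero] at h1
  rw [← h1] at h
  simp at h

theorem IsCayley.one_add_ringInverse_add_smul [FiniteDimensional ℝ E] {ω : BilinForm ℝ E}
    {N : E →L[ℝ] E} (hN : IsCayley ω N) {c : ℝ} {v : E} (hu : IsUnit N) (hu1 : IsUnit (1 + N))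
    (hu' : IsUnit (N + c • rankOneSkew ω v)) :
    1 + Ring.inverse (N + c • rankOneSkew ω v) = (1 + Ring.inverse N) *
      transv ω (Ring.inverse (1 + N) v) (c / (1 + c * ω v (Ring.inverse N v))) := by
  have hd := one_add_mul_form_ringInverse_ne_zero hu hu'
  set w := Ring.inverse (1 + N) v with hw
  have hv : w + N w = v := apply_ringInverse_apply hu1 v
  set d := 1 + c * ω v (Ring.inverse N v) with hdef
  have hform : ∀ y, ω w (N y) = -ω v y := fun y => by
    have := hN w y
    rw [← hv, map_add, LinearMap.add_apply]
    linarith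
  have hNw : w + Ring.inverse N w = Ring.inverse N v := by
    rw [← hv, map_add, ringInverse_apply_apply hu, add_comm]
  ext x
  obtain ⟨y, rfl⟩ : ∃ y, N y = x := ⟨_, apply_ringInverse_apply hu x⟩
  rw [mul_apply_eq_comp, transv_apply, map_add, map_smul, hform]
  simp only [add_apply, one_apply_eq_self, hNw, ringInverse_apply_apply hu]
  rw [add_assoc, add_right_inj]
  refine (congrArg _ ?_).trans (ringInverse_apply_apply hu' _)
  simp only [add_apply, smul_apply, rankOneSkew_apply, map_add, map_smul,
    apply_ringInverse_apply hu]
  have h2 : c * ω v y + (c / d * -ω v y + c / d * -ω v y * c * ω v (Ring.inverse N v)) = 0 := by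
    have h3 : ω v (Ring.inverse N v) * c = d - 1 := by
      rw [hdef]
      ring
    field_simp
    linear_combination (-ω v y) * h3
  have h4 : ∀ a b q : ℝ, a + (b + b * c * q) = 0 → N y = N y + a • v + b • (v + c • q • v) :=
    fun a b q hab => by
      have : N y + a • v + b • (v + c • q • v) = N y + (a + (b + b * c * q)) • v := by module
      rw [this, hab, zero_smul, add_zero]
  rw [smul_smul c]
  exact h4 _ _ _ h2

theorem isCayley_neg_half (ω : BilinForm ℝ E) : IsCayley ω (-(1 / 2 : ℝ) • 1) := by
  intro a b
  simp only [smul_apply, one_apply_eq_self, map_smul, LinearMap.smul_apply, smul_eq_mul]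
  ring

theorem exists_transvWord_of_list [FiniteDimensional ℝ E] {ω : BilinForm ℝ E} (halt : ω.IsAlt)
    (L : List (C(E →L[ℝ] E, ℝ) × E)) (hL : ∀ p ∈ L, p.1 0 = 0) (N : C(E →L[ℝ] E, E →L[ℝ] E))
    (hN0 : N 0 = -(1 / 2 : ℝ) • 1) (hN : ∀ S, IsCayley ω (N S)) :
    ∃ U ∈ nhds (0 : E →L[ℝ] E), ∀ S : C(I, E →L[ℝ] E), S 0 = 0 → (∀ t, S t ∈ U) →
      ∃ P, IsTransvWord ω P ∧ ∀ t,
        1 + Ring.inverse (N (S t) + (L.map fun p => p.1 (S t) • rankOneSkew ω p.2).sum)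
          = (1 + Ring.inverse (N (S t))) * P t := by
  induction L generalizing N with
  | nil => exact ⟨Set.univ, Filter.univ_mem, fun S _ _ => ⟨1, IsTransvWord.one, fun t => by simp⟩⟩
  | cons p L ih =>
    obtain ⟨c, v⟩ := p
    have hc0 : c 0 = 0 := hL (c, v) List.mem_cons_self
    let N' : C(E →L[ℝ] E, E →L[ℝ] E) := ⟨fun S => N S + c S • rankOneSkew ω v, by fun_prop⟩
    have hN'0 : N' 0 = -(1 / 2 : ℝ) • 1 := by simp [N', hN0, hc0]
    obtain ⟨U, hU, hUP⟩ := ih (fun p hp => hL p (List.mem_cons_of_mem _ hp)) N' hN'0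
      (fun S => (hN S).add_smul_rankOneSkew halt _ _)
    have hunit : ∀ r : ℝ, r ≠ 0 → IsUnit (r • (1 : E →L[ℝ] E)) := fun r hr =>
      isUnit_of_forall_apply_eq_zero fun x hx => by simpa [hr] using hx
    have h1 : ∀ᶠ S in nhds (0 : E →L[ℝ] E), IsUnit (N S) :=
      N.continuous.continuousAt.eventually (Units.isOpen.mem_nhds (by
        rw [hN0]
        exact hunit _ (by norm_num)))
    have h2 : ∀ᶠ S in nhds (0 : E →L[ℝ] E), IsUnit (1 + N S) :=
      (continuous_const.add N.continuous).continuousAt.eventually (Units.isOpen.mem_nhds (by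
        have : 1 + N 0 = (1 / 2 : ℝ) • 1 := by
          rw [hN0]
          module
        change IsUnit (1 + N 0)
        rw [this]
        exact hunit _ (by norm_num)))
    have h3 : ∀ᶠ S in nhds (0 : E →L[ℝ] E), IsUnit (N' S) :=
      N'.continuous.continuousAt.eventually (Units.isOpen.mem_nhds (by
        rw [hN'0]
        exact hunit _ (by norm_num)))
    refine ⟨_, Filter.inter_mem hU (h1.and (h2.and h3)), fun S hS0 hS => ?_⟩
    obtain ⟨P, hP, hPt⟩ := hUP S hS0 fun t => (hS t).1
    have hSc := S.continuous
    have hNS : Continuous fun t => N (S t) := N.continuous.comp hSc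
    have hcS : Continuous fun t => c (S t) := c.continuous.comp hSc
    have hinv : Continuous fun t => Ring.inverse (N (S t)) :=
      continuous_ringInverse hNS fun t => (hS t).2.1
    let w : C(I, E) := ⟨fun t => Ring.inverse (1 + N (S t)) v,
      (continuous_ringInverse (continuous_const.add hNS) fun t => (hS t).2.2.1).clm_apply
        continuous_const⟩
    let κ : C(I, ℝ) := ⟨fun t => c (S t) / (1 + c (S t) * ω v (Ring.inverse (N (S t)) v)),
      hcS.div (continuous_const.add (hcS.mul (continuous_form_apply ω continuous_const
        (hinv.clm_apply continuous_const)))) fun t =>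
          one_add_mul_form_ringInverse_ne_zero (hS t).2.1 (hS t).2.2.2⟩
    refine ⟨transvPath ω w κ * P, IsTransvWord.mul_left w κ ?_ P hP, fun t => ?_⟩
    · simp [κ, hS0, hc0]
    · rw [List.map_cons, List.sum_cons, ← add_assoc]
      refine (hPt t).trans ?_
      rw [ContinuousMap.mul_apply, ← mul_assoc]
      refine congrArg (· * P t) ?_
      exact (hN (S t)).one_add_ringInverse_add_smul (hS t).2.1 (hS t).2.2.1 (hS t).2.2.2

/-- The functions on the endomorphisms that are combinations of rank one elements of the Lie algebra
with continuous coefficients vanishing at `0`. -/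
def IsRankOneSum [FiniteDimensional ℝ E] (ω : BilinForm ℝ E) (F : (E →L[ℝ] E) → E →L[ℝ] E) :
    Prop :=
  ∃ L : List (C(E →L[ℝ] E, ℝ) × E), (∀ p ∈ L, p.1 0 = 0) ∧
    ∀ S, (L.map fun p => p.1 S • rankOneSkew ω p.2).sum = F S

theorem IsRankOneSum.smul [FiniteDimensional ℝ E] (ω : BilinForm ℝ E) (c : C(E →L[ℝ] E, ℝ))
    (hc : c 0 = 0) (v : E) : IsRankOneSum ω fun S => c S • rankOneSkew ω v :=
  ⟨[(c, v)], by simpa using hc, fun S => by simp⟩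

theorem IsRankOneSum.add [FiniteDimensional ℝ E] {ω : BilinForm ℝ E}
    {F F' : (E →L[ℝ] E) → E →L[ℝ] E} (hF : IsRankOneSum ω F) (hF' : IsRankOneSum ω F') :
    IsRankOneSum ω fun S => F S + F' S := by
  obtain ⟨L, hL, h⟩ := hF
  obtain ⟨L', hL', h'⟩ := hF'
  refine ⟨L ++ L', fun p hp => ?_, fun S => by rw [List.map_append, List.sum_append, h, h']⟩
  rcases List.mem_append.1 hp with hp | hp
  · exact hL p hp
  · exact hL' p hp

theorem IsRankOneSum.sum [FiniteDimensional ℝ E] {ω : BilinForm ℝ E} {ι : Type*} (s : Finset ι)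
    {F : ι → (E →L[ℝ] E) → E →L[ℝ] E} (hF : ∀ i, IsRankOneSum ω (F i)) :
    IsRankOneSum ω fun S => ∑ i ∈ s, F i S := by
  classical
  induction s using Finset.induction_on with
  | empty => exact ⟨[], by simp, fun S => by simp⟩
  | insert i s hi ih =>
    simp only [Finset.sum_insert hi]
    exact (hF i).add ih

theorem exists_isRankOneSum_eq_self [FiniteDimensional ℝ E] {ω : BilinForm ℝ E} (halt : ω.IsAlt)
    (hnd : ω.Nondegenerate) : ∃ F, IsRankOneSum ω F ∧
      ∀ S : E →L[ℝ] E, (∀ x y, ω (S x) y + ω x (S y) = 0) → F S = S := by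
  let b := Module.finBasis ℝ E
  let f : Fin (Module.finrank ℝ E) → E := fun j => (BilinForm.toDual ω hnd).symm (b.coord j)
  have hf : ∀ j x, ω (f j) x = b.coord j x := fun j x => BilinForm.apply_toDual_symm_apply _ _
  let c : Fin (Module.finrank ℝ E) → Fin (Module.finrank ℝ E) → ℝ → C(E →L[ℝ] E, ℝ) :=
    fun i j r => ⟨fun S => r * b.coord i (S (b j)), continuous_const.mul
      ((LinearMap.continuous_of_finiteDimensional _).comp (by fun_prop))⟩
  have hc : ∀ i j r S, c i j r S = r * b.coord i (S (b j)) := fun _ _ _ _ => rfl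
  refine ⟨fun S => ∑ i, ∑ j, (c i j (1 / 2) S • rankOneSkew ω (f j + b i)
    + c i j (-(1 / 2)) S • rankOneSkew ω (f j) + c i j (-(1 / 2)) S • rankOneSkew ω (b i)),
    IsRankOneSum.sum _ fun i => IsRankOneSum.sum _ fun j => ((IsRankOneSum.smul ω _ (by simp [hc])
      _).add (IsRankOneSum.smul ω _ (by simp [hc]) _)).add (IsRankOneSum.smul ω _ (by simp [hc]) _),
    fun S hS => ?_⟩
  ext x
  have hterm : ∀ i j, (c i j (1 / 2) S • rankOneSkew ω (f j + b i)
      + c i j (-(1 / 2)) S • rankOneSkew ω (f j) + c i j (-(1 / 2)) S • rankOneSkew ω (b i)) x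
      = (1 / 2 : ℝ) • (b.coord j x • b.coord i (S (b j)) • b i)
        + (1 / 2 : ℝ) • (b.coord i (S (b j)) • ω (b i) x • f j) := by
    intro i j
    simp only [add_apply, smul_apply, rankOneSkew_apply, map_add, LinearMap.add_apply, hc, hf]
    module
  have hsum : ∀ y, ∑ i, b.coord i y • b i = y := fun y => b.sum_repr y
  have hdual : ∀ y, ∑ j, ω (b j) y • f j = -y := by
    intro y
    refine eq_neg_of_add_eq_zero_left (eq_zero_of_forall_form_eq_zero hnd fun z => ?_)
    have h1 : ∑ j, ω (b j) y * b.coord j z = ω z y := by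
      conv_rhs => rw [← hsum z]
      simp only [map_sum, LinearMap.sum_apply, map_smul, LinearMap.smul_apply, smul_eq_mul, mul_comm]
    simp only [map_add, map_sum, map_smul, LinearMap.add_apply, LinearMap.sum_apply,
      LinearMap.smul_apply, smul_eq_mul, hf, h1]
    rw [isAlt_skew halt z y]
    ring
  have h1 : ∑ j, ∑ i, b.coord j x • b.coord i (S (b j)) • b i = S x := by
    simp only [← Finset.smul_sum, hsum]
    conv_rhs => rw [← hsum x]
    simp only [map_sum, map_smul]
  have h2 : ∑ j, ∑ i, b.coord i (S (b j)) • ω (b i) x • f j = S x := by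
    have h3 : ∀ j, ∑ i, b.coord i (S (b j)) • ω (b i) x • f j = -(ω (b j) (S x) • f j) := by
      intro j
      have h4 : ∑ i, b.coord i (S (b j)) * ω (b i) x = ω (S (b j)) x := by
        conv_rhs => rw [← hsum (S (b j))]
        simp only [map_sum, LinearMap.sum_apply, map_smul, LinearMap.smul_apply, smul_eq_mul]
      simp only [smul_smul, ← Finset.sum_smul, h4]
      rw [eq_neg_of_add_eq_zero_left (hS (b j) x), neg_smul]
    simp only [h3, Finset.sum_neg_distrib, hdual, neg_neg]
  simp only [sum_apply, hterm]
  rw [Finset.sum_comm]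
  have h3 : (1 / 2 : ℝ) • S x + (1 / 2 : ℝ) • S x = S x := by module
  rw [← h3]
  nth_rewrite 1 [← h1]
  rw [← h2]
  simp only [Finset.sum_add_distrib, Finset.smul_sum]

theorem exists_nhds_one_isTransvWord [FiniteDimensional ℝ E] {ω : BilinForm ℝ E} (halt : ω.IsAlt)
    (hnd : ω.Nondegenerate) : ∃ U ∈ nhds (1 : E →L[ℝ] E), ∀ C : C(I, E →L[ℝ] E),
      (∀ t, IsSp ω (C t)) → C 0 = 1 → (∀ t, C t ∈ U) → IsTransvWord ω C := by
  obtain ⟨F, ⟨L, hL, hLF⟩, hF⟩ := exists_isRankOneSum_eq_self halt hnd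
  obtain ⟨U, hU, hUP⟩ := exists_transvWord_of_list halt L hL
    (ContinuousMap.const _ (-(1 / 2 : ℝ) • 1)) rfl (fun _ => isCayley_neg_half ω)
  have hinv : ∀ r s : ℝ, r * s = 1 → ∀ a : (E →L[ℝ] E), a = r • 1 → Ring.inverse a = s • 1 := by
    rintro r s hrs a rfl
    have e1 : (r • (1 : E →L[ℝ] E)) * (s • 1) = 1 := by
      rw [smul_mul_smul_comm, hrs, one_smul, mul_one]
    have e2 : (s • (1 : E →L[ℝ] E)) * (r • 1) = 1 := by
      rw [smul_mul_smul_comm, mul_comm, hrs, one_smul, mul_one]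
    exact Ring.inverse_unit ⟨_, _, e1, e2⟩
  have hu : IsUnit (1 + 1 : E →L[ℝ] E) := by
    refine isUnit_of_forall_apply_eq_zero fun x hx => ?_
    have : (2 : ℝ) • x = 0 := by
      rw [two_smul]
      exact hx
    simpa using this
  have h0 : (1 / 2 : ℝ) • 1 - Ring.inverse (1 + 1 : E →L[ℝ] E) = 0 := by
    rw [hinv 2 (1 / 2) (by norm_num) _ (by module), sub_self]
  have hcont : ContinuousAt (fun B : E →L[ℝ] E => (1 / 2 : ℝ) • 1 - Ring.inverse (1 + B)) 1 := by
    obtain ⟨v, hv⟩ := hu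
    have h := NormedRing.inverse_continuousAt v
    rw [hv] at h
    refine continuousAt_const.sub (ContinuousAt.comp (f := fun B : E →L[ℝ] E => 1 + B) h ?_)
    fun_prop
  have h1 : ∀ᶠ B in nhds (1 : E →L[ℝ] E), (1 / 2 : ℝ) • 1 - Ring.inverse (1 + B) ∈ U := by
    refine hcont.eventually ?_
    change U ∈ nhds ((1 / 2 : ℝ) • 1 - Ring.inverse (1 + 1 : E →L[ℝ] E))
    rw [h0]
    exact hU
  have h2 : ∀ᶠ B in nhds (1 : E →L[ℝ] E), IsUnit (1 + B) := by
    have h : Continuous fun B : E →L[ℝ] E => 1 + B := by fun_prop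
    exact h.continuousAt.eventually (Units.isOpen.mem_nhds hu)
  refine ⟨_, h1.and h2, fun C hC hC0 hCU => ?_⟩
  let S : C(I, E →L[ℝ] E) := ⟨fun t => (1 / 2 : ℝ) • 1 - Ring.inverse (1 + C t),
    continuous_const.sub (continuous_ringInverse (continuous_const.add C.continuous)
      fun t => (hCU t).2)⟩
  obtain ⟨P, hP, hPt⟩ := hUP S (by simp only [S, ContinuousMap.coe_mk, hC0, h0])
    fun t => (hCU t).1
  have hCP : C = P := by
    ext1 t
    have hS : ∀ x y, ω (S t x) y + ω x (S t y) = 0 := by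
      intro x y
      obtain ⟨a, rfl⟩ : ∃ a, (1 + C t) a = x := ⟨_, apply_ringInverse_apply (hCU t).2 x⟩
      obtain ⟨b, rfl⟩ : ∃ b, (1 + C t) b = y := ⟨_, apply_ringInverse_apply (hCU t).2 y⟩
      have hSx : ∀ a, S t ((1 + C t) a) = (1 / 2 : ℝ) • (1 + C t) a - a := fun a => by
        simp only [S, ContinuousMap.coe_mk, sub_apply, smul_apply, one_apply_eq_self,
          ringInverse_apply_apply (hCU t).2]
      rw [hSx, hSx]
      have := hC t a b
      simp only [add_apply, one_apply_eq_self, map_add, map_sub, map_smul, LinearMap.add_apply,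
        LinearMap.sub_apply, LinearMap.smul_apply, smul_eq_mul]
      linarith
    have h := hPt t
    rw [hLF, hF _ hS, ContinuousMap.const_apply,
      hinv (-(1 / 2)) (-2) (by norm_num) _ rfl] at h
    have e1 : -(1 / 2 : ℝ) • 1 + S t = -Ring.inverse (1 + C t) := by
      simp only [S, ContinuousMap.coe_mk]
      module
    have e2 : (1 : E →L[ℝ] E) + (-2 : ℝ) • 1 = -1 := by module
    have e3 : Ring.inverse (-Ring.inverse (1 + C t)) = -(1 + C t) := by
      obtain ⟨v, hv⟩ := (hCU t).2
      rw [← hv, Ring.inverse_unit, ← Units.val_neg, Ring.inverse_unit, ← Units.val_neg, inv_neg,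
        inv_inv]
    rw [e1, e3, e2, neg_one_mul, neg_add, add_neg_cancel_left] at h
    exact neg_injective h
  rw [hCP]
  exact hP

end Factorization

section Classification

open scoped unitInterval

theorem isTransvWord_of_isSp [FiniteDimensional ℝ E] {ω : BilinForm ℝ E} (halt : ω.IsAlt)
    (hnd : ω.Nondegenerate) {C : C(I, E →L[ℝ] E)} (hC : ∀ t, IsSp ω (C t)) (h0 : C 0 = 1) :
    IsTransvWord ω C := by
  obtain ⟨U, hU, hUC⟩ := exists_nhds_one_isTransvWord halt hnd
  have hu : ∀ t, IsUnit (C t) := fun t => (hC t).isUnit hnd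
  let Φ : C(I × I, E →L[ℝ] E) := ⟨fun p => Ring.inverse (C p.1) * C p.2,
    (continuous_ringInverse (C.continuous.comp continuous_fst) fun p => hu p.1).mul
      (C.continuous.comp continuous_snd)⟩
  obtain ⟨ε, hε, hεU⟩ := Metric.mem_nhds_iff.1 hU
  obtain ⟨δ, hδ, hδΦ⟩ := Metric.uniformContinuous_iff.1
    (CompactSpace.uniformContinuous_of_continuous Φ.continuous) ε hε
  have hΦU : ∀ s t : I, dist t s < δ → Φ (s, t) ∈ U := fun s t hst => by
    have h1 : Φ (s, s) = 1 := Ring.inverse_mul_cancel _ (hu s)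
    have h2 := hδΦ (a := (s, t)) (b := (s, s)) (by simpa [Prod.dist_eq] using hst)
    rw [h1] at h2
    exact hεU h2
  let a : ℕ → I := fun k => Set.projIcc 0 1 zero_le_one (k * (δ / 2))
  let m : ℕ → C(I, I) := fun k => ⟨fun t => min t (a k), by fun_prop⟩
  have ha : ∀ (k : ℕ) (t : I), dist (m (k + 1) t) (m k t) < δ := fun k t => by
    have h1 : |min (t : ℝ) (a (k + 1)) - min (t : ℝ) (a k)| ≤ |(a (k + 1) : ℝ) - a k| := by
      simpa using abs_min_sub_min_le_max (t : ℝ) (a (k + 1)) t (a k)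
    have h2 : |(a (k + 1) : ℝ) - a k| ≤ |((k + 1 : ℕ) : ℝ) * (δ / 2) - k * (δ / 2)| :=
      Set.abs_projIcc_sub_projIcc _
    have h3 : ((k + 1 : ℕ) : ℝ) * (δ / 2) - k * (δ / 2) = δ / 2 := by
      push_cast
      ring
    rw [h3, abs_of_pos (half_pos hδ)] at h2
    exact lt_of_le_of_lt (h1.trans h2) (half_lt_self hδ)
  have hword : ∀ k, IsTransvWord ω (C.comp (m k)) := by
    intro k
    induction k with
    | zero =>
      have h : C.comp (m 0) = 1 := by
        ext1 t
        have h1 : a 0 = 0 := by simp [a]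
        simp [m, h1, h0]
      rw [h]
      exact IsTransvWord.one
    | succ k ih =>
      have h : C.comp (m (k + 1)) = C.comp (m k) * Φ.comp ((m k).prodMk (m (k + 1))) := by
        ext1 t
        simp only [ContinuousMap.mul_apply, ContinuousMap.comp_apply, Φ, ContinuousMap.coe_mk,
          ContinuousMap.prod_eval]
        rw [← mul_assoc, Ring.mul_inverse_cancel _ (hu _), one_mul]
      rw [h]
      refine ih.mul (hUC _ (fun t => ?_) ?_ fun t => hΦU _ _ (ha k t))
      · exact ((hC _).ringInverse (hu _)).mul (hC _)
      · have h1 : ∀ j, m j 0 = 0 := fun j => min_eq_left (a j).2.1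
        simp only [ContinuousMap.comp_apply, ContinuousMap.prod_eval, h1]
        exact Ring.inverse_mul_cancel _ (hu 0)
  obtain ⟨k, hk⟩ := exists_nat_gt (1 / (δ / 2))
  have h1 : a k = 1 := by
    refine Set.projIcc_of_right_le _ ?_
    rw [div_lt_iff₀ (half_pos hδ)] at hk
    exact hk.le
  have h2 : C.comp (m k) = C := by
    ext1 t
    have h3 : min t (1 : I) = t := min_eq_left t.2.2
    simp [m, h1, h3]
  rw [← h2]
  exact hword k

theorem joinedIn_ndPath_of_muIndex_eq [FiniteDimensional ℝ E] {ω : BilinForm ℝ E} (halt : ω.IsAlt)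
    (hnd : ω.Nondegenerate) {A B : C(I, E →L[ℝ] E)} (hA : A ∈ ndPath ω) (hB : B ∈ ndPath ω)
    (h : muIndex ω A = muIndex ω B) : JoinedIn (ndPath ω) A B := by
  have hu : ∀ t, IsUnit (A t) := fun t => (hA.1 t).isUnit hnd
  let C : C(I, E →L[ℝ] E) := ⟨fun t => Ring.inverse (A t) * B t,
    (continuous_ringInverse A.continuous hu).mul B.continuous⟩
  have hC : IsTransvWord ω C := isTransvWord_of_isSp halt hnd
    (fun t => ((hA.1 t).ringInverse (hu t)).mul (hB.1 t)) (by simp [C, hA.2.1, hB.2.1])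
  have hAC : A * C = B := by
    ext1 t
    simp only [C, ContinuousMap.mul_apply, ContinuousMap.coe_mk]
    rw [← mul_assoc, Ring.mul_inverse_cancel _ (hu t), one_mul]
  have h1 := eqvGen_upRel_mul halt hC hA (by rwa [hAC])
  rw [hAC] at h1
  exact JoinedIn.of_eqvGen_upRel halt hnd hA hB h1 h

theorem ker_sub_id_eq_bot_iff [FiniteDimensional ℝ E] {B : E →L[ℝ] E} :
    LinearMap.ker ((B : E →ₗ[ℝ] E) - LinearMap.id) = ⊥ ↔ IsUnit (B - 1) := by
  rw [isUnit_sub_one_iff, LinearMap.ker_eq_bot']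
  simp only [LinearMap.sub_apply, LinearMap.id_apply, sub_eq_zero, ContinuousLinearMap.coe_coe]

/-- The restriction of a symplectic path to the unit interval. -/
def IsSymplecticPath.toContinuousMap {ω : BilinForm ℝ E} {A : ℝ → E →L[ℝ] E}
    (hA : IsSymplecticPath ω 0 1 A) : C(I, E →L[ℝ] E) :=
  ⟨fun t => A t, continuousOn_iff_continuous_domRestrict.1 hA.cont⟩

theorem IsSymplecticPath.toContinuousMap_mem [FiniteDimensional ℝ E] {ω : BilinForm ℝ E}
    {A : ℝ → E →L[ℝ] E} (hA : IsSymplecticPath ω 0 1 A) (hA0 : A 0 = ContinuousLinearMap.id ℝ E)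
    (hker : LinearMap.ker ((A 1 : E →ₗ[ℝ] E) - LinearMap.id) = ⊥) :
    hA.toContinuousMap ∈ ndPath ω :=
  ⟨fun t => hA.symp t t.2, hA0, ker_sub_id_eq_bot_iff.1 hker⟩

theorem IsSymplecticPath.nonempty_admissibleData [FiniteDimensional ℝ E] {ω : BilinForm ℝ E}
    (halt : ω.IsAlt) (hnd : ω.Nondegenerate) {A : ℝ → E →L[ℝ] E}
    (hA : IsSymplecticPath ω 0 1 A) : Nonempty (AdmissibleData (prodNegForm ω) 0 1
      (fun _ => diagSub) (fun t => graphSub (A t))) :=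
  exists_admissibleData halt hnd (A := Set.IccExtend zero_le_one hA.toContinuousMap)
    hA.toContinuousMap.continuous.Icc_extend' (fun _ => hA.symp _ (Subtype.prop _))
    fun _ ht => (Set.IccExtend_of_mem zero_le_one hA.toContinuousMap ht).symm

end Classification

/-- `μ` classifies the nondegenerate components: two continuous paths
`A, A' : [0,1] → Sp(E)` with `A(0) = A'(0) = I` and `ker(A(1) − I) = ker(A'(1) − I) = 0` can be
joined by a continuous homotopy `H : [0,1] × [0,1] → Sp(E)` with `H(s,0) = I` and
`ker(H(s,1) − I) = 0` for all `s` if and only if `μ(A) = μ(A')`, where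
`μ(A) = [const_Δ : Γ_{A(t)}]` in `E × E⁻` is computed from arbitrary admissible data. -/
theorem mu_classifies_components [FiniteDimensional ℝ E]
    (ω : BilinForm ℝ E) (halt : LinearMap.IsAlt ω)
    (hnd : LinearMap.BilinForm.Nondegenerate ω)
    (A A' : ℝ → E →L[ℝ] E)
    (hA : IsSymplecticPath ω 0 1 A) (hA' : IsSymplecticPath ω 0 1 A')
    (hA0 : A 0 = ContinuousLinearMap.id ℝ E) (hA'0 : A' 0 = ContinuousLinearMap.id ℝ E)
    (hker : LinearMap.ker ((A 1 : E →ₗ[ℝ] E) - LinearMap.id) = ⊥)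
    (hker' : LinearMap.ker ((A' 1 : E →ₗ[ℝ] E) - LinearMap.id) = ⊥) :
    (∃ H : ℝ → ℝ → E →L[ℝ] E,
        ContinuousOn (fun p : ℝ × ℝ => H p.1 p.2) (Set.Icc 0 1 ×ˢ Set.Icc 0 1) ∧
        (∀ s ∈ Set.Icc (0:ℝ) 1, ∀ t ∈ Set.Icc (0:ℝ) 1, Function.Bijective (H s t)) ∧
        (∀ s ∈ Set.Icc (0:ℝ) 1, ∀ t ∈ Set.Icc (0:ℝ) 1,
          ∀ x y, ω (H s t x) (H s t y) = ω x y) ∧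
        H 0 = A ∧ H 1 = A' ∧
        (∀ s ∈ Set.Icc (0:ℝ) 1, H s 0 = ContinuousLinearMap.id ℝ E) ∧
        (∀ s ∈ Set.Icc (0:ℝ) 1,
          LinearMap.ker ((H s 1 : E →ₗ[ℝ] E) - LinearMap.id) = ⊥)) ↔
    (∀ D : AdmissibleData (prodNegForm ω) 0 1 (fun _ => diagSub)
        (fun t => graphSub (A t)),
      ∀ D' : AdmissibleData (prodNegForm ω) 0 1 (fun _ => diagSub)
        (fun t => graphSub (A' t)),
      dataSum D = dataSum D') := by
  have hmem := hA.toContinuousMap_mem hA0 hker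
  have hmem' := hA'.toContinuousMap_mem hA'0 hker'
  constructor
  · rintro ⟨H, hHc, -, hsp, h0, h1, hs, hu⟩ D D'
    rw [dataSum_eq_muIndex halt hnd hmem (fun _ => rfl) D,
      dataSum_eq_muIndex halt hnd hmem' (fun _ => rfl) D']
    refine JoinedIn.muIndex_eq halt hnd (joinedIn_ndPath
      (fun p : unitInterval × unitInterval => H p.1 p.2) ?_ (fun t => by simp [h0]; rfl)
      (fun t => by simp [h1]; rfl) (fun p => hsp _ p.1.2 _ p.2.2) (fun s => hs s s.2)
      fun s => ker_sub_id_eq_bot_iff.1 (hu s s.2))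
    exact hHc.comp_continuous (f := fun p : unitInterval × unitInterval => ((p.1 : ℝ), (p.2 : ℝ)))
      (by fun_prop) fun p => ⟨p.1.2, p.2.2⟩
  · intro h
    obtain ⟨D⟩ := hA.nonempty_admissibleData halt hnd
    obtain ⟨D'⟩ := hA'.nonempty_admissibleData halt hnd
    have hmu := h D D'
    rw [dataSum_eq_muIndex halt hnd hmem (fun _ => rfl) D,
      dataSum_eq_muIndex halt hnd hmem' (fun _ => rfl) D'] at hmu
    obtain ⟨γ, hγ⟩ := joinedIn_ndPath_of_muIndex_eq halt hnd hmem hmem' hmu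
    let G : ℝ → ℝ → E →L[ℝ] E :=
      fun s t => γ (Set.projIcc 0 1 zero_le_one s) (Set.projIcc 0 1 zero_le_one t)
    have hG : Continuous fun p : ℝ × ℝ => G p.1 p.2 := by
      have hp : Continuous fun p : ℝ × ℝ => (γ (Set.projIcc 0 1 zero_le_one p.1),
          Set.projIcc (0:ℝ) 1 zero_le_one p.2) :=
        (γ.continuous.comp (continuous_projIcc.comp continuous_fst)).prodMk
          (continuous_projIcc.comp continuous_snd)
      exact ContinuousEval.continuous_eval.comp hp
    obtain ⟨H, hH0, hH1, hHG⟩ : ∃ H : ℝ → ℝ → E →L[ℝ] E, H 0 = A ∧ H 1 = A' ∧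
        ∀ s, ∀ t ∈ Set.Icc (0:ℝ) 1, H s t = G s t := by
      refine ⟨Function.update (Function.update G 0 A) 1 A', by simp, by simp, fun s t ht => ?_⟩
      rcases eq_or_ne s 1 with rfl | hs1
      · simp only [Function.update_self, G, Set.projIcc_right, Set.Icc.mk_one, γ.target,
          Set.projIcc_of_mem zero_le_one ht]
        rfl
      rcases eq_or_ne s 0 with rfl | hs0
      · simp only [Function.update_self, Function.update_of_ne hs1, G, Set.projIcc_left,
          Set.Icc.mk_zero, γ.source, Set.projIcc_of_mem zero_le_one ht]
        rfl
      · rw [Function.update_of_ne hs1, Function.update_of_ne hs0]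
    have h0 : (0:ℝ) ∈ Set.Icc (0:ℝ) 1 := Set.left_mem_Icc.2 zero_le_one
    have h1 : (1:ℝ) ∈ Set.Icc (0:ℝ) 1 := Set.right_mem_Icc.2 zero_le_one
    have hsp : ∀ s, ∀ t ∈ Set.Icc (0:ℝ) 1, IsSp ω (H s t) := fun s t ht => by
      rw [hHG s t ht]
      exact (hγ _).1 _
    refine ⟨H, hG.continuousOn.congr fun p hp => hHG _ _ hp.2, fun s _ t ht => ?_,
      fun s _ t ht => hsp s t ht, hH0, hH1, fun s _ => ?_, fun s _ => ?_⟩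
    · have hu := (hsp s t ht).isUnit hnd
      exact Function.bijective_iff_has_inverse.2 ⟨⇑(Ring.inverse (H s t)),
        ringInverse_apply_apply hu, apply_ringInverse_apply hu⟩
    · rw [hHG s 0 h0]
      simp only [G, Set.projIcc_left, Set.Icc.mk_zero]
      exact (hγ _).2.1
    · rw [ker_sub_id_eq_bot_iff, hHG s 1 h1]
      simp only [G, Set.projIcc_right, Set.Icc.mk_one]
      exact (hγ _).2.2
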